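/- arXiv:2001.11703 — 6 statements merged into one kernel-verified Lean document; each statement's English description precedes it below -/
import Mathlib

section
/- Let D be a digraph of order n and let W be a nonempty subset of V(D). If the minimum semi-degree of W in D satisfies δ⁰(W) ≥ n/2, then W is cyclable in D, i.e., D contains a directed cycle passing through every vertex of W. -/
/-- Out-degree of `v` in the digraph with arc relation `A`. -/
noncomputable def outDeg {V : Type*} (A : V → V → Prop) (v : V) : ℕ :=
  {w | A v w}.ncard

/-- In-degree of `v` in the digraph with arc relation `A`. -/
noncomputable def inDeg {V : Type*} (A : V → V → Prop) (v : V) : ℕ :=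
  {w | A w v}.ncard

/-- `l` is the (nonrepeating) vertex list of a directed cycle of the digraph
with arc relation `A`; directed cycles have at least two vertices. -/
def IsDicycle {V : Type*} (A : V → V → Prop) (l : List V) : Prop :=
  2 ≤ l.length ∧ l.Nodup ∧
    ∀ i : Fin l.length,
      A (l.get i) (l.get ⟨((i : ℕ) + 1) % l.length, Nat.mod_lt _ i.pos⟩)

open Classical in
/-- number of arcs between `w` and `v` -/
noncomputable def arcs {V : Type*} (A : V → V → Prop) (w v : V) : ℕ :=
  (if A w v then 1 else 0) + (if A v w then 1 else 0)

theorem exists_min_meas {α : Type*} (P : α → Prop) (μ : α → ℕ) (h : ∃ a, P a) :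
    ∃ a, P a ∧ ∀ b, P b → μ a ≤ μ b := by
  obtain ⟨a, ha, hm⟩ := (measure μ).wf.has_min {a | P a} h
  exact ⟨a, ha, fun b hb => not_lt.mp (hm b hb)⟩

theorem noninsert_bound {V : Type*} (A : V → V → Prop) (w s : V) :
    ∀ (l : List V) (a : V), (a :: l).getLast? = some s →
      (∀ l1 l2 u v, a :: l = l1 ++ u :: v :: l2 → ¬ (A u w ∧ A w v)) →
      ((a :: l).map (arcs A w)).sum ≤ l.length
        + (arcs A w a - (open Classical in if A a w then 1 else 0))
        + (open Classical in if A s w then 1 else 0) := by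
  classical
  intro l
  induction l with
  | nil =>
    intro a hs _
    simp at hs
    subst hs
    simp [arcs]
  | cons b l ih =>
    intro a hs h
    have h1 := ih b (by simpa using hs) (fun l1 l2 u v e => h (a :: l1) l2 u v (by simp [e]))
    have h2 := h [] l a b rfl
    rw [List.map_cons, List.sum_cons]
    simp only [List.length_cons, arcs] at h1 ⊢
    split_ifs at h1 ⊢ <;> first | omega | (exfalso; tauto)

theorem inter_exists {V : Type*} [Fintype V] [DecidableEq V] (X Y E F : Finset V)
    (h : Fintype.card V ≤ X.card + Y.card) (hX : Disjoint X E) (hY : Disjoint Y E)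
    (hF : F.card < E.card) : ∃ x, x ∈ X ∧ x ∈ Y ∧ x ∉ F := by
  have h1 : (X ∪ Y).card + E.card ≤ Fintype.card V := by
    rw [← Finset.card_union_of_disjoint (Finset.disjoint_union_left.mpr ⟨hX, hY⟩)]
    exact Finset.card_le_univ _
  have h2 := Finset.card_union_add_card_inter X Y
  obtain ⟨x, hx, hxF⟩ := Finset.exists_mem_notMem_of_card_lt_card
    (show F.card < (X ∩ Y).card by omega)
  rw [Finset.mem_inter] at hx
  exact ⟨x, hx.1, hx.2, hxF⟩

theorem conn {V : Type*} [Fintype V] (A : V → V → Prop) (hA : ∀ v, ¬ A v v) (C : List V)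
    (c y f : V) (hc : c ∈ C) (hy : y ∉ C)
    (hd : Fintype.card V ≤ outDeg A c + inDeg A y) :
    ∃ s ∈ C, A s y ∨ ∃ x, x ∉ C ∧ x ≠ f ∧ x ≠ y ∧ A s x ∧ A x y := by
  classical
  by_cases hcy : A c y
  · exact ⟨c, hc, Or.inl hcy⟩
  have hne : c ≠ y := fun e => hy (e ▸ hc)
  obtain ⟨x, hx1, hx2, hx3⟩ := inter_exists (Finset.univ.filter (A c ·))
    (Finset.univ.filter (A · y)) {c, y} {f}
    (by
      simp only [outDeg, inDeg, Set.ncard_eq_toFinset_card'] at hd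
      simpa using hd)
    (by simp [hcy, hA]) (by simp [hcy, hA]) (by simp [hne])
  simp at hx1 hx2 hx3
  by_cases hxC : x ∈ C
  · exact ⟨x, hxC, Or.inl hx2⟩
  · exact ⟨c, hc, Or.inr ⟨x, hxC, hx3, fun e => hA y (e ▸ hx2), hx1, hx2⟩⟩

/-- A bypass of the cycle `C` through `y`, skipping the segment `G`. -/
structure Conf {V : Type*} (A : V → V → Prop) (C : List V) (y : V)
    (Q G L R : List V) (s t : V) : Prop where
  rot : Q ++ G ~r C
  hs : Q.getLast? = some s
  ht : Q.head? = some t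
  lL : L.length ≤ 1
  lR : R.length ≤ 1
  cL : List.IsChain A (s :: (L ++ [y]))
  cR : List.IsChain A (y :: (R ++ [t]))
  nd : (L ++ y :: R).Nodup
  dj : ∀ v ∈ L ++ y :: R, v ∉ C

theorem exists_conf {V : Type*} [Fintype V] (A : V → V → Prop) (hA : ∀ v, ¬ A v v) (C : List V)
    (c y : V) (hc : c ∈ C) (hy : y ∉ C)
    (hd : Fintype.card V ≤ outDeg A c + inDeg A y)
    (hd' : Fintype.card V ≤ inDeg A c + outDeg A y) :
    ∃ Q G L R s t, Conf A C y Q G L R s t := by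
  obtain ⟨s, hs, L, hL1, hL2, hL3, hL4⟩ : ∃ s ∈ C, ∃ L : List V, L.length ≤ 1 ∧
      List.IsChain A (s :: (L ++ [y])) ∧ y ∉ L ∧ ∀ v ∈ L, v ∉ C := by
    obtain ⟨s, hs, h | ⟨x, h1, h2, h3, h4, h5⟩⟩ := conn A hA C c y y hc hy hd
    · exact ⟨s, hs, [], by simp, by simpa, by simp, by simp⟩
    · exact ⟨s, hs, [x], by simp, by simp [h4, h5], by simpa using h3.symm, by simpa using h1⟩
  obtain ⟨f, hf⟩ : ∃ f, ∀ v ∈ L, v = f := by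
    match L, hL1 with
    | [], _ => exact ⟨y, by simp⟩
    | [x], _ => exact ⟨x, by simp⟩
  obtain ⟨t, ht, R, hR1, hR2, hR3, hR4, hR5⟩ : ∃ t ∈ C, ∃ R : List V, R.length ≤ 1 ∧
      List.IsChain A (y :: (R ++ [t])) ∧ y ∉ R ∧ (∀ v ∈ R, v ∉ C) ∧ f ∉ R := by
    obtain ⟨s, hs, h | ⟨x, h1, h2, h3, h4, h5⟩⟩ := conn (fun a b => A b a) hA C c y f hc hy hd'
    · exact ⟨s, hs, [], by simp, by simpa, by simp, by simp, by simp⟩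
    · exact ⟨s, hs, [x], by simp, by simp [h4, h5], by simpa using h3.symm, by simpa using h1,
        by simpa using h2.symm⟩
  obtain ⟨C1, C2, rfl⟩ := List.append_of_mem ht
  have hs' : s ∈ t :: C2 ++ C1 := by simp at hs ⊢; tauto
  obtain ⟨D1, D2, hD⟩ := List.append_of_mem hs'
  refine ⟨D1 ++ [s], D2, L, R, s, t, ?_, ?_, ?_, hL1, hR1, hL2, hR2, ?_, ?_⟩
  · rw [List.append_assoc, List.singleton_append, ← hD]
    exact List.isRotated_append
  · simp
  · cases D1 with
    | nil => simp at hD ⊢; exact hD.1.symm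
    | cons a D1 => simp at hD ⊢; exact hD.1.symm
  · have hLn : L.Nodup := by
      match L, hL1 with
      | [], _ => simp
      | [x], _ => simp
    have hRn : R.Nodup := by
      match R, hR1 with
      | [], _ => simp
      | [x], _ => simp
    rw [List.nodup_append]
    refine ⟨hLn, by simp [hR3, hRn], ?_⟩
    rintro a ha b hb rfl
    rw [List.mem_cons] at hb
    rcases hb with rfl | hb
    · exact hL3 ha
    · exact hR5 (hf a ha ▸ hb)
  · intro v hv
    rw [List.mem_append, List.mem_cons] at hv
    rcases hv with hv | rfl | hv
    · exact hL4 v hv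
    · exact hy
    · exact hR4 v hv

theorem chain_of_cycle {V : Type*} (A : V → V → Prop) (l : List V)
    (h : Cycle.Chain A (l : Cycle V)) : List.IsChain A l := by
  cases l with
  | nil => simp
  | cons a l =>
    rw [Cycle.chain_coe_cons, ← List.cons_append, List.isChain_append] at h
    exact h.1

theorem sum_arcs {V : Type*} [Fintype V] (A : V → V → Prop) (w : V) :
    ∑ v, arcs A w v = outDeg A w + inDeg A w := by
  classical
  simp only [arcs, Finset.sum_add_distrib, outDeg, inDeg, Set.ncard_eq_toFinset_card']
  simp

open Classical in
theorem six_bound (a b c d l r : Prop) (h1 : ¬ l → ¬ (a ∧ d)) (h2 : ¬ r → ¬ (c ∧ b)) :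
    ((if a then 1 else 0) + (if b then 1 else 0)) + ((if c then 1 else 0) + (if d then 1 else 0))
      + 0 + 0 ≤ 2 + (if l then 1 else 0) + (if r then 1 else 0) := by
  split_ifs <;> first | omega | (exfalso; tauto)

set_option maxHeartbeats 1000000 in
/-- The main improvement step: a nonextendable cycle contains everything. -/
theorem improve {V : Type*} [Fintype V] (A : V → V → Prop) (hA : ∀ v, ¬ A v v) (W : Finset V)
    (hdeg : ∀ v ∈ W, Fintype.card V ≤ 2 * outDeg A v ∧ Fintype.card V ≤ 2 * inDeg A v)
    (C : List V) (hnd : C.Nodup) (hC : Cycle.Chain A (C : Cycle V))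
    (c y : V) (hc : c ∈ C) (hcW : c ∈ W) (hyW : y ∈ W) (hy : y ∉ C) :
    ∃ C' : List V, C'.Nodup ∧ Cycle.Chain A (C' : Cycle V) ∧ y ∈ C' ∧
      ∀ w ∈ W, w ∈ C → w ∈ C' := by
  classical
  have hcd := hdeg c hcW
  have hyd := hdeg y hyW
  obtain ⟨⟨Q, G, L, R, s, t⟩, K, hmin⟩ := exists_min_meas
    (fun p : List V × List V × List V × List V × V × V =>
      Conf A C y p.1 p.2.1 p.2.2.1 p.2.2.2.1 p.2.2.2.2.1 p.2.2.2.2.2)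
    (fun p => 3 * p.2.1.length + p.2.2.1.length + p.2.2.2.1.length)
    (by
      obtain ⟨Q, G, L, R, s, t, h⟩ := exists_conf A hA C c y hc hy (by omega) (by omega)
      exact ⟨⟨Q, G, L, R, s, t⟩, h⟩)
  replace hmin : ∀ Q' G' L' R' s' t', Conf A C y Q' G' L' R' s' t' →
      3 * G.length + L.length + R.length ≤ 3 * G'.length + L'.length + R'.length :=
    fun Q' G' L' R' s' t' h => hmin ⟨Q', G', L', R', s', t'⟩ h
  dsimp only at K
  obtain ⟨rot, hs, ht, lL, lR, cL, cR, nd, dj⟩ := K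
  have hndQG : (Q ++ G).Nodup := rot.nodup_iff.mpr hnd
  have hQGC : Cycle.Chain A ((Q ++ G : List V) : Cycle V) := by
    rw [Cycle.coe_eq_coe.mpr rot]; exact hC
  have hcQG := chain_of_cycle A _ hQGC
  have hcQ : List.IsChain A Q := (List.isChain_append.mp hcQG).1
  have hmem : ∀ v, v ∈ C ↔ v ∈ Q ∨ v ∈ G := fun v => by
    rw [← rot.perm.mem_iff, List.mem_append]
  have hQG : ∀ v, v ∈ Q → v ∉ G := fun v h1 h2 =>
    (List.nodup_append.mp hndQG).2.2 v h1 v h2 rfl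
  -- the longest path from t to s within C containing Q
  obtain ⟨S, ⟨S1, S2, S3, S4, S5, S6⟩, hSmax⟩ := exists_min_meas
    (fun S : List V => S.Nodup ∧ List.IsChain A S ∧ S.getLast? = some s ∧ S.head? = some t ∧
      (∀ v ∈ Q, v ∈ S) ∧ (∀ v ∈ S, v ∈ C))
    (fun S => C.length - S.length)
    ⟨Q, (List.nodup_append.mp hndQG).1, hcQ, hs, ht, fun v h => h,
      fun v h => (hmem v).mpr (Or.inl h)⟩
  by_cases hall : ∀ w ∈ W, w ∈ C → w ∈ S
  · refine ⟨S ++ (L ++ y :: R), ?_, ?_, by simp, fun w h1 h2 => by simp [hall w h1 h2]⟩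
    · rw [List.nodup_append]
      refine ⟨S1, nd, ?_⟩
      rintro a ha b hb rfl
      exact dj a hb (S6 a ha)
    · cases S with
      | nil => simp at S4
      | cons a S' =>
        simp at S4
        subst S4
        rw [List.cons_append, Cycle.chain_coe_cons]
        have e : a :: (S' ++ (L ++ y :: R) ++ [a]) = (a :: S') ++ (L ++ y :: (R ++ [a])) := by
          simp
        rw [e, List.isChain_append, S3]
        rw [List.isChain_cons] at cL
        refine ⟨S2, List.isChain_split.mpr ⟨cL.2, cR⟩, ?_⟩
        intro x hx b hb
        simp at hx
        subst hx
        apply cL.1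
        simpa [List.head?_append] using hb
  exfalso
  push Not at hall
  obtain ⟨z, hzW, hzC, hzS⟩ := hall
  have hzG : z ∈ G := ((hmem z).mp hzC).resolve_left fun h => hzS (S5 z h)
  have hGpos : 0 < G.length := List.length_pos_of_mem hzG
  -- minimality consequences
  have mR : ∀ g ∈ G, ∀ R' : List V, R'.length ≤ 1 → (L ++ y :: R').Nodup →
      (∀ v ∈ R', v ∉ C) → ¬ List.IsChain A (y :: (R' ++ [g])) := by
    intro g hg R' h1 h2 h3 h4
    obtain ⟨G1, G2, rfl⟩ := List.append_of_mem hg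
    have := hmin (g :: G2 ++ Q) G1 L R' s g
      ⟨by
        refine List.IsRotated.trans ?_ rot
        rw [List.append_assoc, ← List.append_assoc Q]
        exact List.isRotated_append, by rw [List.getLast?_append, hs]; rfl, by simp, lL, h1, cL, h4, h2, by
        intro v hv
        rw [List.mem_append, List.mem_cons] at hv
        rcases hv with hv | rfl | hv
        · exact dj v (by simp [hv])
        · exact hy
        · exact h3 v hv⟩
    simp at this
    omega
  have mL : ∀ g ∈ G, ∀ L' : List V, L'.length ≤ 1 → (L' ++ y :: R).Nodup →
      (∀ v ∈ L', v ∉ C) → ¬ List.IsChain A (g :: (L' ++ [y])) := by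
    intro g hg L' h1 h2 h3 h4
    obtain ⟨G1, G2, rfl⟩ := List.append_of_mem hg
    have := hmin (Q ++ G1 ++ [g]) G2 L' R g t
      ⟨by simpa using rot, by simp, by simp [List.head?_append, ht], h1, lR, h4, cR, h2, by
        intro v hv
        rw [List.mem_append, List.mem_cons] at hv
        rcases hv with hv | rfl | hv
        · exact h3 v hv
        · exact hy
        · exact dj v (by simp [hv])⟩
    simp at this
    omega
  have ndL : (L ++ [y]).Nodup := by
    simp only [List.nodup_append, List.nodup_cons, List.mem_cons] at nd ⊢
    simp
    exact ⟨nd.1, fun a ha => nd.2.2 a ha y (by simp)⟩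
  have ndR : (y :: R).Nodup := (List.nodup_append.mp nd).2.1
  have n1 : ∀ g ∈ G, ¬ A y g := fun g hg h =>
    mR g hg [] (by simp) ndL (by simp) (by simpa using h)
  have n2 : ∀ g ∈ G, ¬ A g y := fun g hg h =>
    mL g hg [] (by simp) ndR (by simp) (by simpa using h)
  have n3 : ∀ x, x ∉ C → x ≠ y → x ∉ L → ¬ (A y x ∧ A x z) := by
    rintro x h1 h2 h3 ⟨h4, h5⟩
    refine mR z hzG [x] (by simp) ?_ (by simpa using h1) (by simp [h4, h5])
    have e : L ++ [y, x] = (L ++ [y]) ++ [x] := by simp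
    rw [e, List.nodup_append]
    refine ⟨ndL, by simp, ?_⟩
    rintro a ha b hb rfl
    simp at ha hb
    subst hb
    tauto
  have n4 : ∀ x, x ∉ C → x ≠ y → x ∉ R → ¬ (A z x ∧ A x y) := by
    rintro x h1 h2 h3 ⟨h4, h5⟩
    refine mL z hzG [x] (by simp) ?_ (by simpa using h1) (by simp [h4, h5])
    rw [List.singleton_append, List.nodup_cons]
    exact ⟨by simp [h2, h3], ndR⟩
  have n5 : L.length + (if A s y then 1 else 0) ≤ 1 := by
    split_ifs with h
    · have := hmin Q G [] R s t ⟨rot, hs, ht, by simp, lR, by simpa using h, cR, ndR,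
        fun v hv => dj v (by simp at hv ⊢; tauto)⟩
      simp at this
      simp [this]
    · simpa using lL
  have n6 : R.length + (if A y t then 1 else 0) ≤ 1 := by
    split_ifs with h
    · have := hmin Q G L [] s t ⟨rot, hs, ht, lL, by simp, cL, by simpa using h, ndL,
        fun v hv => dj v (by simp at hv ⊢; tauto)⟩
      simp at this
      simp [this]
    · simpa using lR
  have n7 : ∀ l1 l2 u v, Q = l1 ++ u :: v :: l2 → ¬ (A u y ∧ A y v) := by
    rintro l1 l2 u v e ⟨h1, h2⟩
    have := hmin (v :: l2 ++ G ++ (l1 ++ [u])) [] [] [] u v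
      ⟨by
        refine List.IsRotated.trans ?_ rot
        have e' : Q ++ G = (l1 ++ [u]) ++ (v :: l2 ++ G) := by simp [e]
        rw [List.append_nil, e']
        exact List.isRotated_append, by rw [List.getLast?_append, List.getLast?_append]; rfl, by simp, by simp, by simp,
        by simpa using h1, by simpa using h2, by simp, by simpa using hy⟩
    simp only [List.length_nil] at this
    omega
  have n8 : ∀ l1 l2 u v, S = l1 ++ u :: v :: l2 → ¬ (A u z ∧ A z v) := by
    rintro l1 l2 u v e ⟨h1, h2⟩
    have hp : (l1 ++ u :: z :: v :: l2).Perm (z :: S) := by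
      rw [e]
      have e1 : l1 ++ u :: z :: v :: l2 = (l1 ++ [u]) ++ z :: (v :: l2) := by simp
      have e2 : l1 ++ u :: v :: l2 = (l1 ++ [u]) ++ (v :: l2) := by simp
      rw [e1, e2]
      exact List.perm_middle
    have hnd' : (l1 ++ u :: z :: v :: l2).Nodup := hp.nodup_iff.mpr (by simp [hzS, S1])
    have hsub : ∀ w ∈ l1 ++ u :: z :: v :: l2, w ∈ C := by
      intro w hw
      rw [hp.mem_iff, List.mem_cons] at hw
      rcases hw with rfl | hw
      · exact hzC
      · exact S6 w hw
    have := hSmax (l1 ++ u :: z :: v :: l2) ⟨hnd', by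
      rw [e, List.isChain_split] at S2
      rw [List.isChain_split]
      refine ⟨S2.1, ?_⟩
      have := S2.2
      simp only [List.isChain_cons_cons] at this ⊢
      exact ⟨h1, h2, this.2⟩, by
      rw [← S3, e]; simp [List.getLast?_append, List.getLast?_cons], by
      rw [← S4, e]; simp [List.head?_append], fun w hw => by
      rw [hp.mem_iff]; simp [S5 w hw], hsub⟩
    have hlen := (List.subperm_of_subset hnd' hsub).length_le
    have hl2 := hp.length_eq
    simp only [List.length_cons] at hl2
    omega
  -- counting
  have hyz : y ≠ z := fun e => hy (e ▸ hzC)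
  have b1 : (Q.map (arcs A y)).sum + L.length + R.length ≤ Q.length + 1 := by
    cases Q with
    | nil => simp at hs
    | cons a Q' =>
      simp at ht
      subst ht
      have := noninsert_bound A y s Q' a hs n7
      simp only [arcs, List.length_cons] at this n5 n6 ⊢
      omega
  have b2 : (S.map (arcs A z)).sum ≤ S.length + 1 := by
    cases S with
    | nil => simp at S3
    | cons a S' =>
      have := noninsert_bound A z s S' a S3 n8
      have h1 : arcs A z a - (if A a z then 1 else 0) ≤ 1 := by
        simp only [arcs]; split_ifs <;> simp
      have h2 : (if A s z then 1 else 0) ≤ 1 := by split_ifs <;> simp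
      simp only [List.length_cons] at this ⊢
      omega
  have hQn : Q.Nodup := (List.nodup_append.mp hndQG).1
  rw [← List.sum_toFinset _ hQn] at b1
  rw [← List.sum_toFinset _ S1] at b2
  have b3 : ∑ v ∈ S.toFinset, arcs A y v = ∑ v ∈ Q.toFinset, arcs A y v := by
    symm
    apply Finset.sum_subset
    · intro v hv; simp at hv ⊢; exact S5 v hv
    · intro v hv hvQ
      simp at hv hvQ
      have hvG : v ∈ G := ((hmem v).mp (S6 v hv)).resolve_left hvQ
      simp [arcs, n1 v hvG, n2 v hvG]
  change ∑ v ∈ Q.toFinset, arcs A y v + _ + _ ≤ _ at b1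
  change ∑ v ∈ S.toFinset, arcs A z v ≤ _ at b2
  have hQS : Q.length ≤ S.length := (List.subperm_of_subset hQn S5).length_le
  have hpt : ∀ v ∈ (S.toFinset)ᶜ, arcs A y v + arcs A z v + (if v = y then 2 else 0)
      + (if v = z then 2 else 0) ≤ 2 + (if v ∈ L then 1 else 0) + (if v ∈ R then 1 else 0) := by
    intro v hv
    by_cases hvy : v = y
    · subst hvy
      simp [arcs, hA, n1 z hzG, n2 z hzG, hyz]
      omega
    by_cases hvz : v = z
    · subst hvz
      simp [arcs, hA, n1 v hzG, n2 v hzG, hvy]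
      omega
    by_cases hvC : v ∈ C
    · simp at hv
      have hvG : v ∈ G := ((hmem v).mp hvC).resolve_left fun h => hv (S5 v h)
      simp only [arcs, n1 v hvG, n2 v hvG, hvy, hvz, if_false]
      split_ifs <;> simp
    · have h3 := n3 v hvC hvy
      have h4 := n4 v hvC hvy
      simp only [arcs, hvy, hvz, if_false]
      convert six_bound _ _ _ _ _ _ h3 h4 using 1
      congr
  have hsum := Finset.sum_le_sum hpt
  simp only [Finset.sum_add_distrib] at hsum
  have hyS : y ∈ (S.toFinset)ᶜ := by simp; exact fun h => hy (S6 y h)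
  have hzS' : z ∈ (S.toFinset)ᶜ := by simpa using hzS
  have hcard : ∀ l : List V, ∑ v ∈ (S.toFinset)ᶜ, (if v ∈ l then 1 else 0) ≤ l.length := by
    intro l
    rw [Finset.sum_boole]
    refine le_trans ?_ l.toFinset_card_le
    apply Finset.card_le_card
    intro v hv
    simp at hv ⊢
    exact hv.2
  rw [Finset.sum_ite_eq' _ y, Finset.sum_ite_eq' _ z, if_pos hyS, if_pos hzS', Finset.sum_const,
    smul_eq_mul] at hsum
  have c1 := hcard L
  have c2 := hcard R
  have c3 := Finset.card_add_card_compl S.toFinset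
  rw [List.toFinset_card_of_nodup S1] at c3
  have t1 := Finset.sum_add_sum_compl S.toFinset (arcs A y)
  have t2 := Finset.sum_add_sum_compl S.toFinset (arcs A z)
  rw [sum_arcs] at t1 t2
  have hzd := hdeg z hzW
  omega

theorem dicycle_of_cycle {V : Type*} (A : V → V → Prop) (hA : ∀ v, ¬ A v v) (l : List V)
    (hl : l ≠ []) (hnd : l.Nodup) (h : Cycle.Chain A (l : Cycle V)) : IsDicycle A l := by
  cases l with
  | nil => simp at hl
  | cons a l =>
    rw [Cycle.chain_coe_cons] at h
    refine ⟨?_, hnd, ?_⟩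
    · cases l with
      | nil => simp at h; exact absurd h (hA a)
      | cons b l => simp
    · rintro ⟨i, hi⟩
      rw [List.isChain_iff_getElem] at h
      have := h i (by simp at hi ⊢; omega)
      simp only [← List.cons_append] at this
      rw [List.getElem_append_left hi] at this
      simp only [List.get_eq_getElem]
      by_cases hlast : i + 1 < (a :: l).length
      · rw [List.getElem_append_left hlast] at this
        simpa only [Nat.mod_eq_of_lt hlast] using this
      · have e : i + 1 = (a :: l).length := by omega
        rw [List.getElem_append_right (by omega)] at this
        simp only [e, Nat.mod_self]
        simpa using this

/-- **Theorem (cyclability).** If `D` is a digraph of order `n` and `W` is a nonempty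
set of vertices with minimum semi-degree `δ⁰(W) ≥ n/2`, then `D` contains a directed
cycle through every vertex of `W`. -/
theorem stmt0 {V : Type*} [Fintype V] (A : V → V → Prop) (hloopless : Irreflexive A)
    (W : Finset V) (hW : W.Nonempty)
    (hdeg : ∀ v ∈ W, (Fintype.card V : ℚ) / 2 ≤ (outDeg A v : ℚ) ∧
      (Fintype.card V : ℚ) / 2 ≤ (inDeg A v : ℚ)) :
    ∃ l : List V, IsDicycle A l ∧ ∀ w ∈ W, w ∈ l := by
  classical
  have hA : ∀ v, ¬ A v v := hloopless
  have hdeg' : ∀ v ∈ W, Fintype.card V ≤ 2 * outDeg A v ∧ Fintype.card V ≤ 2 * inDeg A v := by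
    intro v hv
    obtain ⟨h1, h2⟩ := hdeg v hv
    constructor
    · have : (Fintype.card V : ℚ) ≤ 2 * outDeg A v := by linarith
      exact_mod_cast this
    · have : (Fintype.card V : ℚ) ≤ 2 * inDeg A v := by linarith
      exact_mod_cast this
  obtain ⟨w, hw⟩ := hW
  have hbase : ∃ l : List V, l.Nodup ∧ Cycle.Chain A (l : Cycle V) ∧ ∃ c ∈ l, c ∈ W := by
    obtain ⟨x, hx1, hx2, -⟩ := inter_exists (Finset.univ.filter (A w ·))
      (Finset.univ.filter (A · w)) {w} ∅
      (by
        have := hdeg' w hw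
        simp only [outDeg, inDeg, Set.ncard_eq_toFinset_card', Set.toFinset_setOf] at this
        obtain ⟨h1, h2⟩ := this
        change _ ≤ 2 * (Finset.univ.filter (A w ·)).card at h1
        change _ ≤ 2 * (Finset.univ.filter (A · w)).card at h2
        generalize (Finset.univ.filter (A w ·)).card = p at *
        generalize (Finset.univ.filter (A · w)).card = q at *
        omega)
      (by simp [hA]) (by simp [hA]) (by simp)
    simp at hx1 hx2
    refine ⟨[w, x], ?_, ?_, w, by simp, hw⟩
    · simp
      rintro rfl
      exact hA _ hx1
    · rw [Cycle.chain_coe_cons]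
      simp [hx1, hx2]
  obtain ⟨C, ⟨h1, h2, c, hc, hcW⟩, hmin⟩ := exists_min_meas _
    (fun l : List V => (W.filter (· ∉ l)).card) hbase
  refine ⟨C, dicycle_of_cycle A hA C (List.ne_nil_of_mem hc) h1 h2, ?_⟩
  by_contra hcon
  push Not at hcon
  obtain ⟨y, hyW, hy⟩ := hcon
  obtain ⟨C', k1, k2, k3, k4⟩ := improve A hA W hdeg' C h1 h2 c y hc hcW hyW hy
  have := hmin C' ⟨k1, k2, y, k3, hyW⟩
  refine absurd this (not_le.mpr (Finset.card_lt_card ?_))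
  rw [Finset.ssubset_iff_of_subset]
  · exact ⟨y, by simp [hyW, hy], by simp [k3]⟩
  · intro v hv
    simp at hv ⊢
    exact ⟨hv.1, fun h => hv.2 (k4 v hv.1 h)⟩
end

section
/- Let D be a digraph of order n and let W ⊆ V(D) satisfy δ⁰(W) ≥ (3n−3)/4. Then for every integer k ≥ 1 and every positive integer partition |W| = n_1 + ⋯ + n_k with n_i ≥ 2 for each i, D contains k pairwise vertex-disjoint directed cycles C_1, …, C_k such that each C_i contains exactly n_i vertices of W (|V(C_i) ∩ W| = n_i). -/
/-- Effect of a transposition on the number of arcs along a fixed-point-free permutation. -/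
lemma swap_gain {P : Type*} [Fintype P] [DecidableEq P] (σ : Equiv.Perm P)
    (hσ : ∀ p, σ p ≠ p) (e : P → P → ℤ) (he : ∀ p, e p p = 0) (x q : P) (hq : q ≠ x) :
    ∑ p, e (Equiv.swap x q p) (Equiv.swap x q (σ p)) - ∑ p, e p (σ p) =
      (e q (σ x) + e (σ.symm x) q + e x (σ q) + e (σ.symm q) x
        - e x (σ x) - e (σ.symm x) x - e q (σ q) - e (σ.symm q) q)
      + (if q = σ x then e (σ x) x + e x (σ x) else 0)
      + (if q = σ.symm x then e x (σ.symm x) + e (σ.symm x) x else 0) := by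
  obtain ⟨z, rfl⟩ := σ.surjective x
  obtain ⟨r, rfl⟩ := σ.surjective q
  simp only [Equiv.symm_apply_apply]
  rw [← Finset.sum_sub_distrib]
  have hz := hσ z
  have hr := hσ r
  have hzz := hσ (σ z)
  have hrr := hσ (σ r)
  have hrz : r ≠ z := fun h => hq (by rw [h])
  have inj : ∀ a b, σ a = σ b → a = b := fun a b h => σ.injective h
  have key : ∀ p, e (Equiv.swap (σ z) (σ r) p) (Equiv.swap (σ z) (σ r) (σ p)) - e p (σ p) =
      (if p = σ z then (if σ r = σ (σ z) then e (σ r) (σ z) else e (σ r) (σ (σ z))) - e (σ z) (σ (σ z)) else 0)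
      + (if p = z then (if z = σ r then 0 else e z (σ r) - e z (σ z)) else 0)
      + (if p = σ r then (if z = σ r then e (σ z) (σ r) else e (σ z) (σ (σ r))) - e (σ r) (σ (σ r)) else 0)
      + (if p = r then (if r = σ z then 0 else e r (σ z) - e r (σ r)) else 0) := by
    intro p
    simp only [Equiv.swap_apply_def]
    grind
  rw [Finset.sum_congr rfl (fun p _ => key p)]
  simp only [Finset.sum_add_distrib, Finset.sum_ite_eq', Finset.mem_univ, if_true]
  grind

lemma swap_gain_sum {P : Type*} [Fintype P] [DecidableEq P] (σ : Equiv.Perm P)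
    (hσ : ∀ p, σ p ≠ p) (e : P → P → ℤ) (he : ∀ p, e p p = 0) (x : P) (hx : e x (σ x) = 0) :
    ∑ q, (∑ p, e (Equiv.swap x q p) (Equiv.swap x q (σ p)) - ∑ p, e p (σ p)) =
      ∑ q, e q (σ x) + ∑ q, e (σ.symm x) q + ∑ q, e x q + ∑ q, e q x
      - (Fintype.card P - 1) * e (σ.symm x) x - 2 * ∑ p, e p (σ p)
      + e (σ x) x + e x (σ.symm x) := by
  have key : ∀ q, ∑ p, e (Equiv.swap x q p) (Equiv.swap x q (σ p)) - ∑ p, e p (σ p) =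
      (e q (σ x) + e (σ.symm x) q + e x (σ q) + e (σ.symm q) x
        - e x (σ x) - e (σ.symm x) x - e q (σ q) - e (σ.symm q) q)
      + (if q = σ x then e (σ x) x + e x (σ x) else 0)
      + (if q = σ.symm x then e x (σ.symm x) + e (σ.symm x) x else 0) := by
    intro q
    by_cases hq : q = x
    · subst hq
      have h1 := hσ q
      have h2 : q ≠ σ.symm q := fun h => h1 ((Equiv.eq_symm_apply σ).1 h)
      simp [h1.symm, h2]
      ring
    · exact swap_gain σ hσ e he x q hq
  rw [Finset.sum_congr rfl (fun q _ => key q)]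
  have e1 : ∑ q, e x (σ q) = ∑ q, e x q := Equiv.sum_comp σ (e x)
  have e2 : ∑ q, e (σ.symm q) x = ∑ q, e q x := Equiv.sum_comp σ.symm (fun q => e q x)
  have e3 : ∑ q, e (σ.symm q) q = ∑ q, e q (σ q) := by
    rw [← Equiv.sum_comp σ]; simp
  simp only [Finset.sum_add_distrib, Finset.sum_sub_distrib, Finset.sum_ite_eq', Finset.mem_univ,
    if_true, e1, e2, e3, hx, Finset.sum_const, Finset.card_univ, nsmul_eq_mul]
  ring

/-- A placement `φ` of `W` on the positions, with connectors for the non-arcs, all distinct. -/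
def Placed {V P : Type*} (A : V → V → Prop) (W : Finset V) (σ : Equiv.Perm P) : Prop :=
  ∃ (φ : P ≃ {v // v ∈ W}) (f : P → V),
    (∀ p, ¬ A (φ p) (φ (σ p)) → f p ∉ W ∧ A (φ p) (f p) ∧ A (f p) (φ (σ p))) ∧
    (∀ p q, ¬ A (φ p) (φ (σ p)) → ¬ A (φ q) (φ (σ q)) → f p = f q → p = q)

open Classical in
/-- Arc indicator. -/
noncomputable def arcInd {V : Type*} (A : V → V → Prop) (v w : V) : ℤ := if A v w then 1 else 0

lemma arcInd_le {V : Type*} (A : V → V → Prop) (v w : V) : arcInd A v w ≤ 1 := by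
  unfold arcInd; split_ifs <;> simp

lemma arcInd_nonneg {V : Type*} (A : V → V → Prop) (v w : V) : 0 ≤ arcInd A v w := by
  unfold arcInd; split_ifs <;> simp

lemma arcInd_eq_zero {V : Type*} {A : V → V → Prop} {v w : V} : arcInd A v w = 0 ↔ ¬ A v w := by
  unfold arcInd; split_ifs <;> simp_all

lemma arcInd_eq_one {V : Type*} {A : V → V → Prop} {v w : V} : arcInd A v w = 1 ↔ A v w := by
  unfold arcInd; split_ifs <;> simp_all

/-- Number of arcs along the placement. -/
noncomputable def arcCount {V P : Type*} [Fintype P] (A : V → V → Prop) {W : Finset V}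
    (σ : Equiv.Perm P) (φ : P ≃ {v // v ∈ W}) : ℤ :=
  ∑ p, arcInd A (φ p) (φ (σ p))

open Classical in
/-- If not every non-arc can get its own connector, some non-arc has few possible connectors. -/
lemma exists_unmatched {V P : Type*} [Fintype V] [Fintype P]
    (A : V → V → Prop) {W : Finset V} (σ : Equiv.Perm P) (hno : ¬ Placed A W σ)
    (φ : P ≃ {v // v ∈ W}) :
    ∃ x, ¬ A (φ x) (φ (σ x)) ∧ ∃ Z : Finset V, (Z.card : ℤ) + 1 ≤
      Fintype.card P - arcCount A σ φ ∧
      ∀ u, u ∉ W → u ∉ Z → ¬ (A (φ x) u ∧ A u (φ (σ x))) := by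
  set B : Finset P := Finset.univ.filter (fun p => ¬ A (φ p) (φ (σ p))) with hB
  have hBcard : (B.card : ℤ) = Fintype.card P - arcCount A σ φ := by
    have : ∀ p, arcInd A (φ p) (φ (σ p)) = 1 - (if ¬ A (φ p) (φ (σ p)) then 1 else 0) := by
      intro p; unfold arcInd; split_ifs <;> simp_all
    unfold arcCount
    rw [Finset.sum_congr rfl (fun p _ => this p), Finset.sum_sub_distrib, hB, Finset.card_filter]
    simp
  let good : Finset P → Prop := fun S => S ⊆ B ∧ ∃ f : P → V,
    (∀ p ∈ S, f p ∉ W ∧ A (φ p) (f p) ∧ A (f p) (φ (σ p))) ∧ Set.InjOn f S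
  by_cases hP : Nonempty P
  swap
  · exfalso
    rw [not_nonempty_iff] at hP
    exact hno ⟨φ, fun p => hP.elim p, fun p => hP.elim p, fun p => hP.elim p⟩
  have hV : Nonempty V := ⟨(φ hP.some).1⟩
  have hempty : good ∅ := ⟨by simp, fun _ => hV.some, by simp, by simp⟩
  obtain ⟨S, hS, hmax⟩ := Finset.exists_max_image (Finset.univ.filter good) Finset.card
    ⟨∅, by simpa using hempty⟩
  simp only [Finset.mem_filter, Finset.mem_univ, true_and] at hS hmax
  obtain ⟨hSB, f, hf, hinj⟩ := hS
  have hne : S ≠ B := by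
    rintro rfl
    refine hno ⟨φ, f, fun p hp => hf p (by simp [hB, hp]), fun p q hp hq h => ?_⟩
    exact hinj (by simp [hB, hp]) (by simp [hB, hq]) h
  have hss : S ⊂ B := hSB.ssubset_of_ne hne
  obtain ⟨x, hxB, hxS⟩ := Finset.exists_of_ssubset hss
  refine ⟨x, by simpa [hB] using hxB, S.image f, ?_, ?_⟩
  · rw [← hBcard]
    have h1 := Finset.card_lt_card hss
    have h2 : (S.image f).card ≤ S.card := Finset.card_image_le
    omega
  · rintro u hu huZ ⟨h1, h2⟩
    have : good (insert x S) := by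
      refine ⟨Finset.insert_subset hxB hSB, Function.update f x u, ?_, ?_⟩
      · intro p hp
        by_cases hpx : p = x
        · subst hpx; simp [hu, h1, h2]
        · rw [Function.update_of_ne hpx]
          exact hf p (by simpa [hpx] using hp)
      · intro p hp q hq h
        have hh : ∀ s ∈ S, f s ≠ u := fun s hs h => huZ (Finset.mem_image.2 ⟨s, hs, h⟩)
        simp only [Finset.coe_insert, Set.mem_insert_iff, Finset.mem_coe] at hp hq
        by_cases hpx : p = x <;> by_cases hqx : q = x
        · rw [hpx, hqx]
        · subst hpx
          rw [Function.update_self, Function.update_of_ne hqx] at h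
          exact absurd h.symm (hh q (by tauto))
        · subst hqx
          rw [Function.update_self, Function.update_of_ne hpx] at h
          exact absurd h (hh p (by tauto))
        · rw [Function.update_of_ne hpx, Function.update_of_ne hqx] at h
          exact hinj (by simp; tauto) (by simp; tauto) h
    have := hmax _ this
    rw [Finset.card_insert_of_notMem hxS] at this
    omega

open Classical in
lemma tight {V P : Type*} [Fintype V] [Fintype P]
    (A : V → V → Prop) (hA : ∀ v, ¬ A v v) {W : Finset V} (σ : Equiv.Perm P) (hσ : ∀ p, σ p ≠ p)
    (hout : ∀ v ∈ W, 3 * (Fintype.card V : ℤ) - 3 ≤ 4 * ∑ w, arcInd A v w)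
    (hin : ∀ v ∈ W, 3 * (Fintype.card V : ℤ) - 3 ≤ 4 * ∑ w, arcInd A w v)
    (hno : ¬ Placed A W σ)
    (φ : P ≃ {v // v ∈ W}) (hmax : ∀ ψ : P ≃ {v // v ∈ W}, arcCount A σ ψ ≤ arcCount A σ φ) :
    ∃ x, (∀ p, ¬ A (φ p) (φ (σ p)) → p = x) ∧ A (φ (σ.symm x)) (φ x) ∧
      ¬ A (φ (σ x)) (φ x) ∧ ¬ A (φ x) (φ (σ.symm x)) ∧
      arcCount A σ ((Equiv.swap x (σ.symm x)).trans φ) = arcCount A σ φ := by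
  obtain ⟨x, hx, Z, hZ, hconn⟩ := exists_unmatched A σ hno φ
  set e : P → P → ℤ := fun p q => arcInd A (φ p) (φ q) with he
  have hee : ∀ p, e p p = 0 := fun p => arcInd_eq_zero.2 (hA _)
  have hex : e x (σ x) = 0 := arcInd_eq_zero.2 hx
  have hsum := swap_gain_sum σ hσ e hee x hex
  have hcount : ∀ q, ∑ p, e (Equiv.swap x q p) (Equiv.swap x q (σ p)) =
    arcCount A σ ((Equiv.swap x q).trans φ) := fun q => rfl
  have hcount0 : ∑ p, e p (σ p) = arcCount A σ φ := rfl
  simp only [hcount, hcount0] at hsum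
  have hgain : ∀ q, arcCount A σ ((Equiv.swap x q).trans φ) - arcCount A σ φ ≤ 0 := fun q => by
    have := hmax ((Equiv.swap x q).trans φ); omega
  have hsingle : ∑ q, (arcCount A σ ((Equiv.swap x q).trans φ) - arcCount A σ φ) ≤
      arcCount A σ ((Equiv.swap x (σ.symm x)).trans φ) - arcCount A σ φ := by
    rw [← Finset.add_sum_erase _ _ (Finset.mem_univ (σ.symm x))]
    have : ∑ q ∈ Finset.univ.erase (σ.symm x),
      (arcCount A σ ((Equiv.swap x q).trans φ) - arcCount A σ φ) ≤ 0 :=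
      Finset.sum_nonpos (fun q _ => hgain q)
    linarith
  have hg0 := hgain (σ.symm x)
  -- splitting sums over V
  have hsplit : ∀ g : V → ℤ, ∑ v, g v = ∑ p, g (φ p) + ∑ u ∈ Wᶜ, g u := by
    intro g
    rw [← Finset.sum_add_sum_compl W g]
    congr 1
    rw [← Finset.sum_coe_sort W g]
    exact (Equiv.sum_comp φ (fun v => g v)).symm
  have hcardW : (Fintype.card P : ℤ) = W.card := by
    rw [Fintype.card_congr φ]; simp
  have hcardV : (Fintype.card V : ℤ) = W.card + (Wᶜ).card := by
    rw [← Finset.card_add_card_compl W]; push_cast; rfl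
  have d1 := hin _ (φ (σ x)).2
  have d2 := hout _ (φ (σ.symm x)).2
  have d3 := hout _ (φ x).2
  have d4 := hin _ (φ x).2
  rw [hsplit] at d1 d2 d3 d4
  have hbound : ∑ u ∈ Wᶜ, arcInd A u (φ (σ x)) + ∑ u ∈ Wᶜ, arcInd A (φ (σ.symm x)) u
      + ∑ u ∈ Wᶜ, arcInd A (φ x) u + ∑ u ∈ Wᶜ, arcInd A u (φ x) ≤ 3 * (Wᶜ).card + Z.card := by
    rw [← Finset.sum_add_distrib, ← Finset.sum_add_distrib, ← Finset.sum_add_distrib]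
    calc _ ≤ ∑ u ∈ Wᶜ, (3 + if u ∈ Z then (1 : ℤ) else 0) := by
          refine Finset.sum_le_sum (fun u hu => ?_)
          have h1 := arcInd_le A u (φ (σ x))
          have h2 := arcInd_le A (φ (σ.symm x)) u
          have h3 := arcInd_le A (φ x) u
          have h4 := arcInd_le A u (φ x)
          have huW : u ∉ W := by simpa using hu
          split_ifs with huZ
          · linarith
          · have := hconn u huW huZ
            rw [not_and_or, ← arcInd_eq_zero, ← arcInd_eq_zero] at this
            rcases this with h | h <;> linarith
      _ ≤ _ := by
          rw [Finset.sum_add_distrib, ← Finset.sum_filter]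
          simp only [Finset.sum_const, nsmul_eq_mul, mul_one]
          have : (Finset.filter (fun u => u ∈ Z) Wᶜ).card ≤ Z.card :=
            Finset.card_le_card (fun u hu => (Finset.mem_filter.1 hu).2)
          have : ((Finset.filter (fun u => u ∈ Z) Wᶜ).card : ℤ) ≤ Z.card := by exact_mod_cast this
          linarith
  have a1 : e (σ.symm x) x ≤ 1 := arcInd_le _ _ _
  have a0 : 0 ≤ e (σ.symm x) x := arcInd_nonneg _ _ _
  have b0 : 0 ≤ e (σ x) x := arcInd_nonneg _ _ _
  have c0 : 0 ≤ e x (σ.symm x) := arcInd_nonneg _ _ _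
  have hP2 : (2 : ℤ) ≤ Fintype.card P := by
    have : 1 < Fintype.card P := Fintype.one_lt_card_iff.2 ⟨_, _, hσ x⟩
    exact_mod_cast this
  have hprod : (Fintype.card P - 1 : ℤ) * e (σ.symm x) x ≤
      Fintype.card P - 2 + e (σ.symm x) x := by nlinarith
  have hZ0 : (0 : ℤ) ≤ Z.card := by positivity
  have E1 : ∑ q, e q (σ x) = ∑ p, arcInd A (φ p) (φ (σ x)) := rfl
  have E2 : ∑ q, e (σ.symm x) q = ∑ p, arcInd A (φ (σ.symm x)) (φ p) := rfl
  have E3 : ∑ q, e x q = ∑ p, arcInd A (φ x) (φ p) := rfl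
  have E4 : ∑ q, e q x = ∑ p, arcInd A (φ p) (φ x) := rfl
  have fin1 : e (σ.symm x) x = 1 := by linarith
  have fin2 : e (σ x) x = 0 := by linarith
  have fin3 : e x (σ.symm x) = 0 := by linarith
  have fin4 : arcCount A σ ((Equiv.swap x (σ.symm x)).trans φ) = arcCount A σ φ := by linarith
  have fin5 : arcCount A σ φ ≥ Fintype.card P - 1 := by linarith
  refine ⟨x, ?_, arcInd_eq_one.1 fin1, arcInd_eq_zero.1 fin2, arcInd_eq_zero.1 fin3, fin4⟩
  intro p hp
  by_contra hpx
  have : arcCount A σ φ ≤ ∑ q, ((1 : ℤ) - (if q = x then 1 else 0) - (if q = p then 1 else 0)) := by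
    refine Finset.sum_le_sum (fun q _ => ?_)
    have h1 := arcInd_le A (φ q) (φ (σ q))
    by_cases h2 : q = x
    · subst h2
      rw [arcInd_eq_zero.2 hx]; simp [Ne.symm hpx]
    · by_cases h3 : q = p
      · subst h3
        rw [arcInd_eq_zero.2 hp]; simp [hpx]
      · simp [h2, h3, h1]
  simp at this
  linarith

theorem placed {V P : Type*} [Fintype V] [Fintype P]
    (A : V → V → Prop) (hA : ∀ v, ¬ A v v) {W : Finset V} (σ : Equiv.Perm P) (hσ : ∀ p, σ p ≠ p)
    (hout : ∀ v ∈ W, 3 * (Fintype.card V : ℤ) - 3 ≤ 4 * ∑ w, arcInd A v w)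
    (hin : ∀ v ∈ W, 3 * (Fintype.card V : ℤ) - 3 ≤ 4 * ∑ w, arcInd A w v)
    (φ₀ : P ≃ {v // v ∈ W}) : Placed A W σ := by
  classical
  by_contra hno
  obtain ⟨φ, -, hmax⟩ := Finset.exists_max_image (Finset.univ : Finset (P ≃ {v // v ∈ W}))
    (arcCount A σ) ⟨φ₀, Finset.mem_univ _⟩
  simp only [Finset.mem_univ, forall_const] at hmax
  obtain ⟨x, -, h1, -, h3, h4⟩ := tight A hA σ hσ hout hin hno φ hmax
  obtain ⟨x', h5, -, h7, -⟩ := tight A hA σ hσ hout hin hno ((Equiv.swap x (σ.symm x)).trans φ)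
    (fun ψ => h4 ▸ hmax ψ)
  have hx' : σ.symm x = x' := h5 _ (by simpa using h3)
  subst hx'
  simp at h7
  exact h7 h1

lemma isDicycle_of_chain {V : Type*} {A : V → V → Prop} (l : List V) (a : V) (t : List V)
    (hl : l = a :: t) (h2 : 2 ≤ l.length) (hnd : l.Nodup) (hc : List.IsChain A (l ++ [a])) :
    2 ≤ l.length ∧ l.Nodup ∧
    ∀ i : Fin l.length,
      A (l.get i) (l.get ⟨((i : ℕ) + 1) % l.length, Nat.mod_lt _ i.pos⟩) := by
  refine ⟨h2, hnd, fun i => ?_⟩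
  have h := (List.isChain_iff_getElem.1 hc) i (by simp)
  rw [List.getElem_append_left i.2] at h
  simp only [List.get_eq_getElem]
  by_cases hi : (i : ℕ) + 1 < l.length
  · rw [List.getElem_append_left hi] at h
    simpa only [Nat.mod_eq_of_lt hi] using h
  · have hi' : (i : ℕ) + 1 = l.length := by have := i.2; omega
    have : l[((i : ℕ) + 1) % l.length]'(Nat.mod_lt _ i.pos) = a := by
      simp only [hi', Nat.mod_self]
      subst hl; rfl
    rw [this]
    simpa [hi'] using h

lemma chain_flatMap {V : Type*} {A : V → V → Prop} (g : ℕ → V) (bl : ℕ → List V)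
    (hb : ∀ t, List.IsChain A (g t :: (bl t ++ [g (t + 1)]))) (n : ℕ) :
    List.IsChain A ((List.range n).flatMap (fun t => g t :: bl t) ++ [g n]) := by
  induction n with
  | zero => simp
  | succ n ih =>
    rw [List.range_succ, List.flatMap_append]
    simp only [List.flatMap_cons, List.flatMap_nil, List.append_nil, List.append_assoc,
      List.cons_append]
    rw [List.isChain_split]
    exact ⟨ih, hb n⟩

/-- **Theorem 1.** If `D` is a digraph of order `n` and `W ⊆ V(D)` satisfies
`δ⁰(W) ≥ (3n−3)/4`, then for every `k ≥ 1` and every partition `|W| = n₁ + ⋯ + n_k`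
with each `nᵢ ≥ 2`, `D` contains `k` pairwise vertex-disjoint directed cycles
`C₁, …, C_k` with `|V(Cᵢ) ∩ W| = nᵢ` for each `i`. -/
theorem stmt1 {V : Type*} [Fintype V] [DecidableEq V]
    (A : V → V → Prop) (hloopless : Irreflexive A)
    (W : Finset V)
    (hdeg : ∀ v ∈ W, (3 * (Fintype.card V : ℚ) - 3) / 4 ≤ (outDeg A v : ℚ) ∧
      (3 * (Fintype.card V : ℚ) - 3) / 4 ≤ (inDeg A v : ℚ))
    (k : ℕ) (hk : 1 ≤ k) (m : Fin k → ℕ) (hm : ∀ i, 2 ≤ m i)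
    (hsum : ∑ i, m i = W.card) :
    ∃ c : Fin k → List V,
      (∀ i, IsDicycle A (c i)) ∧
      (∀ i j, i ≠ j → ∀ v ∈ c i, v ∉ c j) ∧
      (∀ i, ((c i).toFinset ∩ W).card = m i) := by
  classical
  let P := Σ i : Fin k, Fin (m i)
  let σ : Equiv.Perm P := Equiv.sigmaCongrRight (fun i => finRotate (m i))
  have hsig : ∀ i (a b : Fin (m i)), (⟨i, a⟩ : P) = ⟨i, b⟩ → a = b :=
    fun i a b h => sigma_mk_injective (β := fun i => Fin (m i)) h
  have hrot : ∀ (N : ℕ) (j : Fin N), ((finRotate N j : Fin N) : ℕ) = (j + 1) % N := by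
    intro N j
    cases N with
    | zero => exact j.elim0
    | succ N => rw [finRotate_succ_apply, Fin.val_add]; simp
  have hσ : ∀ p, σ p ≠ p := by
    rintro ⟨i, j⟩ h
    have h1 : finRotate (m i) j = j := hsig i _ _ h
    have h2 := hrot (m i) j
    rw [h1] at h2
    have h3 := hm i
    have h4 := j.2
    by_cases h5 : (j : ℕ) + 1 < m i
    · rw [Nat.mod_eq_of_lt h5] at h2; omega
    · have : (j : ℕ) + 1 = m i := by omega
      rw [this, Nat.mod_self] at h2; omega
  have hcard : Fintype.card P = Fintype.card {v // v ∈ W} := by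
    simp [P, hsum]
  have ho : ∀ v, (outDeg A v : ℤ) = ∑ w, arcInd A v w := by
    intro v
    simp only [outDeg, arcInd, Set.ncard_eq_toFinset_card', Finset.sum_boole]
    simp
  have hi : ∀ v, (inDeg A v : ℤ) = ∑ w, arcInd A w v := by
    intro v
    simp only [inDeg, arcInd, Set.ncard_eq_toFinset_card', Finset.sum_boole]
    simp
  obtain ⟨φ, f, hf, hinj⟩ := placed A hloopless (W := W) σ hσ
    (fun v hv => by
      have := (hdeg v hv).1
      rw [← ho]
      have h : (3 * (Fintype.card V : ℚ) - 3) ≤ 4 * (outDeg A v : ℚ) := by linarith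
      exact_mod_cast h)
    (fun v hv => by
      have := (hdeg v hv).2
      rw [← hi]
      have h : (3 * (Fintype.card V : ℚ) - 3) ≤ 4 * (inDeg A v : ℚ) := by linarith
      exact_mod_cast h)
    (Fintype.equivOfCardEq hcard)
  have hpos : ∀ i, 0 < m i := fun i => by have := hm i; omega
  let pos : ∀ _ : Fin k, ℕ → P := fun i t => ⟨i, ⟨t % m i, Nat.mod_lt _ (hpos i)⟩⟩
  have hpos_succ : ∀ i t, pos i (t + 1) = σ (pos i t) := by
    intro i t
    simp only [pos, σ]
    congr 1
    apply Fin.ext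
    rw [hrot]
    simp
  let bl : P → List V := fun p => if A (φ p) (φ (σ p)) then [] else [f p]
  have hbl : ∀ p v, v ∈ bl p → v = f p ∧ ¬ A (φ p) (φ (σ p)) := by
    intro p v hv
    by_cases h : A (φ p) (φ (σ p)) <;> simp_all [bl]
  -- membership in a block determines the position
  have hblock : ∀ p q v, v ∈ ((φ p : V) :: bl p) → v ∈ ((φ q : V) :: bl q) → p = q := by
    intro p q v hp hq
    rw [List.mem_cons] at hp hq
    rcases hp with hp | hp <;> rcases hq with hq | hq
    · exact φ.injective (Subtype.ext (hp.symm.trans hq))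
    · obtain ⟨h1, h2⟩ := hbl _ _ hq
      exact absurd (φ p).2 (by rw [← hp, h1]; exact (hf q h2).1)
    · obtain ⟨h1, h2⟩ := hbl _ _ hp
      exact absurd (φ q).2 (by rw [← hq, h1]; exact (hf p h2).1)
    · obtain ⟨h1, h2⟩ := hbl _ _ hp
      obtain ⟨h3, h4⟩ := hbl _ _ hq
      exact hinj p q h2 h4 (h1.symm.trans h3)
  let c : Fin k → List V := fun i =>
    (List.range (m i)).flatMap (fun t => (φ (pos i t) : V) :: bl (pos i t))
  have hmem : ∀ i v, v ∈ c i → ∃ t, v ∈ ((φ (pos i t) : V) :: bl (pos i t)) := by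
    intro i v hv
    obtain ⟨t, -, ht⟩ := List.mem_flatMap.1 hv
    exact ⟨t, ht⟩
  have hinter : ∀ i, (c i).toFinset ∩ W =
      (Finset.univ : Finset (Fin (m i))).image (fun j => (φ ⟨i, j⟩ : V)) := by
    intro i
    ext v
    simp only [Finset.mem_inter, List.mem_toFinset, Finset.mem_image, Finset.mem_univ, true_and]
    constructor
    · rintro ⟨hv, hW⟩
      obtain ⟨t, ht⟩ := hmem i v hv
      rcases List.mem_cons.1 ht with h | h
      · exact ⟨_, h.symm⟩
      · obtain ⟨h1, h2⟩ := hbl _ _ h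
        exact absurd hW (by rw [h1]; exact (hf _ h2).1)
    · rintro ⟨j, rfl⟩
      refine ⟨List.mem_flatMap.2 ⟨j, List.mem_range.2 j.2, ?_⟩, (φ _).2⟩
      have : pos i j = ⟨i, j⟩ := by
        simp only [pos]
        congr 1
        exact Fin.ext (Nat.mod_eq_of_lt j.2)
      rw [this]
      simp
  have hcardi : ∀ i, ((c i).toFinset ∩ W).card = m i := by
    intro i
    rw [hinter, Finset.card_image_of_injective]
    · simp
    · intro a b hab
      exact hsig i _ _ (φ.injective (Subtype.ext hab))
  refine ⟨c, fun i => ?_, ?_, hcardi⟩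
  · obtain ⟨N, hN⟩ : ∃ N, m i = N + 1 := ⟨m i - 1, by have := hpos i; omega⟩
    refine isDicycle_of_chain (c i) (φ (pos i 0)) (bl (pos i 0) ++
      ((List.range N).map Nat.succ).flatMap (fun t => (φ (pos i t) : V) :: bl (pos i t)))
      ?_ ?_ ?_ ?_
    · simp only [c]
      rw [hN, List.range_succ_eq_map, List.flatMap_cons, List.cons_append]
    · calc 2 ≤ m i := hm i
        _ = ((c i).toFinset ∩ W).card := (hcardi i).symm
        _ ≤ (c i).toFinset.card := Finset.card_le_card Finset.inter_subset_left
        _ ≤ (c i).length := List.toFinset_card_le _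
    · rw [List.nodup_flatMap]
      constructor
      · intro t _
        rw [List.nodup_cons]
        constructor
        · intro h
          obtain ⟨h1, h2⟩ := hbl _ _ h
          exact (hf _ h2).1 (h1 ▸ (φ (pos i t)).2)
        · simp only [bl]; split_ifs <;> simp
      · refine List.Pairwise.imp_of_mem ?_ (List.nodup_range (n := m i))
        intro s t hs ht hst v hv1 hv2
        have := congrArg Fin.val (hsig i _ _ (hblock _ _ v hv1 hv2))
        simp only at this
        rw [List.mem_range] at hs ht
        rw [Nat.mod_eq_of_lt hs, Nat.mod_eq_of_lt ht] at this
        exact hst this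
    · have h0 : pos i (m i) = pos i 0 := by simp [pos]
      have := chain_flatMap (A := A) (fun t => (φ (pos i t) : V)) (fun t => bl (pos i t)) (by
        intro t
        simp only [hpos_succ, bl]
        split_ifs with h
        · simpa using h
        · have := hf _ h
          simp [this.2.1, this.2.2]) (m i)
      simp only [h0] at this
      exact this
  · intro i j hij v hv hv'
    obtain ⟨s, hs⟩ := hmem i v hv
    obtain ⟨t, ht⟩ := hmem j v hv'
    exact hij (congrArg Sigma.fst (hblock _ _ v hs ht))
end

section
/- Let G(X,Y) be a balanced bipartite graph with perfect matching M = {x_i y_i : x_i ∈ X, y_i ∈ Y, 1 ≤ i ≤ n}. Suppose M_0 ⊆ M and δ(M_0) ≥ (3n+1)/4. Then for every positive integer partition |M_0| = n_1 + ⋯ + n_k with n_i ≥ 2 for each i (k ≥ 1), G(X,Y) contains k pairwise vertex-disjoint M-alternating cycles C_1, …, C_k such that each C_i contains exactly n_i edges of M_0. -/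
/-- `e(S, T)`: the number of edges of `G` with one end in `S` and the other in `T`. -/
noncomputable def eBtw {V : Type*} (G : SimpleGraph V) (S T : Set V) : ℕ :=
  {e : Sym2 V | e ∈ G.edgeSet ∧ ∃ a b, e = s(a, b) ∧ a ∈ S ∧ b ∈ T}.ncard

/-- The set of vertices `{xᵢ, yᵢ : i ∈ F}` corresponding to a set `F` of matching
indices; here `Sum.inl i` plays the role of `xᵢ ∈ X` and `Sum.inr i` of `yᵢ ∈ Y`. -/
def iVerts {α : Type*} (F : Set α) : Set (α ⊕ α) :=
  {w | ∃ i ∈ F, w = Sum.inl i ∨ w = Sum.inr i}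

/-- An `M`-alternating cycle `x_{i₁} y_{i₁} x_{i₂} y_{i₂} ⋯ x_{i_r} y_{i_r} x_{i₁}`
(where `M = {xᵢyᵢ}` is the perfect matching), encoded by its list of matching
indices `i₁, …, i_r`: consecutive (cyclically) indices are joined by the non-matching
edges `y_{i_j} x_{i_{j+1}}`.  Such a cycle has `2 * l.length` edges, `l.length` of
which are matching edges. -/
def AltCycle {α : Type*} (G : SimpleGraph (α ⊕ α)) (l : List α) : Prop :=
  2 ≤ l.length ∧ l.Nodup ∧
    ∀ i : Fin l.length,
      G.Adj (Sum.inr (l.get i))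
        (Sum.inl (l.get ⟨((i : ℕ) + 1) % l.length, Nat.mod_lt _ i.pos⟩))

/-- An `M`-alternating path `x_{i₁} y_{i₁} ⋯ x_{i_r} y_{i_r}` beginning and ending
with matching edges, encoded by its list of matching indices. -/
def AltPath {α : Type*} (G : SimpleGraph (α ⊕ α)) (l : List α) : Prop :=
  l ≠ [] ∧ l.Nodup ∧ l.Chain' (fun a b => G.Adj (Sum.inr a) (Sum.inl b))

/-- A feasible path: an `M`-alternating path `x_{i₁} y_{i₁} ⋯ x_{i_r} y_{i_r}` whose
end-vertices `x_{i₁}` and `y_{i_r}` belong to `V(M₀)`, where `S` is the index set of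
`M₀ ⊆ M`. -/
def FeasPath {α : Type*} [DecidableEq α] (G : SimpleGraph (α ⊕ α)) (S : Finset α)
    (l : List α) : Prop :=
  AltPath G l ∧ ∀ h : l ≠ [], l.head h ∈ S ∧ l.getLast h ∈ S



set_option linter.unusedSectionVars false

open Classical in
/-- arc indicator -/
noncomputable def ar {V : Type*} (E : V → V → Prop) (x y : V) : ℤ := if E x y then 1 else 0

/-- number of arcs along a permutation -/
noncomputable def NN {V : Type*} [Fintype V] (E : V → V → Prop) (σ : Equiv.Perm V) : ℤ :=
  ∑ x, ar E x (σ x)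

section AltPerm
variable {V : Type*} [Fintype V] [DecidableEq V] (E : V → V → Prop)

lemma ar_nonneg (x y : V) : 0 ≤ ar E x y := by unfold ar; split_ifs <;> norm_num
lemma ar_le (x y : V) : ar E x y ≤ 1 := by unfold ar; split_ifs <;> norm_num
lemma ar_one {x y : V} (h : E x y) : ar E x y = 1 := by simp [ar, h]
lemma ar_zero {x y : V} (h : ¬ E x y) : ar E x y = 0 := by simp [ar, h]
lemma of_ar {x y : V} (h : ar E x y = 1) : E x y := by
  by_contra h'; simp [ar, h'] at h

lemma NN_conj (σ τ : Equiv.Perm V) :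
    NN E (τ * σ * τ⁻¹) = ∑ y, ar E (τ y) (τ (σ y)) := by
  unfold NN
  rw [← Equiv.sum_comp τ]
  simp

lemma NN_swap_sub (σ : Equiv.Perm V) (v x : V) (F : Finset V)
    (hF : ∀ y, y ∉ F → y ≠ v ∧ y ≠ x ∧ σ y ≠ v ∧ σ y ≠ x) :
    NN E (Equiv.swap v x * σ * (Equiv.swap v x)⁻¹) - NN E σ
      = ∑ y ∈ F, (ar E (Equiv.swap v x y) (Equiv.swap v x (σ y)) - ar E y (σ y)) := by
  rw [NN_conj, NN, ← Finset.sum_sub_distrib]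
  symm
  apply Finset.sum_subset (Finset.subset_univ _)
  intro y _ hy
  obtain ⟨h1, h2, h3, h4⟩ := hF y hy
  rw [Equiv.swap_apply_of_ne_of_ne h1 h2, Equiv.swap_apply_of_ne_of_ne h3 h4, sub_self]

/-- generic swap -/
lemma swap_gen (σ : Equiv.Perm V) (u y : V) (h1 : σ y ≠ σ u) (h2 : σ y ≠ u) (h3 : y ≠ σ u)
    (h4 : σ (σ y) ≠ σ y) (h5 : σ (σ u) ≠ σ u) :
    NN E (Equiv.swap (σ u) (σ y) * σ * (Equiv.swap (σ u) (σ y))⁻¹) - NN E σ =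
      ar E u (σ y) + ar E (σ y) (σ (σ u)) + ar E y (σ u) + ar E (σ u) (σ (σ y))
      - (ar E u (σ u) + ar E (σ u) (σ (σ u)) + ar E y (σ y) + ar E (σ y) (σ (σ y))) := by
  have hyu : y ≠ u := fun h => h1 (by rw [h])
  have hu : σ u ≠ u := fun h => h5 (by rw [h, h])
  have hy : σ y ≠ y := fun h => h4 (by rw [h, h])
  rw [NN_swap_sub E σ (σ u) (σ y) {u, σ u, σ y, y}]
  · rw [Finset.sum_insert, Finset.sum_insert, Finset.sum_insert, Finset.sum_singleton]
    · rw [Equiv.swap_apply_left, Equiv.swap_apply_right,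
        Equiv.swap_apply_of_ne_of_ne (a := σ u) (b := σ y) (x := u),
        Equiv.swap_apply_of_ne_of_ne (a := σ u) (b := σ y) (x := y),
        Equiv.swap_apply_of_ne_of_ne (a := σ u) (b := σ y) (x := σ (σ u)),
        Equiv.swap_apply_of_ne_of_ne (a := σ u) (b := σ y) (x := σ (σ y))]
      · ring
      all_goals first | assumption | (symm; assumption) | skip
      · intro h; exact h2 (σ.injective h)
      · intro h; exact h3 (σ.injective h).symm
    all_goals simp
    · exact hy
    · exact ⟨fun h => h1 (by rw [h]), fun h => h3 h.symm⟩
    · exact ⟨fun h => hu h.symm, fun h => h2 h.symm, fun h => hyu h.symm⟩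
  · intro z hz
    simp at hz
    refine ⟨hz.2.1, hz.2.2.1, fun h => hz.1 (σ.injective h), fun h => hz.2.2.2 (σ.injective h)⟩

/-- swap `v = σ u` with `σ v` -/
lemma swap_next (σ : Equiv.Perm V) (u : V) (h5 : σ (σ u) ≠ σ u) (h6 : σ (σ u) ≠ u) :
    NN E (Equiv.swap (σ u) (σ (σ u)) * σ * (Equiv.swap (σ u) (σ (σ u)))⁻¹) - NN E σ =
      ar E u (σ (σ u)) + ar E (σ (σ u)) (σ u) + ar E (σ u) (σ (σ (σ u)))
      - (ar E u (σ u) + ar E (σ u) (σ (σ u)) + ar E (σ (σ u)) (σ (σ (σ u)))) := by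
  have hu : σ u ≠ u := fun h => h5 (by rw [h, h])
  rw [NN_swap_sub E σ (σ u) (σ (σ u)) {u, σ u, σ (σ u)}]
  · rw [Finset.sum_insert, Finset.sum_insert, Finset.sum_singleton]
    · rw [Equiv.swap_apply_left, Equiv.swap_apply_right,
        Equiv.swap_apply_of_ne_of_ne (a := σ u) (x := u),
        Equiv.swap_apply_of_ne_of_ne (a := σ u) (x := σ (σ (σ u)))]
      · ring
      all_goals first | assumption | (symm; assumption) | skip
      · intro h; exact h6 (σ.injective h)
      · intro h; exact h5 (σ.injective h)
    all_goals simp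
    · exact fun h => hu h.symm
    · exact ⟨fun h => hu h.symm, fun h => h6 h.symm⟩
  · intro z hz
    simp at hz
    refine ⟨hz.2.1, hz.2.2, fun h => hz.1 (σ.injective h), fun h => hz.2.1 (σ.injective h)⟩


/-- the connectors from `u` to `v` outside `S` -/
noncomputable def conn_s3 (S : Finset V) (u v : V) : Finset V := by
  classical exact Finset.univ.filter (fun r => r ∉ S ∧ E u r ∧ E r v)

/-- swap-count terms -/
noncomputable def TT (σ : Equiv.Perm V) (u y : V) : ℤ :=
  ar E u (σ y) + ar E (σ y) (σ (σ u)) + ar E y (σ u) + ar E (σ u) (σ (σ y))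

/-- degree condition -/
def Deg (S : Finset V) : Prop := ∀ x ∈ S,
  3 * (Fintype.card V : ℤ) ≤ 4 * (∑ y, ar E x y) + 3 ∧
  3 * (Fintype.card V : ℤ) ≤ 4 * (∑ y, ar E y x) + 3

lemma mem_step {S : Finset V} {σ : Equiv.Perm V} (hS : ∀ x, σ x ≠ x ↔ x ∈ S) {x : V}
    (hx : x ∈ S) : σ x ∈ S := by
  rw [← hS] at hx ⊢
  exact fun h => hx (σ.injective h)

lemma TT_sum {S : Finset V} (hdeg : Deg E S) {σ : Equiv.Perm V}
    (hS : ∀ x, σ x ≠ x ↔ x ∈ S) {u : V} (hu : u ∈ S) :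
    3 * (Fintype.card V : ℤ) - 3 ≤ ∑ y, TT E σ u y := by
  have h1 := (hdeg u hu).1
  have hv := mem_step hS hu
  have h2 := (hdeg _ hv)
  have h3 := (hdeg _ (mem_step hS hv)).2
  have e : ∑ y, TT E σ u y = (∑ y, ar E u y) + (∑ y, ar E y (σ (σ u))) + (∑ y, ar E y (σ u))
      + ∑ y, ar E (σ u) y := by
    unfold TT
    rw [Finset.sum_add_distrib, Finset.sum_add_distrib, Finset.sum_add_distrib,
      Equiv.sum_comp σ (fun y => ar E u y), Equiv.sum_comp σ (fun y => ar E y (σ (σ u))),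
      Equiv.sum_comp σ (fun x => ar E (σ u) (σ x)), Equiv.sum_comp σ (fun y => ar E (σ u) y)]
  rw [e]; linarith [h2.1, h2.2]

section bounds
variable {E} {S : Finset V} {σ : Equiv.Perm V} {u : V}

lemma TT_self
    (hE : ∀ x, ¬ E x x) (hS : ∀ x, σ x ≠ x ↔ x ∈ S) (hu : u ∈ S) (hn : ¬ E u (σ u))
    : TT E σ u u = 2 * ar E (σ u) (σ (σ u)) := by
  unfold TT; rw [ar_zero E hn]; ring

lemma TT_out
    (hE : ∀ x, ¬ E x x) (hS : ∀ x, σ x ≠ x ↔ x ∈ S) (hu : u ∈ S) (hn : ¬ E u (σ u))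
    {y : V} (hy : y ∉ S) :
    TT E σ u y = ar E u y + ar E y (σ (σ u)) + ar E y (σ u) + ar E (σ u) y := by
  have : σ y = y := by by_contra h; exact hy ((hS y).1 h)
  unfold TT; rw [this, this]

lemma TT_pred
    (hE : ∀ x, ¬ E x x) (hS : ∀ x, σ x ≠ x ↔ x ∈ S) (hu : u ∈ S) (hn : ¬ E u (σ u))
    {y : V} (hy : σ y = u) :
    TT E σ u y = ar E u (σ (σ u)) + ar E y (σ u) := by
  unfold TT; rw [hy, ar_zero E (hE u), ar_zero E (hE (σ u))]; ring


lemma TT_next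
    (hE : ∀ x, ¬ E x x) (hS : ∀ x, σ x ≠ x ↔ x ∈ S) (hu : u ∈ S) (hn : ¬ E u (σ u))
    (hmax : ∀ x ∈ S, NN E (Equiv.swap (σ u) x * σ * (Equiv.swap (σ u) x)⁻¹) ≤ NN E σ)
    (h6 : σ (σ u) ≠ u) :
    TT E σ u (σ u) ≤ ar E (σ u) (σ (σ u)) + ar E (σ (σ u)) (σ (σ (σ u))) := by
  have hv := mem_step hS hu
  have := hmax _ (mem_step hS hv)
  have h := swap_next E σ u ((hS _).2 hv) h6
  rw [ar_zero E hn] at h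
  unfold TT
  rw [ar_zero E (hE (σ u)), ar_zero E (hE (σ (σ u)))]
  linarith [ar_nonneg E (σ (σ u)) (σ u)]

lemma TT_pred_le
    (hE : ∀ x, ¬ E x x) (hS : ∀ x, σ x ≠ x ↔ x ∈ S) (hu : u ∈ S) (hn : ¬ E u (σ u))
    (hmax : ∀ x ∈ S, NN E (Equiv.swap (σ u) x * σ * (Equiv.swap (σ u) x)⁻¹) ≤ NN E σ)
    {y : V} (hy : σ y = u) (h6 : σ (σ u) ≠ u) :
    TT E σ u y ≤ ar E y u + ar E (σ u) (σ (σ u)) := by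
  have hv := mem_step hS hu
  have := hmax u hu
  have h := swap_next E σ y (by rw [hy]; exact (hS _).2 hu)
    (by rw [hy]; rintro rfl; exact h6 (by rw [hy]))
  rw [hy, ar_zero E hn, Equiv.swap_comm] at h
  rw [TT_pred hE hS hu hn hy]
  linarith [ar_nonneg E (σ u) u]

lemma TT_gen
    (hE : ∀ x, ¬ E x x) (hS : ∀ x, σ x ≠ x ↔ x ∈ S) (hu : u ∈ S) (hn : ¬ E u (σ u))
    (hmax : ∀ x ∈ S, NN E (Equiv.swap (σ u) x * σ * (Equiv.swap (σ u) x)⁻¹) ≤ NN E σ)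
    {y : V} (hyS : y ∈ S) (h1 : y ≠ u) (h2 : σ y ≠ u) (h3 : y ≠ σ u) :
    TT E σ u y ≤ ar E (σ u) (σ (σ u)) + ar E y (σ y) + ar E (σ y) (σ (σ y)) := by
  have hv := mem_step hS hu
  have hy := mem_step hS hyS
  have := hmax _ hy
  have h := swap_gen E σ u y (fun h => h1 (σ.injective h)) h2 h3 ((hS _).2 hy) ((hS _).2 hv)
  rw [ar_zero E hn] at h
  unfold TT
  linarith

/-- main inequality, all cases -/
lemma conn_ge
    (hE : ∀ x, ¬ E x x) (hS : ∀ x, σ x ≠ x ↔ x ∈ S) (hu : u ∈ S) (hn : ¬ E u (σ u))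
    (hmax : ∀ x ∈ S, NN E (Equiv.swap (σ u) x * σ * (Equiv.swap (σ u) x)⁻¹) ≤ NN E σ)
    (hdeg : Deg E S) :
    (if σ (σ u) = u then 1 else 0) + 2 * ((S.card : ℤ) - NN E σ) - 2
      ≤ ((conn_s3 E S u (σ u)).card : ℤ) := by
  classical
  have hsum := TT_sum E hdeg hS hu
  set B : V → ℤ := fun y => (if y ∈ S then 1 else 3) + (if y ∈ conn_s3 E S u (σ u) then 1 else 0)
    + ar E y (σ y) + ar E (σ y) (σ (σ y))
    - ((if y = σ u then 1 else 0) + (if y = u ∧ σ (σ u) = u then 1 - ar E (σ u) u else 0)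
      + (if y = σ u ∧ σ (σ u) = u then ar E (σ u) u else 0)) with hB
  have hle : ∀ y, TT E σ u y ≤ B y := by
    intro y
    have hun : σ u ≠ u := (hS u).2 hu
    have hv := mem_step hS hu
    by_cases hyS : y ∈ S
    · have hc : y ∉ conn_s3 E S u (σ u) := by simp [conn_s3, hyS]
      simp only [hB, hyS, hc, if_true, if_false]
      by_cases h1 : y = u
      · subst h1
        rw [TT_self hE hS hu hn, ar_zero E hn]
        simp only [Ne.symm hun, false_and, if_false, true_and]
        split_ifs with h
        · rw [h]; linarith [ar_le E (σ y) y]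
        · linarith [ar_le E (σ y) (σ (σ y))]
      · simp only [h1, false_and, if_false]
        by_cases h6 : σ (σ u) = u
        · by_cases h3 : y = σ u
          · subst h3
            rw [TT_pred hE hS hu hn h6, h6, ar_zero E (hE _), ar_zero E (hE _)]
            simp
            linarith [ar_nonneg E (σ u) u, ar_nonneg E u (σ u)]
          · simp only [h3, false_and, if_false]
            have h2 : σ y ≠ u := fun h => h3 (σ.injective (by rw [h, h6]))
            have := TT_gen hE hS hu hn hmax hyS h1 h2 h3
            linarith [ar_le E (σ u) (σ (σ u))]
        · by_cases h3 : y = σ u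
          · subst h3
            have := TT_next hE hS hu hn hmax h6
            simp [h6]; linarith
          · simp only [h3, false_and, if_false]
            by_cases h2 : σ y = u
            · have := TT_pred_le hE hS hu hn hmax h2 h6
              rw [h2, ar_zero E hn]
              linarith [ar_le E (σ u) (σ (σ u))]
            · have := TT_gen hE hS hu hn hmax hyS h1 h2 h3
              linarith [ar_le E (σ u) (σ (σ u))]
    · have e : σ y = y := by by_contra h; exact hyS ((hS y).1 h)
      have h1 : y ≠ u := fun h => hyS (h ▸ hu)
      have h3 : y ≠ σ u := fun h => hyS (h ▸ hv)
      rw [TT_out hE hS hu hn hyS]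
      simp only [hB, hyS, h1, h3, e, if_false, false_and, ar_zero E (hE _)]
      have a1 := ar_le E u y
      have a2 := ar_le E y (σ u)
      have a3 := ar_le E y (σ (σ u))
      have a4 := ar_le E (σ u) y
      split_ifs with h
      · linarith
      · have : ¬ (E u y ∧ E y (σ u)) := by simpa [conn_s3, hyS] using h
        by_cases hh : E u y
        · have := ar_zero E (fun h' => this ⟨hh, h'⟩)
          linarith
        · have := ar_zero E hh
          linarith
  have hBs : ∑ y, B y = 3 * (Fintype.card V : ℤ) - 2 * S.card + (conn_s3 E S u (σ u)).card
      + 2 * NN E σ - (1 + if σ (σ u) = u then 1 else 0) := by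
    simp only [hB, Finset.sum_sub_distrib, Finset.sum_add_distrib]
    have e1 : ∑ y, (if y ∈ S then (1:ℤ) else 3) = 3 * Fintype.card V - 2 * S.card := by
      have : ∀ y, (if y ∈ S then (1:ℤ) else 3) = 3 - 2 * (if y ∈ S then 1 else 0) := by
        intro y; split_ifs <;> norm_num
      simp only [this, Finset.sum_sub_distrib, ← Finset.mul_sum]
      simp; ring
    have e2 : ∑ y, ar E (σ y) (σ (σ y)) = NN E σ := by
      unfold NN; exact Equiv.sum_comp σ (fun y => ar E y (σ y))
    rw [e1, e2]
    by_cases h : σ (σ u) = u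
    · simp [NN, h]; ring
    · simp [NN, h]; ring
  have := Finset.sum_le_sum (fun y (_ : y ∈ Finset.univ) => hle y)
  rw [hBs] at this
  linarith

/-- tight case -/
lemma tight_s3
    (hE : ∀ x, ¬ E x x) (hS : ∀ x, σ x ≠ x ↔ x ∈ S) (hu : u ∈ S) (hn : ¬ E u (σ u))
    (hmax : ∀ x ∈ S, NN E (Equiv.swap (σ u) x * σ * (Equiv.swap (σ u) x)⁻¹) ≤ NN E σ)
    (hdeg : Deg E S) (hall : ∀ x ∈ S, x ≠ u → E x (σ x)) (h6 : σ (σ u) ≠ u)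
    (hc : conn_s3 E S u (σ u) = ∅) :
    E u (σ (σ u)) ∧ (∀ y, σ y = u → E y (σ u)) ∧ ∀ r, r ∉ S → E (σ u) r := by
  classical
  have hsum := TT_sum E hdeg hS hu
  have hun : σ u ≠ u := (hS u).2 hu
  have hv := mem_step hS hu
  set B : V → ℤ := fun y => 3 - ((if y = u then 1 else 0) + (if y = σ u then 1 else 0)
    + (if y = σ⁻¹ u then 1 else 0)) with hB
  have hp : ∀ y, y = σ⁻¹ u ↔ σ y = u := fun y => by rw [Equiv.Perm.eq_inv_iff_eq]
  have hle : ∀ y, TT E σ u y ≤ B y := by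
    intro y
    simp only [hB, hp]
    by_cases hyS : y ∈ S
    · by_cases h1 : y = u
      · subst h1
        rw [TT_self hE hS hu hn, if_neg (Ne.symm hun), if_neg hun]
        simp; linarith [ar_le E (σ y) (σ (σ y))]
      · rw [if_neg h1]
        by_cases h3 : y = σ u
        · subst h3
          have := TT_next hE hS hu hn hmax h6
          rw [if_neg h6]
          simp; linarith [ar_le E (σ u) (σ (σ u)), ar_le E (σ (σ u)) (σ (σ (σ u)))]
        · rw [if_neg h3]
          by_cases h2 : σ y = u
          · rw [TT_pred hE hS hu hn h2, if_pos h2]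
            linarith [ar_le E y (σ u), ar_le E u (σ (σ u))]
          · have := TT_gen hE hS hu hn hmax hyS h1 h2 h3
            rw [if_neg h2]
            linarith [ar_le E (σ u) (σ (σ u)), ar_le E y (σ y), ar_le E (σ y) (σ (σ y))]
    · have e : σ y = y := by by_contra h; exact hyS ((hS y).1 h)
      have h1 : y ≠ u := fun h => hyS (h ▸ hu)
      have h3 : y ≠ σ u := fun h => hyS (h ▸ hv)
      rw [TT_out hE hS hu hn hyS]
      simp only [h1, h3, e, if_false]
      have a1 := ar_le E u y
      have a2 := ar_le E y (σ u)
      have a3 := ar_le E y (σ (σ u))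
      have a4 := ar_le E (σ u) y
      have : ¬ (E u y ∧ E y (σ u)) := by
        have h : y ∉ conn_s3 E S u (σ u) := by rw [hc]; simp
        simpa [conn_s3, hyS] using h
      by_cases hh : E u y
      · have := ar_zero E (fun h' => this ⟨hh, h'⟩)
        linarith
      · have := ar_zero E hh
        linarith
  have hBs : ∑ y, B y = 3 * (Fintype.card V : ℤ) - 3 := by
    simp only [hB, Finset.sum_sub_distrib, Finset.sum_add_distrib]
    simp; ring
  have heq : ∀ y, TT E σ u y = B y := by
    have h0 : ∑ y, (B y - TT E σ u y) = 0 := by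
      apply le_antisymm
      · rw [Finset.sum_sub_distrib, hBs]; linarith
      · exact Finset.sum_nonneg (fun y _ => by linarith [hle y])
    rw [Finset.sum_eq_zero_iff_of_nonneg (fun y _ => by linarith [hle y])] at h0
    intro y; linarith [h0 y (Finset.mem_univ _)]
  have key : ∀ y, σ y = u → E u (σ (σ u)) ∧ E y (σ u) := by
    intro y hy
    have h := heq y
    have h1 : y ≠ u := by rintro rfl; exact hun hy
    have h3 : y ≠ σ u := by rintro rfl; exact h6 hy
    simp only [hB, hp, hy, h1, h3, if_true, if_false] at h
    rw [TT_pred hE hS hu hn hy] at h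
    constructor <;> apply of_ar
    · linarith [ar_le E y (σ u), ar_le E u (σ (σ u))]
    · linarith [ar_le E y (σ u), ar_le E u (σ (σ u))]
  refine ⟨(key (σ⁻¹ u) (by simp)).1, fun y hy => (key y hy).2, ?_⟩
  intro y hyS
  have e : σ y = y := by by_contra h; exact hyS ((hS y).1 h)
  have h1 : y ≠ u := fun h => hyS (h ▸ hu)
  have h3 : y ≠ σ u := fun h => hyS (h ▸ hv)
  have h := heq y
  rw [TT_out hE hS hu hn hyS] at h
  simp only [hB, hp, h1, h3, e, if_false] at h
  have a1 := ar_le E u y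
  have a2 := ar_le E y (σ u)
  have a3 := ar_le E y (σ (σ u))
  have a4 := ar_le E (σ u) y
  have : ¬ (E u y ∧ E y (σ u)) := by
    have h : y ∉ conn_s3 E S u (σ u) := by rw [hc]; simp
    simpa [conn_s3, hyS] using h
  apply of_ar
  by_cases hh : E u y
  · have := ar_zero E (fun h' => this ⟨hh, h'⟩)
    linarith
  · have := ar_zero E hh
    linarith

end bounds

lemma perm_inv_self (σ : Equiv.Perm V) (x : V) : σ⁻¹ (σ x) = x := σ.symm_apply_apply x

lemma conj_step (s : Equiv.Perm V) (u a : V) (hs : s u = u) :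
    IsConj (s * Equiv.swap a u) (s * Equiv.swap (s a) u) := by
  rw [isConj_iff]
  refine ⟨Equiv.swap (s a) u, ?_⟩
  have : s * Equiv.swap a u = Equiv.swap (s a) u * s := by
    rw [Equiv.mul_swap_eq_swap_mul, hs]
  rw [this]
  simp [← mul_assoc]

lemma conj_pow_swap (s : Equiv.Perm V) (u b : V) (hs : s u = u) (i : ℕ) :
    IsConj (s * Equiv.swap b u) (s * Equiv.swap ((s ^ i) b) u) := by
  induction i with
  | zero => exact IsConj.refl _
  | succ i ih =>
    refine ih.trans ?_
    rw [pow_succ', Equiv.Perm.mul_apply]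
    exact conj_step s u _ hs

lemma insertion (hE : ∀ x, ¬ E x x) (hdeg : Deg E (Finset.univ : Finset V)) (σ : Equiv.Perm V)
    (hσ : ∀ x, σ x ≠ x) (hbest : ∀ ρ, IsConj σ ρ → ∃ x, ¬ E x (ρ x)) (u : V)
    (hall : ∀ x, x ≠ u → E x (σ x)) (hb : E (σ⁻¹ u) (σ u)) : False := by
  classical
  set b := σ⁻¹ u with hbdef
  have hσb : σ b = u := by simp [hbdef]
  have hbu : b ≠ u := by intro h; rw [h] at hσb; exact hσ u hσb
  obtain ⟨s, hs⟩ : ∃ s : Equiv.Perm V, s = σ * Equiv.swap b u := ⟨_, rfl⟩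
  have hsu : s u = u := by simp [hs, hσb]
  have hsσ : s * Equiv.swap b u = σ := by rw [hs]; simp [mul_assoc]
  have hsE : ∀ x, x ≠ u → E x (s x) := by
    intro x hx
    by_cases hxb : x = b
    · rw [hxb]; simpa [hs] using hb
    · rw [hs, Equiv.Perm.mul_apply, Equiv.swap_apply_of_ne_of_ne hxb hx]; exact hall x hx
  have hsne : ∀ x, x ≠ u → s x ≠ u := fun x hx h => hx (s.injective (by rw [h, hsu]))
  obtain ⟨A, hA⟩ : ∃ A : Finset V, A = Finset.univ.filter (fun a => s.SameCycle b a) := ⟨_, rfl⟩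
  have hAm : ∀ a, a ∈ A ↔ s.SameCycle b a := by simp [hA]
  have hAs : ∀ a, s a ∈ A ↔ a ∈ A := by
    intro a; rw [hAm, hAm, Equiv.Perm.sameCycle_apply_right]
  have hbA : b ∈ A := by rw [hAm]
  have huA : u ∉ A := by
    rw [hAm]; intro h
    exact hbu (h.eq_of_right hsu)
  have hconj : ∀ a ∈ A, IsConj σ (s * Equiv.swap a u) := by
    intro a ha
    obtain ⟨i, _, rfl⟩ := ((hAm a).1 ha).exists_pow_eq'
    have := conj_pow_swap s u b hsu i
    rwa [hsσ] at this
  obtain ⟨Z, hZ⟩ : ∃ Z : Finset V, Z = Finset.univ.filter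
    (fun z => z = u ∨ (z ∉ A ∧ E (s⁻¹ z) u ∧ E u (s z))) := ⟨_, rfl⟩
  have hZm : ∀ z, z ∈ Z ↔ z = u ∨ (z ∉ A ∧ E (s⁻¹ z) u ∧ E u (s z)) := by simp [hZ]
  have claim : ∀ z ∈ Z, ∀ a ∈ A, ¬ (E a z ∧ E z (s a)) := by
    rintro z hz a ha ⟨h1, h2⟩
    rw [hZm] at hz
    have hau : a ≠ u := fun h => huA (h ▸ ha)
    have hzA : z ∉ A := by rcases hz with rfl | h; exacts [huA, h.1]
    have haz : a ≠ z := fun h => hzA (h ▸ ha)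
    obtain ⟨x, hx⟩ := hbest (Equiv.swap u z * (s * Equiv.swap a u) * (Equiv.swap u z)⁻¹)
      ((hconj a ha).trans (isConj_iff.2 ⟨_, rfl⟩))
    apply hx
    obtain ⟨y, rfl⟩ := (Equiv.swap u z).surjective x
    simp only [Equiv.Perm.mul_apply, perm_inv_self]
    by_cases hyu : y = u
    · subst hyu
      have : s a ∈ A := (hAs a).2 ha
      rw [Equiv.swap_apply_right, Equiv.swap_apply_left, Equiv.swap_apply_of_ne_of_ne]
      · exact h2
      · exact fun h => huA (h ▸ this)
      · exact fun h => hzA (h ▸ this)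
    by_cases hya : y = a
    · subst hya
      rw [Equiv.swap_apply_left, hsu, Equiv.swap_apply_left, Equiv.swap_apply_of_ne_of_ne hyu haz]
      exact h1
    rw [Equiv.swap_apply_of_ne_of_ne hya hyu]
    by_cases hyz : y = z
    · subst hyz
      have hz' := hz.resolve_left hyu
      rw [Equiv.swap_apply_right, Equiv.swap_apply_of_ne_of_ne (hsne y hyu)]
      · exact hz'.2.2
      · intro h; exact hE y (by have := hsE y hyu; rwa [h] at this)
    rw [Equiv.swap_apply_of_ne_of_ne hyu hyz]
    by_cases hsy : s y = z
    · rw [hsy, Equiv.swap_apply_right]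
      have hzu : z ≠ u := hsy ▸ hsne y hyu
      have := (hz.resolve_left hzu).2.1
      rwa [← hsy, perm_inv_self] at this
    · rw [Equiv.swap_apply_of_ne_of_ne (hsne y hyu) hsy]
      exact hsE y hyu
  have hshift : ∀ f : V → ℤ, ∑ a ∈ A, f (s a) = ∑ a ∈ A, f a := by
    intro f
    exact Finset.sum_equiv s (fun a => (hAs a).symm) (fun a _ => rfl)
  have hshift' : ∀ f : V → ℤ, ∑ a ∈ A, f (s⁻¹ a) = ∑ a ∈ A, f a := by
    intro f
    rw [← hshift]; simp
  have hdA : ∀ z ∈ Z, ∑ a ∈ A, (ar E a z + ar E z a) ≤ A.card := by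
    intro z hz
    rw [Finset.sum_add_distrib, ← hshift (fun a => ar E z a), ← Finset.sum_add_distrib]
    have : (A.card : ℤ) = ∑ a ∈ A, 1 := by simp
    rw [this]
    apply Finset.sum_le_sum
    intro a ha
    have hc := claim z hz a ha
    by_cases h : E a z
    · rw [ar_zero E (fun h' => hc ⟨h, h'⟩)]; linarith [ar_le E a z]
    · rw [ar_zero E h]; linarith [ar_le E z (s a)]
  have huZ : u ∈ Z := by rw [hZm]; left; rfl
  have hZA : ∀ z ∈ Z, z ∉ A := by
    intro z hz
    rcases (hZm z).1 hz with rfl | h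
    exacts [huA, h.1]
  -- first count
  have c1 : (∑ y, ar E u y) + (∑ y, ar E y u) ≤ (Fintype.card V : ℤ) + Z.card - 2 := by
    have e1 : (∑ y, ar E u y) + (∑ y, ar E y u) = ∑ x, (ar E (s⁻¹ x) u + ar E u (s x)) := by
      rw [Finset.sum_add_distrib, Equiv.sum_comp s (fun y => ar E u y),
        Equiv.sum_comp s⁻¹ (fun y => ar E y u), add_comm]
    rw [e1, ← Finset.sum_add_sum_compl A]
    have e2 : ∑ x ∈ A, (ar E (s⁻¹ x) u + ar E u (s x)) ≤ A.card := by
      rw [Finset.sum_add_distrib, hshift (fun y => ar E u y), hshift' (fun y => ar E y u),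
        ← Finset.sum_add_distrib]
      exact hdA u huZ
    have e3 : ∑ x ∈ Aᶜ, (ar E (s⁻¹ x) u + ar E u (s x)) ≤
        ∑ x ∈ Aᶜ, (1 + (if x ∈ Z then 1 else 0) - 2 * (if x = u then 1 else 0) : ℤ) := by
      apply Finset.sum_le_sum
      intro x hx
      rw [Finset.mem_compl] at hx
      by_cases hxu : x = u
      · subst hxu
        have : s⁻¹ x = x := by rw [Equiv.Perm.inv_eq_iff_eq, hsu]
        rw [this, hsu, ar_zero E (hE _)]
        simp [huZ]
      · have a1 := ar_le E (s⁻¹ x) u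
        have a2 := ar_le E u (s x)
        rw [if_neg hxu]
        split_ifs with h
        · linarith
        · rw [hZm] at h
          by_cases h1 : E (s⁻¹ x) u
          · rw [ar_zero E (fun h2 => h (Or.inr ⟨hx, h1, h2⟩))]; linarith
          · rw [ar_zero E h1]; linarith
    have e4 : ∑ x ∈ Aᶜ, (1 + (if x ∈ Z then 1 else 0) - 2 * (if x = u then 1 else 0) : ℤ)
        = (Fintype.card V - A.card) + Z.card - 2 := by
      rw [Finset.sum_sub_distrib, Finset.sum_add_distrib, ← Finset.mul_sum]
      have f1 : ∑ x ∈ Aᶜ, (1 : ℤ) = Fintype.card V - A.card := by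
        have := Finset.card_add_card_compl A
        simp; omega
      have f2 : ∑ x ∈ Aᶜ, (if x ∈ Z then 1 else 0 : ℤ) = Z.card := by
        rw [Finset.sum_ite_mem, Finset.inter_eq_right.2]
        · simp
        · intro z hz; rw [Finset.mem_compl]; exact hZA z hz
      have f3 : ∑ x ∈ Aᶜ, (if x = u then 1 else 0 : ℤ) = 1 := by
        simp [huA]
      rw [f1, f2, f3]; ring
    linarith
  -- second count
  have c2 : ∑ a ∈ A, ((∑ y, ar E a y) + (∑ y, ar E y a)) ≤
      2 * A.card * (Fintype.card V : ℤ) - A.card * Z.card - 2 * A.card := by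
    have e1 : ∑ a ∈ A, ((∑ y, ar E a y) + (∑ y, ar E y a)) =
        ∑ x, ∑ a ∈ A, (ar E a x + ar E x a) := by
      rw [Finset.sum_comm]
      apply Finset.sum_congr rfl
      intro a _
      rw [Finset.sum_add_distrib]
    rw [e1]
    have e2 : ∀ x, ∑ a ∈ A, (ar E a x + ar E x a) ≤
        2 * A.card - A.card * (if x ∈ Z then 1 else 0) - 2 * (if x ∈ A then 1 else 0) := by
      intro x
      by_cases hxZ : x ∈ Z
      · have := hdA x hxZ
        simp only [hxZ, hZA x hxZ, if_true, if_false]; linarith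
      · have : ∑ a ∈ A, (ar E a x + ar E x a) ≤ ∑ a ∈ A, (2 - 2 * (if a = x then 1 else 0)) := by
          apply Finset.sum_le_sum
          intro a _
          split_ifs with h
          · rw [h, ar_zero E (hE x)]; norm_num
          · linarith [ar_le E a x, ar_le E x a]
        refine this.trans (le_of_eq ?_)
        rw [Finset.sum_sub_distrib, ← Finset.mul_sum]
        simp [hxZ]
        ring
    refine (Finset.sum_le_sum (fun x _ => e2 x)).trans (le_of_eq ?_)
    rw [Finset.sum_sub_distrib, Finset.sum_sub_distrib, ← Finset.mul_sum, ← Finset.mul_sum]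
    simp
    ring
  have c3 : ∑ a ∈ A, ((3 * (Fintype.card V : ℤ) - 3)) ≤
      ∑ a ∈ A, 2 * ((∑ y, ar E a y) + (∑ y, ar E y a)) := by
    apply Finset.sum_le_sum
    intro a _
    have := hdeg a (Finset.mem_univ a)
    linarith [this.1, this.2]
  rw [← Finset.mul_sum, Finset.sum_const, nsmul_eq_mul] at c3
  have hu := hdeg u (Finset.mem_univ u)
  have hp : (0 : ℤ) < A.card := by exact_mod_cast Finset.card_pos.2 ⟨b, hbA⟩
  nlinarith [hu.1, hu.2]

/-- the non-arcs of `σ` in `S` -/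
noncomputable def bad (S : Finset V) (σ : Equiv.Perm V) : Finset V := by
  classical exact S.filter (fun x => ¬ E x (σ x))

lemma NN_bad (hE : ∀ x, ¬ E x x) {S : Finset V} {σ : Equiv.Perm V}
    (hS : ∀ x, σ x ≠ x ↔ x ∈ S) : NN E σ = S.card - (bad E S σ).card := by
  classical
  have h1 : NN E σ = ∑ x ∈ S, ar E x (σ x) := by
    symm
    apply Finset.sum_subset (Finset.subset_univ _)
    intro x _ hx
    have e : σ x = x := by by_contra h; exact hx ((hS x).1 h)
    rw [e, ar_zero E (hE x)]
  have h2 : ((bad E S σ).card : ℤ) = ∑ x ∈ S, (1 - ar E x (σ x)) := by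
    simp only [bad, Finset.card_filter]
    push_cast
    apply Finset.sum_congr rfl
    intro x _
    by_cases h : E x (σ x) <;> simp [ar, h]
  rw [h1, h2, Finset.sum_sub_distrib]
  simp

lemma NN_flip (σ : Equiv.Perm V) : NN (flip E) σ⁻¹ = NN E σ := by
  unfold NN
  rw [← Equiv.sum_comp σ]
  apply Finset.sum_congr rfl
  intro x _
  rw [perm_inv_self]
  rfl

lemma supp_swap {S : Finset V} {σ : Equiv.Perm V} (hS : ∀ x, σ x ≠ x ↔ x ∈ S) {a b : V}
    (ha : a ∈ S) (hb : b ∈ S) :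
    ∀ x, (Equiv.swap a b * σ * (Equiv.swap a b)⁻¹) x ≠ x ↔ x ∈ S := by
  intro x
  obtain ⟨y, rfl⟩ := (Equiv.swap a b).surjective x
  simp only [Equiv.Perm.mul_apply, perm_inv_self]
  rw [(Equiv.swap a b).injective.ne_iff, hS]
  by_cases h1 : y = a
  · subst h1; simp [ha, hb]
  by_cases h2 : y = b
  · subst h2; simp [ha, hb]
  rw [Equiv.swap_apply_of_ne_of_ne h1 h2]

theorem main_perm (hE : ∀ x, ¬ E x x) {S : Finset V} (hdeg : Deg E S) (σ₀ : Equiv.Perm V)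
    (hS₀ : ∀ x, σ₀ x ≠ x ↔ x ∈ S) :
    ∃ σ, IsConj σ₀ σ ∧ (∀ x, σ x ≠ x ↔ x ∈ S) ∧
      ∀ u ∈ bad E S σ, (bad E S σ).card ≤ (conn_s3 E S u (σ u)).card := by
  classical
  obtain ⟨σ, ⟨hc, hS⟩, hmax⟩ := Set.exists_max_image
    {σ : Equiv.Perm V | IsConj σ₀ σ ∧ ∀ x, σ x ≠ x ↔ x ∈ S} (NN E) (Set.toFinite _)
    ⟨σ₀, IsConj.refl _, hS₀⟩
  by_contra hcon
  push Not at hcon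
  obtain ⟨u, hub, hlt⟩ := hcon σ hc hS
  have hbadm : ∀ (ρ : Equiv.Perm V) x, x ∈ bad E S ρ ↔ x ∈ S ∧ ¬ E x (ρ x) := by
    intro ρ x; simp [bad]
  obtain ⟨hu, hn⟩ := (hbadm σ u).1 hub
  have hv := mem_step hS hu
  have hm1 : ∀ a ∈ S, ∀ x ∈ S, NN E (Equiv.swap a x * σ * (Equiv.swap a x)⁻¹) ≤ NN E σ :=
    fun a ha x hx => hmax _ ⟨hc.trans (isConj_iff.2 ⟨_, rfl⟩), supp_swap hS ha hx⟩
  have hge := conn_ge hE hS hu hn (hm1 _ hv) hdeg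
  rw [NN_bad E hE hS] at hge
  have hpos : 0 < (bad E S σ).card := Finset.card_pos.2 ⟨u, hub⟩
  have h6 : σ (σ u) ≠ u := by
    intro h; rw [if_pos h] at hge; omega
  rw [if_neg h6] at hge
  have ht : (bad E S σ).card = 1 := by omega
  have hc0 : conn_s3 E S u (σ u) = ∅ := by rw [← Finset.card_eq_zero]; omega
  have hall : ∀ x ∈ S, x ≠ u → E x (σ x) := by
    intro x hx hxu
    by_contra h
    obtain ⟨w, hw⟩ := Finset.card_eq_one.1 ht
    have h1 : x ∈ bad E S σ := (hbadm _ _).2 ⟨hx, h⟩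
    rw [hw, Finset.mem_singleton] at h1 hub
    exact hxu (h1.trans hub.symm)
  obtain ⟨t1, t2, t3⟩ := tight_s3 hE hS hu hn (hm1 _ hv) hdeg hall h6 hc0
  have hun : σ u ≠ u := (hS u).2 hu
  have hvv : σ (σ u) ≠ σ u := (hS _).2 hv
  -- the reverse
  have hS' : ∀ x, σ⁻¹ x ≠ x ↔ x ∈ S := by
    intro x; rw [← hS, Ne, Ne, Equiv.Perm.inv_eq_iff_eq, eq_comm]
  have t3' : ∀ r, r ∉ S → E r u := by
    have := (tight_s3 (E := flip E) (fun x => hE x) (S := S) (σ := σ⁻¹) hS' (u := σ u) hv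
      (by simpa [flip] using hn) ?_ ?_ ?_ ?_ ?_).2.2
    · simpa [flip] using this
    · intro x hx
      rw [perm_inv_self, NN_flip]
      have : Equiv.swap u x * σ⁻¹ * (Equiv.swap u x)⁻¹ =
        (Equiv.swap u x * σ * (Equiv.swap u x)⁻¹)⁻¹ := by group
      rw [this, NN_flip]
      exact hm1 u hu x hx
    · intro x hx
      exact ⟨(hdeg x hx).2, (hdeg x hx).1⟩
    · intro x hx hxu
      have h1 : σ⁻¹ x ∈ S := mem_step hS' hx
      have := hall (σ⁻¹ x) h1 (by
        intro h; apply hxu; rw [← h]; simp)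
      simpa [flip] using this
    · intro h
      apply h6
      rw [perm_inv_self, Equiv.Perm.inv_eq_iff_eq] at h
      exact h.symm
    · rw [perm_inv_self, ← hc0]
      ext r; simp [conn_s3, flip, and_comm]
  by_cases hR : ∃ r, r ∉ S
  · obtain ⟨r, hr⟩ := hR
    obtain ⟨ρ, hρ⟩ : ∃ ρ, ρ = Equiv.swap u (σ u) * σ * (Equiv.swap u (σ u))⁻¹ := ⟨_, rfl⟩
    have hρv : ρ (σ u) = u := by simp [hρ]
    have hρE : ∀ x ∈ S, x ≠ σ u → E x (ρ x) := by
      intro x hx hxv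
      by_cases hxu : x = u
      · subst hxu
        have : ρ x = σ (σ x) := by
          simp only [hρ, Equiv.swap_inv, Equiv.Perm.mul_apply, Equiv.swap_apply_left]
          exact Equiv.swap_apply_of_ne_of_ne h6 hvv
        rw [this]; exact t1
      · have e : ρ x = Equiv.swap u (σ u) (σ x) := by
          simp only [hρ, Equiv.swap_inv, Equiv.Perm.mul_apply]
          rw [Equiv.swap_apply_of_ne_of_ne hxu hxv]
        by_cases hxp : σ x = u
        · rw [e, hxp, Equiv.swap_apply_left]; exact t2 x hxp
        · rw [e, Equiv.swap_apply_of_ne_of_ne hxp (fun h => hxu (σ.injective h))]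
          exact hall x hx hxu
    obtain ⟨w, hw, hlt'⟩ := hcon ρ (hρ ▸ hc.trans (isConj_iff.2 ⟨_, rfl⟩))
      (hρ ▸ supp_swap hS hu hv)
    have hsub : bad E S ρ ⊆ {σ u} := by
      intro x hx
      obtain ⟨hxS, hxn⟩ := (hbadm _ _).1 hx
      rw [Finset.mem_singleton]
      by_contra h
      exact hxn (hρE x hxS h)
    have hle : (bad E S ρ).card ≤ 1 := by simpa using Finset.card_le_card hsub
    have hwv : w = σ u := by simpa using hsub hw
    have : 0 < (conn_s3 E S w (ρ w)).card := by
      refine Finset.card_pos.2 ⟨r, ?_⟩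
      rw [hwv, hρv]
      simp [conn_s3, hr, t3 r hr, t3' r hr]
    omega
  · push Not at hR
    have hSu : S = Finset.univ := by ext; simp [hR]
    subst hSu
    refine insertion E hE hdeg σ (fun x => (hS x).2 (Finset.mem_univ x)) ?_ u
      (fun x hx => hall x (Finset.mem_univ x) hx) (t2 _ (by simp))
    intro ρ hρ
    by_contra h
    push Not at h
    have hρS : ∀ x, ρ x ≠ x ↔ x ∈ (Finset.univ : Finset V) := by
      intro x
      simp only [Finset.mem_univ, iff_true]
      intro hx
      exact hE x (by have := h x; rwa [hx] at this)
    have := hmax ρ ⟨hc.trans hρ, hρS⟩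
    rw [NN_bad E hE hS, NN_bad E hE hρS, ht] at this
    have h0 : bad E Finset.univ ρ = ∅ := by
      ext x; simp [hbadm, h]
    rw [h0] at this
    simp at this

theorem main_hall (hE : ∀ x, ¬ E x x) {S : Finset V} (hdeg : Deg E S) (σ₀ : Equiv.Perm V)
    (hS₀ : ∀ x, σ₀ x ≠ x ↔ x ∈ S) :
    ∃ σ, IsConj σ₀ σ ∧ (∀ x, σ x ≠ x ↔ x ∈ S) ∧ ∃ g : V → V,
      (∀ x ∈ S, ¬ E x (σ x) → g x ∉ S ∧ E x (g x) ∧ E (g x) (σ x)) ∧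
      (∀ x ∈ S, ∀ y ∈ S, ¬ E x (σ x) → ¬ E y (σ y) → g x = g y → x = y) := by
  classical
  obtain ⟨σ, h1, h2, h3⟩ := main_perm E hE hdeg σ₀ hS₀
  refine ⟨σ, h1, h2, ?_⟩
  have := (Finset.all_card_le_biUnion_card_iff_exists_injective
    (fun x : {x // x ∈ bad E S σ} => conn_s3 E S x.1 (σ x.1))).1 (by
      intro s
      rcases s.eq_empty_or_nonempty with rfl | ⟨x, hx⟩
      · simp
      · calc s.card ≤ Fintype.card {x // x ∈ bad E S σ} := Finset.card_le_univ _
          _ = (bad E S σ).card := by simp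
          _ ≤ _ := h3 x.1 x.2
          _ ≤ _ := Finset.card_le_card
            (Finset.subset_biUnion_of_mem (fun x : {x // x ∈ bad E S σ} => conn_s3 E S x.1 (σ x.1)) hx))
  obtain ⟨f, hf, hfm⟩ := this
  have hbm : ∀ x, x ∈ S → ¬ E x (σ x) → x ∈ bad E S σ := by
    intro x h h'; simp [bad, h, h']
  refine ⟨fun x => if h : x ∈ bad E S σ then f ⟨x, h⟩ else x, ?_, ?_⟩
  · intro x hx hn
    have hb := hbm x hx hn
    have := hfm ⟨x, hb⟩
    simp only [hb, dif_pos]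
    simpa [conn_s3] using this
  · intro x hx y hy hnx hny h
    simp only [hbm x hx hnx, hbm y hy hny, dif_pos] at h
    simpa using hf h

end AltPerm

lemma chain_flat {α : Type*} (R : α → α → Prop) (h : ℕ → α) (t : ℕ → List α)
    (hc : ∀ j, List.IsChain R ((h j :: t j) ++ [h (j + 1)])) (N : ℕ) :
    List.IsChain R ((List.range N).flatMap (fun j => h j :: t j) ++ [h N]) := by
  induction N with
  | zero => simp
  | succ N ih =>
    rw [List.range_succ, List.flatMap_append]
    simp only [List.flatMap_cons, List.flatMap_nil, List.append_nil, List.append_assoc]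
    rw [List.cons_append, List.isChain_split]
    exact ⟨ih, by simpa using hc N⟩

lemma altCycle_of_chain {α : Type*} (G : SimpleGraph (α ⊕ α)) (l : List α) (x : α)
    (h2 : 2 ≤ l.length) (hn : l.Nodup) (hx : ∀ h : 0 < l.length, l[0] = x)
    (hc : List.IsChain (fun a b => G.Adj (Sum.inr a) (Sum.inl b)) (l ++ [x])) :
    AltCycle G l := by
  refine ⟨h2, hn, ?_⟩
  intro i
  rw [List.isChain_iff_getElem] at hc
  have := hc i.1 (by simp)
  rw [List.getElem_append_left i.2] at this
  simp only [List.get_eq_getElem]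
  by_cases hi : i.1 + 1 < l.length
  · rw [List.getElem_append_left hi] at this
    simpa [Nat.mod_eq_of_lt hi] using this
  · have e : i.1 + 1 = l.length := by omega
    have h0 := hx (by omega)
    simp only [e, Nat.mod_self]
    rw [h0]
    simpa [e] using this

lemma deg_sum {α : Type*} [Fintype α] (P : α → Prop) (T : Set (α ⊕ α))
    (i : α) (hi : P i) (c : α → α ⊕ α) (hcinj : Function.Injective c)
    (hT : ∀ w, w ∈ T ↔ ∃ j, P j ∧ w = c j) (E : α → Prop) (hE : ∀ j, E j ↔ i ≠ j ∧ P j)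
    (f : α → ℤ) (hf1 : ∀ j, E j → f j = 1) (hf0 : ∀ j, ¬ E j → f j = 0) :
    (T.ncard : ℤ) = ∑ j, f j + 1 := by
  classical
  have h1 : T = ((insert i (Finset.univ.filter E)).image c : Finset (α ⊕ α)) := by
    ext w
    simp only [hT, Finset.coe_image, Finset.coe_insert, Finset.coe_filter, Finset.mem_univ,
      true_and, Set.mem_image, Set.mem_insert_iff, Set.mem_ofPred_eq]
    constructor
    · rintro ⟨j, hj, rfl⟩
      by_cases h : j = i
      · exact ⟨j, Or.inl h, rfl⟩
      · exact ⟨j, Or.inr ((hE j).2 ⟨fun h' => h h'.symm, hj⟩), rfl⟩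
    · rintro ⟨j, hj | hj, rfl⟩
      · exact ⟨j, hj ▸ hi, rfl⟩
      · exact ⟨j, ((hE j).1 hj).2, rfl⟩
  rw [h1, Set.ncard_coe_finset, Finset.card_image_of_injective _ hcinj, Finset.card_insert_of_notMem]
  · have : ∑ j, f j = (Finset.univ.filter E).card := by
      rw [Finset.card_filter]
      push_cast
      apply Finset.sum_congr rfl
      intro j _
      by_cases h : E j
      · simp [hf1 j h, h]
      · simp [hf0 j h, h]
    rw [this]; push_cast; ring
  · simp [hE]

theorem finRotate_mod_aux (q : ℕ) (hq : 2 ≤ q) (j : ℕ) (h : j % q < q) (h' : (j + 1) % q < q) :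
    finRotate q ⟨j % q, h⟩ = ⟨(j + 1) % q, h'⟩ := by
  obtain ⟨q, rfl⟩ : ∃ r, q = r + 1 := ⟨q - 1, by omega⟩
  rw [finRotate_succ_apply]
  apply Fin.ext
  rw [Fin.val_add]
  simp [Nat.add_mod]

/-- **Theorem 2 (bipartite form of Theorem 1).**  `G = G(X,Y)` is a balanced bipartite
graph on parts `X = {Sum.inl i}` and `Y = {Sum.inr i}` (`i : Fin n`) containing the
perfect matching `M = {xᵢyᵢ : i}`; `S` is the index set of `M₀ ⊆ M`.  If every
endpoint of an edge of `M₀` has degree at least `(3n+1)/4`, then for every partition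
`|M₀| = n₁ + ⋯ + n_k` with each `nᵢ ≥ 2`, `G` contains `k` pairwise vertex-disjoint
`M`-alternating cycles `C₁, …, C_k` with exactly `nᵢ` edges of `M₀` on `Cᵢ`. -/
theorem stmt3 (n : ℕ) (G : SimpleGraph (Fin n ⊕ Fin n))
    (hX : ∀ i j : Fin n, ¬ G.Adj (Sum.inl i) (Sum.inl j))
    (hY : ∀ i j : Fin n, ¬ G.Adj (Sum.inr i) (Sum.inr j))
    (hM : ∀ i : Fin n, G.Adj (Sum.inl i) (Sum.inr i))
    (S : Finset (Fin n))
    (hdeg : ∀ i ∈ S,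
      (3 * (n : ℚ) + 1) / 4 ≤ ((G.neighborSet (Sum.inl i)).ncard : ℚ) ∧
      (3 * (n : ℚ) + 1) / 4 ≤ ((G.neighborSet (Sum.inr i)).ncard : ℚ))
    (k : ℕ) (hk : 1 ≤ k) (m : Fin k → ℕ) (hm : ∀ i, 2 ≤ m i)
    (hsum : ∑ i, m i = S.card) :
    ∃ c : Fin k → List (Fin n),
      (∀ i, AltCycle G (c i)) ∧
      (∀ i j, i ≠ j → ∀ a ∈ c i, a ∉ c j) ∧
      (∀ i, ((c i).toFinset ∩ S).card = m i) := by
  classical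
  obtain ⟨E, hEdef⟩ : ∃ E : Fin n → Fin n → Prop,
    ∀ i j, E i j ↔ i ≠ j ∧ G.Adj (Sum.inr i) (Sum.inl j) := ⟨_, fun _ _ => Iff.rfl⟩
  have hE : ∀ x, ¬ E x x := by intro x; simp [hEdef]
  have hD : Deg E S := by
    intro i hi
    obtain ⟨d1, d2⟩ := hdeg i hi
    have e2 : ((G.neighborSet (Sum.inr i)).ncard : ℤ) = ∑ j, ar E i j + 1 := by
      apply deg_sum (fun j => G.Adj (Sum.inr i) (Sum.inl j)) _ i (hM i).symm Sum.inl
        Sum.inl_injective _ (fun j => E i j) (fun j => hEdef i j) _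
        (fun j h => ar_one E h) (fun j h => ar_zero E h)
      intro w
      rw [SimpleGraph.mem_neighborSet]
      rcases w with w | w
      · simp
      · simp [hY]
    have e1 : ((G.neighborSet (Sum.inl i)).ncard : ℤ) = ∑ j, ar E j i + 1 := by
      apply deg_sum (fun j => G.Adj (Sum.inr j) (Sum.inl i)) _ i (hM i).symm Sum.inr
        Sum.inr_injective _ (fun j => E j i) (fun j => by rw [hEdef, ne_comm]) _
        (fun j h => ar_one E h) (fun j h => ar_zero E h)
      intro w
      rw [SimpleGraph.mem_neighborSet]
      rcases w with w | w
      · simp [hX]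
      · simp [G.adj_comm]
    have f1 : (3 * (n : ℤ) + 1) ≤ 4 * ((G.neighborSet (Sum.inl i)).ncard : ℤ) := by
      have : (3 * (n : ℚ) + 1) ≤ 4 * ((G.neighborSet (Sum.inl i)).ncard : ℚ) := by linarith
      exact_mod_cast this
    have f2 : (3 * (n : ℤ) + 1) ≤ 4 * ((G.neighborSet (Sum.inr i)).ncard : ℤ) := by
      have : (3 * (n : ℚ) + 1) ≤ 4 * ((G.neighborSet (Sum.inr i)).ncard : ℚ) := by linarith
      exact_mod_cast this
    rw [e1] at f1
    rw [e2] at f2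
    rw [Fintype.card_fin]
    constructor <;> linarith
  -- index type
  let I := Σ i : Fin k, Fin (m i)
  let s : Equiv.Perm I := Equiv.sigmaCongrRight (fun i => finRotate (m i))
  let P : Fin k → ℕ → I := fun i j => ⟨i, ⟨j % m i, Nat.mod_lt _ (by have := hm i; omega)⟩⟩
  have hsP : ∀ i j, s (P i j) = P i (j + 1) := by
    intro i j
    exact congrArg (Sigma.mk i) (finRotate_mod_aux (m i) (hm i) j _ _)
  have hP : ∀ p : I, P p.1 p.2.1 = p := by
    rintro ⟨i, a⟩
    simp only [P]
    congr 1
    ext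
    exact Nat.mod_eq_of_lt a.2
  have hPinj : ∀ i j j', j < m i → j' < m i → P i j = P i j' → j = j' := by
    intro i j j' h h' he
    replace he := congrArg (fun p : Σ i : Fin k, Fin (m i) => p.2.1) he
    simp only [P] at he
    rwa [Nat.mod_eq_of_lt h, Nat.mod_eq_of_lt h'] at he
  have hsne : ∀ p, s p ≠ p := by
    intro p hp
    rw [← hP p, hsP] at hp
    replace hp := congrArg (fun p : Σ i : Fin k, Fin (m i) => p.2.1) hp
    simp only [P] at hp
    have h1 := hm p.1
    have h2 := p.2.2
    rw [Nat.mod_eq_of_lt h2] at hp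
    by_cases h : p.2.1 + 1 < m p.1
    · rw [Nat.mod_eq_of_lt h] at hp; omega
    · have : p.2.1 + 1 = m p.1 := by omega
      rw [this, Nat.mod_self] at hp; omega
  have hcard : Fintype.card I = Fintype.card {x // x ∈ S} := by
    simp [I, hsum]
  let e : I ≃ {x // x ∈ S} := Fintype.equivOfCardEq hcard
  let σ₀ : Equiv.Perm (Fin n) := Equiv.Perm.ofSubtype (e.permCongr s)
  have hσ₀ : ∀ p, σ₀ (e p).1 = (e (s p)).1 := by
    intro p
    simp [σ₀]
  have hS₀ : ∀ x, σ₀ x ≠ x ↔ x ∈ S := by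
    intro x
    constructor
    · intro h
      by_contra hx
      exact h (Equiv.Perm.ofSubtype_apply_of_not_mem _ hx)
    · intro hx h
      have : x = (e (e.symm ⟨x, hx⟩)).1 := by simp
      rw [this, hσ₀] at h
      exact hsne _ (e.injective (Subtype.ext h))
  obtain ⟨σ, hconj, hS, g, hg, hginj⟩ := main_hall E hE hD σ₀ hS₀
  obtain ⟨c, hc⟩ := isConj_iff.1 hconj
  obtain ⟨f, hf⟩ : ∃ f : I → Fin n, ∀ p, f p = c (e p).1 := ⟨_, fun _ => rfl⟩
  have hfσ : ∀ p, σ (f p) = f (s p) := by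
    intro p
    rw [← hc, hf, hf, ← hσ₀]
    simp
  have hfinj : Function.Injective f := by
    intro p q h
    rw [hf, hf] at h
    exact e.injective (Subtype.ext (c.injective h))
  have hfS : ∀ p, f p ∈ S := by
    intro p
    rw [← hS, hfσ]
    exact fun h => hsne p (hfinj h)
  have hgs : ∀ p, ¬ E (f p) (f (s p)) → g (f p) ∉ S ∧ E (f p) (g (f p)) ∧ E (g (f p)) (f (s p)) := by
    intro p h
    rw [← hfσ] at h ⊢
    exact hg _ (hfS p) h
  have hgi : ∀ p q, ¬ E (f p) (f (s p)) → ¬ E (f q) (f (s q)) → g (f p) = g (f q) → p = q := by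
    intro p q h h' he
    rw [← hfσ] at h h'
    exact hfinj (hginj _ (hfS p) _ (hfS q) h h' he)
  obtain ⟨t, ht⟩ : ∃ t : I → List (Fin n), ∀ p, t p = if E (f p) (f (s p)) then [] else [g (f p)] :=
    ⟨_, fun _ => rfl⟩
  have hmemt : ∀ p x, x ∈ t p ↔ ¬ E (f p) (f (s p)) ∧ x = g (f p) := by
    intro p x
    rw [ht]; split_ifs with h <;> simp [h]
  have htS : ∀ p, ∀ x ∈ t p, x ∉ S := by
    intro p x hx
    rw [hmemt] at hx
    rw [hx.2]; exact (hgs p hx.1).1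
  have hdisj : ∀ p q x, x ∈ f p :: t p → x ∈ f q :: t q → p = q := by
    intro p q x h1 h2
    rw [List.mem_cons] at h1 h2
    rcases h1 with h1 | h1 <;> rcases h2 with h2 | h2
    · exact hfinj (h1.symm.trans h2)
    · exact absurd (h1 ▸ hfS p) (htS q x h2)
    · exact absurd (h2 ▸ hfS q) (htS p x h1)
    · rw [hmemt] at h1 h2
      exact hgi p q h1.1 h2.1 (h1.2.symm.trans h2.2)
  have hmemc : ∀ i x, x ∈ (List.range (m i)).flatMap (fun j => f (P i j) :: t (P i j)) ↔
      ∃ j < m i, x ∈ f (P i j) :: t (P i j) := by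
    intro i x; simp only [List.mem_flatMap, List.mem_range]
  refine ⟨fun i => (List.range (m i)).flatMap (fun j => f (P i j) :: t (P i j)), ?_, ?_, ?_⟩
  · intro i
    have hmi := hm i
    apply altCycle_of_chain G _ (f (P i 0))
    · rw [List.length_flatMap]
      calc 2 ≤ m i := hmi
        _ = ((List.range (m i)).map (fun _ => 1)).sum := by simp
        _ ≤ _ := by
          apply List.sum_le_sum
          intro j _; simp
    · rw [List.nodup_flatMap]
      constructor
      · intro j _
        rw [List.nodup_cons]
        refine ⟨fun h => htS _ _ h (hfS _), ?_⟩
        rw [ht]; split_ifs <;> simp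
      · apply List.Nodup.pairwise_of_forall_ne List.nodup_range
        intro j hj j' hj' hne
        rw [List.mem_range] at hj hj'
        intro x h1 h2
        exact hne (hPinj i j j' hj hj' (hdisj _ _ x h1 h2))
    · obtain ⟨q, hq⟩ : ∃ q, m i = q + 1 := ⟨m i - 1, by omega⟩
      intro h
      simp [hq, List.range_succ_eq_map]
    · have hPm : P i (m i) = P i 0 := by simp [P]
      have := chain_flat (fun a b => G.Adj (Sum.inr a) (Sum.inl b)) (fun j => f (P i j))
        (fun j => t (P i j)) ?_ (m i)
      · simpa [hPm] using this
      · intro j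
        rw [← hsP, ht]
        split_ifs with h
        · simpa using ((hEdef _ _).1 h).2
        · obtain ⟨_, h1, h2⟩ := hgs _ h
          simpa using ⟨((hEdef _ _).1 h1).2, ((hEdef _ _).1 h2).2⟩
  · intro i i' hne a h1 h2
    obtain ⟨j, _, h1⟩ := (hmemc i a).1 h1
    obtain ⟨j', _, h2⟩ := (hmemc i' a).1 h2
    exact hne (congrArg Sigma.fst (hdisj _ _ a h1 h2))
  · intro i
    have : ((List.range (m i)).flatMap (fun j => f (P i j) :: t (P i j))).toFinset ∩ S =
        (Finset.range (m i)).image (fun j => f (P i j)) := by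
      ext x
      rw [Finset.mem_inter, List.mem_toFinset, hmemc, Finset.mem_image]
      constructor
      · rintro ⟨⟨j, hj, hx⟩, hxS⟩
        refine ⟨j, Finset.mem_range.2 hj, ?_⟩
        rcases List.mem_cons.1 hx with h | h
        · exact h.symm
        · exact absurd hxS (htS _ _ h)
      · rintro ⟨j, hj, rfl⟩
        exact ⟨⟨j, Finset.mem_range.1 hj, by simp⟩, hfS _⟩
    try dsimp only
    rw [this, Finset.card_image_of_injOn, Finset.card_range]
    intro j hj j' hj' h
    rw [Finset.mem_coe, Finset.mem_range] at hj hj'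
    exact hPinj i j j' hj hj' (hfinj h)
end

section
/- Let s and t be integers with t ≥ s ≥ 2 and t ≥ 3, and suppose that no edge of G joins two distinct edges of M_1 (i.e., for any two distinct f, f′ ∈ M_1, there is no edge of G between an endpoint of f and an endpoint of f′). Let C_1 and C_2 be two vertex-disjoint feasible cycles of G(X,Y) with l_{M_0}(C_1) = s, l_{M_0}(C_2) = t, and Σ_{f ∈ M_0(C_2)} e(f, C_1) > (3/4)·t·l(C_1). Then the subgraph induced by V(C_1) ∪ V(C_2) contains two vertex-disjoint feasible cycles C′ and C″ such that l(C′) + l(C″) < l(C_1) + l(C_2). -/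
/-- Successor permutation along an alternating cycle. -/
theorem exists_next {n : ℕ} (G : SimpleGraph (Fin n ⊕ Fin n)) (l : List (Fin n))
    (h : AltCycle G l) :
    ∃ nx : Equiv.Perm (Fin n), (∀ a ∈ l, nx a ∈ l) ∧ (∀ a ∈ l, nx a ≠ a) ∧
      (∀ a ∈ l, G.Adj (Sum.inr a) (Sum.inl (nx a))) ∧
      (∀ P : Fin n → Prop, (∃ a ∈ l, P a) → (∀ a ∈ l, P a → P (nx a)) → ∀ a ∈ l, P a) := by
  obtain ⟨h2, hnd, hadj⟩ := h
  have hmem : ∀ a ∈ l, l.formPerm a ∈ l := fun a ha => List.formPerm_apply_mem_of_mem ha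
  have hcyc := hnd.isCycleOn_formPerm
  refine ⟨l.formPerm, hmem, ?_, ?_, ?_⟩
  · intro a ha
    exact (List.formPerm_apply_mem_ne_self_iff l hnd a ha).2 h2
  · intro a ha
    obtain ⟨i, hi, rfl⟩ := List.getElem_of_mem ha
    rw [List.formPerm_apply_getElem _ hnd]
    exact hadj ⟨i, hi⟩
  · rintro P ⟨a, ha, hPa⟩ hstep b hb
    have hc : l.formPerm.IsCycleOn (l.toFinset : Set (Fin n)) := by
      convert hcyc using 1
      ext x; simp
    obtain ⟨m, -, rfl⟩ := hc.exists_pow_eq (List.mem_toFinset.2 ha) (List.mem_toFinset.2 hb)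
    have key : ∀ m : ℕ, (l.formPerm ^ m) a ∈ l ∧ P ((l.formPerm ^ m) a) := by
      intro m
      induction m with
      | zero => exact ⟨ha, hPa⟩
      | succ m ih =>
        rw [pow_succ', Equiv.Perm.mul_apply]
        exact ⟨hmem _ ih.1, hstep _ ih.1 ih.2⟩
    exact (key m).2

open Classical in
/-- Number of edges between the matching edges with indices `f` and `j` (`f ≠ j`). -/
noncomputable def wt {n : ℕ} (G : SimpleGraph (Fin n ⊕ Fin n)) (f j : Fin n) : ℕ :=
  (if G.Adj (Sum.inl f) (Sum.inr j) then 1 else 0) +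
  (if G.Adj (Sum.inr f) (Sum.inl j) then 1 else 0)

theorem ind_add_le (A B : Prop) [Decidable A] [Decidable B] [Decidable (A ∧ B)] :
    (if A then 1 else 0) + (if B then 1 else 0) ≤ 1 + (if A ∧ B then 1 else 0) := by
  by_cases hA : A <;> by_cases hB : B <;> simp [hA, hB]

theorem wt_le_two {n : ℕ} (G : SimpleGraph (Fin n ⊕ Fin n)) (f j : Fin n) : wt G f j ≤ 2 := by
  unfold wt
  split_ifs <;> simp

theorem wt_lt_two {n : ℕ} (G : SimpleGraph (Fin n ⊕ Fin n)) (f j : Fin n)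
    (h : ¬ (G.Adj (Sum.inl f) (Sum.inr j) ∧ G.Adj (Sum.inr f) (Sum.inl j))) :
    wt G f j < 2 := by
  unfold wt
  split_ifs with h1 h2
  · exact absurd ⟨h1, h2⟩ h
  all_goals simp

theorem eBtw_le {n : ℕ} (G : SimpleGraph (Fin n ⊕ Fin n))
    (hX : ∀ i j : Fin n, ¬ G.Adj (Sum.inl i) (Sum.inl j))
    (hY : ∀ i j : Fin n, ¬ G.Adj (Sum.inr i) (Sum.inr j)) (f : Fin n) (l : List (Fin n)) :
    eBtw G ({Sum.inl f, Sum.inr f} : Set (Fin n ⊕ Fin n)) (iVerts {j | j ∈ l})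
      ≤ ∑ j ∈ l.toFinset, wt G f j := by
  classical
  unfold eBtw wt
  rw [Finset.sum_add_distrib, ← Finset.card_filter, ← Finset.card_filter]
  set A := l.toFinset.filter (fun j => G.Adj (Sum.inl f) (Sum.inr j))
  set B := l.toFinset.filter (fun j => G.Adj (Sum.inr f) (Sum.inl j))
  have hsub : {e : Sym2 (Fin n ⊕ Fin n) | e ∈ G.edgeSet ∧ ∃ a b, e = s(a, b) ∧
      a ∈ ({Sum.inl f, Sum.inr f} : Set (Fin n ⊕ Fin n)) ∧ b ∈ iVerts {j | j ∈ l}} ⊆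
      ((A.image (fun j => s(Sum.inl f, Sum.inr j)) ∪
        B.image (fun j => s(Sum.inr f, Sum.inl j)) : Finset (Sym2 (Fin n ⊕ Fin n))) :
        Set (Sym2 (Fin n ⊕ Fin n))) := by
    rintro e ⟨he, a, b, rfl, ha, j, hj, hb⟩
    rw [SimpleGraph.mem_edgeSet] at he
    simp only [Set.mem_insert_iff, Set.mem_singleton_iff] at ha
    change j ∈ l at hj
    rw [Finset.mem_coe, Finset.mem_union, Finset.mem_image, Finset.mem_image]
    rcases ha with rfl | rfl <;> rcases hb with rfl | rfl
    · exact absurd he (hX _ _)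
    · exact Or.inl ⟨j, by simp [A, hj, he], rfl⟩
    · exact Or.inr ⟨j, by simp [B, hj, he], rfl⟩
    · exact absurd he (hY _ _)
  calc _ ≤ _ := Set.ncard_le_ncard hsub (Finset.finite_toSet _)
    _ = _ := Set.ncard_coe_finset _
    _ ≤ _ := Finset.card_union_le _ _
    _ ≤ _ := Nat.add_le_add Finset.card_image_le Finset.card_image_le

theorem altCycle_two {n : ℕ} (G : SimpleGraph (Fin n ⊕ Fin n)) (a b : Fin n) (hab : a ≠ b)
    (h1 : G.Adj (Sum.inr a) (Sum.inl b)) (h2 : G.Adj (Sum.inr b) (Sum.inl a)) :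
    AltCycle G [a, b] := by
  refine ⟨by simp, by simp [hab], fun i => ?_⟩
  match i with
  | ⟨0, _⟩ => exact h1
  | ⟨1, _⟩ => simpa using h2

theorem altCycle_three {n : ℕ} (G : SimpleGraph (Fin n ⊕ Fin n)) (a b c : Fin n)
    (hab : a ≠ b) (hac : a ≠ c) (hbc : b ≠ c)
    (h1 : G.Adj (Sum.inr a) (Sum.inl b)) (h2 : G.Adj (Sum.inr b) (Sum.inl c))
    (h3 : G.Adj (Sum.inr c) (Sum.inl a)) :
    AltCycle G [a, b, c] := by
  refine ⟨by simp, by simp [hab, hac, hbc], fun i => ?_⟩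
  match i with
  | ⟨0, _⟩ => exact h1
  | ⟨1, _⟩ => exact h2
  | ⟨2, _⟩ => simpa using h3

theorem altCycle_four {n : ℕ} (G : SimpleGraph (Fin n ⊕ Fin n)) (a b c d : Fin n)
    (hnd : [a, b, c, d].Nodup)
    (h1 : G.Adj (Sum.inr a) (Sum.inl b)) (h2 : G.Adj (Sum.inr b) (Sum.inl c))
    (h3 : G.Adj (Sum.inr c) (Sum.inl d)) (h4 : G.Adj (Sum.inr d) (Sum.inl a)) :
    AltCycle G [a, b, c, d] := by
  refine ⟨by simp, hnd, fun i => ?_⟩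
  match i with
  | ⟨0, _⟩ => exact h1
  | ⟨1, _⟩ => exact h2
  | ⟨2, _⟩ => exact h3
  | ⟨3, _⟩ => simpa using h4

theorem two_le_inter {n : ℕ} (S : Finset (Fin n)) (l : List (Fin n)) (a b : Fin n)
    (hab : a ≠ b) (ha : a ∈ l) (hb : b ∈ l) (haS : a ∈ S) (hbS : b ∈ S) :
    2 ≤ (l.toFinset ∩ S).card := by
  rw [← Finset.card_pair hab]
  apply Finset.card_le_card
  intro x hx
  simp only [Finset.mem_insert, Finset.mem_singleton] at hx
  rcases hx with rfl | rfl <;> simp [*]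

set_option maxHeartbeats 2000000 in
/-- **Lemma 2.** Suppose no edge of `G` joins two distinct edges of `M₁ = M ∖ M₀`
(hypothesis `hM1`).  Let `t ≥ s ≥ 2`, `t ≥ 3`, and let `C₁, C₂` (index lists
`l₁, l₂`) be disjoint feasible cycles with `l_{M₀}(C₁) = s`, `l_{M₀}(C₂) = t` and
`Σ_{f ∈ M₀(C₂)} e(f, C₁) > (3/4)·t·l(C₁)` (a cycle with index list `l` has
`l(C) = 2 * l.length` edges).  Then `[V(C₁ ∪ C₂)]` contains two disjoint feasible
cycles `C′`, `C″` with `l(C′) + l(C″) < l(C₁) + l(C₂)`. -/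
theorem stmt5 (n : ℕ) (G : SimpleGraph (Fin n ⊕ Fin n))
    (hX : ∀ i j : Fin n, ¬ G.Adj (Sum.inl i) (Sum.inl j))
    (hY : ∀ i j : Fin n, ¬ G.Adj (Sum.inr i) (Sum.inr j))
    (hM : ∀ i : Fin n, G.Adj (Sum.inl i) (Sum.inr i))
    (S : Finset (Fin n))
    (hM1 : ∀ a b : Fin n, a ∉ S → b ∉ S → a ≠ b → ¬ G.Adj (Sum.inl a) (Sum.inr b))
    (s t : ℕ) (hs : 2 ≤ s) (hst : s ≤ t) (ht : 3 ≤ t)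
    (l₁ l₂ : List (Fin n)) (hC1 : AltCycle G l₁) (hC2 : AltCycle G l₂)
    (hdisj : ∀ a ∈ l₁, a ∉ l₂)
    (hs1 : (l₁.toFinset ∩ S).card = s) (ht2 : (l₂.toFinset ∩ S).card = t)
    (hsum : (3 / 4 : ℚ) * t * (2 * l₁.length) <
      ∑ i ∈ l₂.toFinset ∩ S,
        (eBtw G ({Sum.inl i, Sum.inr i} : Set (Fin n ⊕ Fin n)) (iVerts {j | j ∈ l₁}) : ℚ)) :
    ∃ l' l'' : List (Fin n),
      AltCycle G l' ∧ AltCycle G l'' ∧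
      2 ≤ (l'.toFinset ∩ S).card ∧ 2 ≤ (l''.toFinset ∩ S).card ∧
      (∀ a ∈ l', a ∉ l'') ∧
      (∀ a ∈ l', a ∈ l₁ ∨ a ∈ l₂) ∧ (∀ a ∈ l'', a ∈ l₁ ∨ a ∈ l₂) ∧
      2 * l'.length + 2 * l''.length < 2 * l₁.length + 2 * l₂.length := by
  classical
  have hnd1 := hC1.2.1
  have hnd2 := hC2.2.1
  obtain ⟨n1, n1mem, n1ne, n1adj, -⟩ := exists_next G l₁ hC1
  obtain ⟨n2, n2mem, n2ne, n2adj, n2ind⟩ := exists_next G l₂ hC2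
  set F := l₂.toFinset ∩ S with hF
  set Gs := l₁.toFinset ∩ S with hGs
  set H := l₁.toFinset \ S with hH
  have memF : ∀ {a}, a ∈ F ↔ a ∈ l₂ ∧ a ∈ S := by intro a; simp [hF]
  have memG : ∀ {a}, a ∈ Gs ↔ a ∈ l₁ ∧ a ∈ S := by intro a; simp [hGs]
  have memH : ∀ {a}, a ∈ H ↔ a ∈ l₁ ∧ a ∉ S := by intro a; simp [hH]
  have hk1 : H.card + s = l₁.length := by
    rw [← hs1, ← List.toFinset_card_of_nodup hnd1]
    exact Finset.card_sdiff_add_card_inter _ _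
  set q := H.card with hq
  have hk2 : t ≤ l₂.length := by
    rw [← ht2, ← List.toFinset_card_of_nodup hnd2]
    exact Finset.card_le_card Finset.inter_subset_left
  have hqs : q ≤ s := by
    rw [hq, ← hs1]
    apply Finset.card_le_card_of_injOn n1 _ n1.injective.injOn
    intro a ha
    have ha' := memH.1 (Finset.mem_coe.1 ha)
    refine Finset.mem_coe.2 (memG.2 ⟨n1mem a ha'.1, ?_⟩)
    by_contra hc
    exact hM1 (n1 a) a hc ha'.2 (n1ne a ha'.1) (n1adj a ha'.1).symm
  -- the successor within `F`
  set σ : Fin n → Fin n := fun a => if n2 a ∈ S then n2 a else n2 (n2 a) with hσ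
  have n2S : ∀ a ∈ l₂, n2 a ∉ S → n2 (n2 a) ∈ S := by
    intro a ha hn
    by_contra hc
    exact hM1 _ _ hc hn (n2ne _ (n2mem a ha)) (n2adj _ (n2mem a ha)).symm
  have σmem : ∀ a ∈ F, σ a ∈ F := by
    intro a ha
    rw [memF] at ha ⊢
    simp only [hσ]
    split_ifs with h
    · exact ⟨n2mem _ ha.1, h⟩
    · exact ⟨n2mem _ (n2mem _ ha.1), n2S a ha.1 h⟩
  have σinj : Set.InjOn σ F := by
    intro a ha b hb hab
    have ha := memF.1 (Finset.mem_coe.1 ha)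
    have hb := memF.1 (Finset.mem_coe.1 hb)
    simp only [hσ] at hab
    split_ifs at hab with h1 h2 h2
    · exact n2.injective hab
    · exact absurd ha.2 (by rw [n2.injective hab]; exact h2)
    · exact absurd hb.2 (by rw [← n2.injective hab]; exact h1)
    · exact n2.injective (n2.injective hab)
  have σσ : ∀ a ∈ F, σ (σ a) ≠ a := by
    intro a ha hcon
    have hall := n2ind (fun x => x = a ∨ x = σ a ∨ (x ∉ S ∧ (x = n2 a ∨ x = n2 (σ a))))
      ⟨a, (memF.1 ha).1, Or.inl rfl⟩ (by
        rintro x hx (rfl | rfl | ⟨hxS, rfl | rfl⟩)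
        · by_cases h : n2 x ∈ S
          · right; left; simp [hσ, h]
          · right; right; exact ⟨h, Or.inl rfl⟩
        · by_cases h : n2 (σ a) ∈ S
          · left
            nth_rw 2 [← hcon]
            generalize σ a = b at h ⊢
            simp [hσ, h]
          · right; right; exact ⟨h, Or.inr rfl⟩
        · right; left; simp [hσ, hxS]
        · left
          nth_rw 2 [← hcon]
          generalize σ a = b at hxS ⊢
          simp [hσ, hxS])
    have hsub : F ⊆ {a, σ a} := by
      intro x hx
      have hx' := memF.1 hx
      rcases hall x hx'.1 with h | h | h
      · simp [h]
      · simp [h]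
      · exact absurd hx'.2 h.1
    have := Finset.card_le_card hsub
    have := Finset.card_le_two (a := a) (b := σ a)
    omega
  have σne : ∀ a ∈ F, σ a ≠ a := by
    intro a ha h
    exact σσ a ha (by rw [h, h])
  have hne12 : ∀ a ∈ l₁, ∀ b ∈ l₂, a ≠ b := by
    rintro a ha b hb rfl; exact hdisj a ha hb
  -- 2-cycles
  set two : Fin n → Fin n → Prop := fun f g =>
    G.Adj (Sum.inl f) (Sum.inr g) ∧ G.Adj (Sum.inr f) (Sum.inl g) with htwo
  -- final construction
  have final : ∀ f ∈ F, ∀ c ∈ F, c ≠ f → c ≠ σ f → ∀ g ∈ Gs, two c g → ∀ h ∈ H,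
      G.Adj (Sum.inl f) (Sum.inr h) → G.Adj (Sum.inr (σ f)) (Sum.inl h) →
      ∃ l' l'' : List (Fin n),
      AltCycle G l' ∧ AltCycle G l'' ∧
      2 ≤ (l'.toFinset ∩ S).card ∧ 2 ≤ (l''.toFinset ∩ S).card ∧
      (∀ a ∈ l', a ∉ l'') ∧
      (∀ a ∈ l', a ∈ l₁ ∨ a ∈ l₂) ∧ (∀ a ∈ l'', a ∈ l₁ ∨ a ∈ l₂) ∧
      2 * l'.length + 2 * l''.length < 2 * l₁.length + 2 * l₂.length := by
    intro f hf c hc hcf hcσ g hg hcg h hh hhf hσh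
    have hq1 : 0 < q := Finset.card_pos.2 ⟨h, hh⟩
    have hf' := memF.1 hf
    have hσf' := memF.1 (σmem f hf)
    have hc' := memF.1 hc
    have hg' := memG.1 hg
    have hh' := memH.1 hh
    have e1 := hne12 g hg'.1 c hc'.1
    have e2 := hne12 g hg'.1 f hf'.1
    have e3 := hne12 g hg'.1 _ hσf'.1
    have e4 := hne12 h hh'.1 c hc'.1
    have e5 := hne12 h hh'.1 f hf'.1
    have e6 := hne12 h hh'.1 _ hσf'.1
    have e7 : g ≠ h := by rintro rfl; exact hh'.2 hg'.2
    have e8 := σne f hf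
    have cyc2 := altCycle_two G c g e1.symm hcg.2 hcg.1.symm
    have c2S := two_le_inter S [c, g] c g e1.symm (by simp) (by simp) hc'.2 hg'.2
    by_cases hS : n2 f ∈ S
    · have hσf : σ f = n2 f := by simp [hσ, hS]
      refine ⟨[c, g], [f, σ f, h], cyc2, altCycle_three G f (σ f) h e8.symm e5.symm e6.symm
        (hσf ▸ n2adj f hf'.1) hσh hhf.symm, c2S,
        two_le_inter S _ f (σ f) e8.symm (by simp) (by simp) hf'.2 hσf'.2, ?_, ?_, ?_, ?_⟩
      · simp [hcf, hcσ, e4.symm, e2, e3, e7]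
      · simp [hc'.1, hg'.1]
      · simp [hf'.1, hσf'.1, hh'.1]
      · simp only [List.length_cons, List.length_nil]; omega
    · have hσf : σ f = n2 (n2 f) := by simp [hσ, hS]
      have hm := n2mem f hf'.1
      have m1 : n2 f ≠ f := n2ne f hf'.1
      have m2 : n2 f ≠ σ f := by intro h0; exact hS (h0 ▸ hσf'.2)
      have m3 : n2 f ≠ c := by intro h0; exact hS (h0 ▸ hc'.2)
      have m4 := hne12 h hh'.1 _ hm
      have m5 := hne12 g hg'.1 _ hm
      have hlen : t + 1 ≤ l₂.length := by
        rw [← ht2, ← List.toFinset_card_of_nodup hnd2,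
          ← Finset.card_insert_of_notMem (a := n2 f) (s := F) (fun h0 => hS (memF.1 h0).2)]
        apply Finset.card_le_card
        intro x hx
        rcases Finset.mem_insert.1 hx with rfl | hx
        · simpa using hm
        · simpa using (memF.1 hx).1
      refine ⟨[c, g], [f, n2 f, σ f, h], cyc2, altCycle_four G f (n2 f) (σ f) h
        (by simp [e8.symm, e5.symm, e6.symm, m1.symm, m2, m4.symm])
        (n2adj f hf'.1) (hσf ▸ n2adj _ hm) hσh hhf.symm, c2S,
        two_le_inter S _ f (σ f) e8.symm (by simp) (by simp) hf'.2 hσf'.2, ?_, ?_, ?_, ?_⟩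
      · simp [hcf, hcσ, e4.symm, e2, e3, e7, m3.symm, m5]
      · simp [hc'.1, hg'.1]
      · simp [hf'.1, hσf'.1, hh'.1, hm]
      · simp only [List.length_cons, List.length_nil]; omega
  have final2 : ∀ c ∈ F, ∀ d ∈ F, c ≠ d → ∀ g ∈ Gs, ∀ g' ∈ Gs, g ≠ g' → two c g → two d g' →
      ∃ l' l'' : List (Fin n),
      AltCycle G l' ∧ AltCycle G l'' ∧
      2 ≤ (l'.toFinset ∩ S).card ∧ 2 ≤ (l''.toFinset ∩ S).card ∧
      (∀ a ∈ l', a ∉ l'') ∧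
      (∀ a ∈ l', a ∈ l₁ ∨ a ∈ l₂) ∧ (∀ a ∈ l'', a ∈ l₁ ∨ a ∈ l₂) ∧
      2 * l'.length + 2 * l''.length < 2 * l₁.length + 2 * l₂.length := by
    intro c hc d hd hcd g hg g' hg' hgg h1 h2
    have hc := memF.1 hc
    have hd := memF.1 hd
    have hg := memG.1 hg
    have hg' := memG.1 hg'
    have e1 := hne12 g hg.1 c hc.1
    have e2 := hne12 g' hg'.1 d hd.1
    have e3 := hne12 g hg.1 d hd.1
    have e4 := hne12 g' hg'.1 c hc.1
    refine ⟨[c, g], [d, g'], altCycle_two G c g e1.symm h1.2 h1.1.symm,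
      altCycle_two G d g' e2.symm h2.2 h2.1.symm,
      two_le_inter S _ c g e1.symm (by simp) (by simp) hc.2 hg.2,
      two_le_inter S _ d g' e2.symm (by simp) (by simp) hd.2 hg'.2, ?_, ?_, ?_, ?_⟩
    · simp [hcd, e4.symm, e3, hgg]
    · simp [hc.1, hg.1]
    · simp [hd.1, hg'.1]
    · simp only [List.length_cons, List.length_nil]; omega
  -- counting
  set P := (F ×ˢ Gs).filter (fun p => two p.1 p.2) with hP
  set W : Fin n → ℕ := fun h => ∑ f ∈ F, wt G f h with hW
  have hsum2 : 3 * t * (s + q) < 2 * (∑ f ∈ F, ∑ j ∈ l₁.toFinset, wt G f j) := by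
    have h1 : (∑ i ∈ F, (eBtw G ({Sum.inl i, Sum.inr i} : Set (Fin n ⊕ Fin n))
        (iVerts {j | j ∈ l₁}) : ℚ)) ≤ ((∑ f ∈ F, ∑ j ∈ l₁.toFinset, wt G f j : ℕ) : ℚ) := by
      rw [Nat.cast_sum]
      exact Finset.sum_le_sum (fun i _ => by exact_mod_cast eBtw_le G hX hY i l₁)
    have h2 := lt_of_lt_of_le hsum h1
    rw [← hk1] at h2
    have h3 : ((3 * t * (s + q) : ℕ) : ℚ) <
        ((2 * (∑ f ∈ F, ∑ j ∈ l₁.toFinset, wt G f j) : ℕ) : ℚ) := by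
      rw [Nat.cast_mul 2]
      push_cast at h2 ⊢
      linarith
    exact_mod_cast h3
  have hsplit : (∑ f ∈ F, ∑ j ∈ l₁.toFinset, wt G f j) =
      (∑ h ∈ H, W h) + ∑ p ∈ F ×ˢ Gs, wt G p.1 p.2 := by
    rw [Finset.sum_product, hW, Finset.sum_comm (s := H), ← Finset.sum_add_distrib]
    refine Finset.sum_congr rfl (fun f _ => ?_)
    rw [hGs, hH, add_comm, Finset.sum_inter_add_sum_sdiff]
  have hGsum : ∑ p ∈ F ×ˢ Gs, wt G p.1 p.2 ≤ t * s + P.card := by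
    have : t * s = ∑ p ∈ F ×ˢ Gs, 1 := by
      rw [Finset.sum_const, Finset.card_product, ht2, hs1]; simp
    rw [this, hP, Finset.card_filter, ← Finset.sum_add_distrib]
    refine Finset.sum_le_sum (fun p _ => ?_)
    exact ind_add_le _ _
  have hWle : ∀ h, W h ≤ 2 * t := by
    intro h
    simp only [hW]
    calc _ ≤ ∑ f ∈ F, 2 := Finset.sum_le_sum (fun f _ => wt_le_two G f h)
      _ = 2 * t := by rw [Finset.sum_const, ht2, smul_eq_mul, mul_comm]
  have hmain : 3 * t * (s + q) < 2 * (∑ h ∈ H, W h) + 2 * (t * s) + 2 * P.card := by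
    omega
  have hPne : P.Nonempty := by
    rw [Finset.nonempty_iff_ne_empty]
    intro h0
    have h1 : ∑ h ∈ H, W h ≤ q * (2 * t) := by
      simpa using Finset.sum_le_card_nsmul H W (2 * t) (fun h _ => hWle h)
    rw [h0, Finset.card_empty] at hmain
    nlinarith
  obtain ⟨⟨a, g⟩, hag⟩ := hPne
  have memP : ∀ {c g}, (c, g) ∈ P ↔ (c ∈ F ∧ g ∈ Gs) ∧ two c g := by
    intro c g; simp only [hP, Finset.mem_filter, Finset.mem_product]
  have hag' := memP.1 hag
  by_cases hstar : ∀ c d g g', (c, g) ∈ P → (d, g') ∈ P → c = d ∨ g = g'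
  swap
  · push Not at hstar
    obtain ⟨c, d, g1, g2, h1, h2, h3, h4⟩ := hstar
    have h1 := memP.1 h1
    have h2 := memP.1 h2
    exact final2 c h1.1.1 d h2.1.1 h3 g1 h1.1.2 g2 h2.1.2 h4 h1.2 h2.2
  by_cases hcase : ∀ b g', (b, g') ∈ P → b = a
  · have hPs : P.card ≤ s := by
      rw [← hs1]
      apply Finset.card_le_card_of_injOn Prod.snd
      · rintro ⟨c, g'⟩ h
        exact Finset.mem_coe.2 (memP.1 (Finset.mem_coe.1 h)).1.2
      · rintro ⟨c, g1⟩ h1 ⟨d, g2⟩ h2 h12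
        have k1 := hcase _ _ h1
        have k2 := hcase _ _ h2
        exact Prod.ext (k1.trans k2.symm) h12
    obtain ⟨h, hh, hWh⟩ : ∃ h ∈ H, 2 * t ≤ W h := by
      by_contra! hcon
      have h1 : ∑ h ∈ H, (W h + 1) ≤ q * (2 * t) := by
        simpa using Finset.sum_le_card_nsmul H (fun h => W h + 1) (2 * t) (fun h hh => hcon h hh)
      rw [Finset.sum_add_distrib, Finset.sum_const, smul_eq_mul, mul_one] at h1
      obtain ⟨r, rfl⟩ := Nat.exists_eq_add_of_le hqs
      obtain ⟨u, rfl⟩ := Nat.exists_eq_add_of_le ht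
      nlinarith
    have hfull : ∀ f ∈ F, G.Adj (Sum.inl f) (Sum.inr h) ∧ G.Adj (Sum.inr f) (Sum.inl h) := by
      intro f hf
      by_contra hcon
      have : W h < ∑ f ∈ F, 2 := by
        refine Finset.sum_lt_sum (fun f _ => wt_le_two G f h) ⟨f, hf, wt_lt_two G f h hcon⟩
      rw [Finset.sum_const, ht2, smul_eq_mul] at this
      omega
    obtain ⟨f, hf, hfa, hσfa⟩ : ∃ f ∈ F, a ≠ f ∧ a ≠ σ f := by
      refine ⟨σ a, σmem _ hag'.1.1, (σne a hag'.1.1).symm, (σσ a hag'.1.1).symm⟩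
    exact final f hf a hag'.1.1 hfa hσfa g hag'.1.2 hag'.2 h hh (hfull f hf).1
      (hfull _ (σmem f hf)).2
  · push Not at hcase
    obtain ⟨b, g', hb, hba⟩ := hcase
    have hgg : g' = g := (hstar _ _ _ _ hb hag).resolve_left hba
    subst hgg
    have hb' := memP.1 hb
    have hPt : P.card ≤ t := by
      rw [← ht2]
      apply Finset.card_le_card_of_injOn Prod.fst
      · rintro ⟨c, g1⟩ h
        exact Finset.mem_coe.2 (memP.1 (Finset.mem_coe.1 h)).1.1
      · have key : ∀ c g1, (c, g1) ∈ P → g1 = g' := by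
          intro c g1 h
          rcases hstar _ _ _ _ h hb with h1 | h1
          · rcases hstar _ _ _ _ h hag with h2 | h2
            · exact absurd (h1.symm.trans h2) hba
            · exact h2
          · exact h1
        rintro ⟨c, g1⟩ h1 ⟨d, g2⟩ h2 h12
        have k1 := key _ _ h1
        have k2 := key _ _ h2
        exact Prod.ext h12 (k1.trans k2.symm)
    obtain ⟨h, hh, hWh⟩ : ∃ h ∈ H, 3 * t < 2 * W h := by
      by_contra! hcon
      have h1 : ∑ h ∈ H, (2 * W h) ≤ q * (3 * t) := by
        simpa using Finset.sum_le_card_nsmul H (fun h => 2 * W h) (3 * t) (fun h hh => hcon h hh)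
      rw [← Finset.mul_sum] at h1
      nlinarith
    have σimg : F.image σ = F := by
      apply Finset.eq_of_subset_of_card_le
      · intro x hx
        obtain ⟨y, hy, rfl⟩ := Finset.mem_image.1 hx
        exact σmem y hy
      · rw [Finset.card_image_of_injOn σinj]
    set good := F.filter (fun f => G.Adj (Sum.inl f) (Sum.inr h) ∧
      G.Adj (Sum.inr (σ f)) (Sum.inl h)) with hgood
    have hWg : W h ≤ t + good.card := by
      have h1 : W h = (∑ f ∈ F, if G.Adj (Sum.inl f) (Sum.inr h) then 1 else 0) +
          ∑ f ∈ F, if G.Adj (Sum.inr (σ f)) (Sum.inl h) then 1 else 0 := by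
        simp only [hW, wt, Finset.sum_add_distrib]
        congr 1
        conv_lhs => rw [← σimg]
        rw [Finset.sum_image σinj]
      have h2 : t = ∑ f ∈ F, 1 := by simp [ht2]
      rw [h1, h2, hgood, Finset.card_filter, ← Finset.sum_add_distrib, ← Finset.sum_add_distrib]
      refine Finset.sum_le_sum (fun p _ => ?_)
      exact ind_add_le _ _
    have hgc : 1 < good.card := by omega
    obtain ⟨f1, hf1, f2, hf2, hf12⟩ := Finset.one_lt_card.1 hgc
    have hf1 := Finset.mem_filter.1 hf1
    have hf2 := Finset.mem_filter.1 hf2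
    have pick : (∃ f ∈ F, (G.Adj (Sum.inl f) (Sum.inr h) ∧ G.Adj (Sum.inr (σ f)) (Sum.inl h)) ∧
        ((a ≠ f ∧ a ≠ σ f) ∨ (b ≠ f ∧ b ≠ σ f))) := by
      by_contra! hcon
      have c1 := hcon f1 hf1.1 hf1.2
      have c2 := hcon f2 hf2.1 hf2.2
      have s1 := σσ a hag'.1.1
      have s2 := σσ b hb'.1.1
      clear_value σ
      clear hcon
      grind
    obtain ⟨f, hf, hfg, hor | hor⟩ := pick
    · exact final f hf a hag'.1.1 hor.1 hor.2 g' hag'.1.2 hag'.2 h hh hfg.1 hfg.2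
    · exact final f hf b hb'.1.1 hor.1 hor.2 g' hb'.1.2 hb'.2 h hh hfg.1 hfg.2
end

section
/- Let k ≥ 1 be an integer and let D be a digraph of order n = 3k with δ⁰(D) ≥ (9k−3)/4. Then D contains k pairwise vertex-disjoint directed cycles, each of order exactly 3, which together cover all vertices of D; in particular, D contains k disjoint cycles each of order at least 3. -/
namespace TriFac

/-- Total weight of a triple. -/
def dW {V : Type*} (w : V → V → ℕ) (t : V × V × V) : ℕ :=
  w t.1 t.2.1 + w t.1 t.2.2 + w t.2.1 t.2.2

/-- Vertices of a triple. -/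
def vs {V : Type*} (t : V × V × V) : Multiset V := t.1 ::ₘ t.2.1 ::ₘ t.2.2 ::ₘ 0

/-- Weight from a vertex to a triple. -/
def cW {V : Type*} (w : V → V → ℕ) (v : V) (t : V × V × V) : ℕ :=
  w v t.1 + w v t.2.1 + w v t.2.2

theorem num_path : ∀ y1 < 3, ∀ y2 < 3, ∀ y3 < 3, y1 + y2 + y3 < 3 →
    ∀ x1 < 3, ∀ x2 < 3, ∀ x3 < 3, 2 * (y1 + y2 + y3) + (x1 + x2 + x3) < 6 →
    ∀ z1 < 3, ∀ z2 < 3, ∀ z3 < 3,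
    2 * (y1 + y2 + y3) + (x1 + x2 + x3) + (z1 + z2 + z3) < 6 →
    (y1 + z1 + 1 ≤ 1 ∧ x2 + x3 ≤ 1) ∨
    (y2 + z2 + 1 ≤ 1 ∧ x1 + x3 ≤ 1) ∨
    (y3 + z3 + 1 ≤ 1 ∧ x1 + x2 + 1 ≤ 1) ∨
    (x1 + z1 ≤ 1 ∧ y2 + y3 ≤ 1) ∨
    (x2 + z2 ≤ 1 ∧ y1 + y3 ≤ 1) ∨
    (x3 + z3 ≤ 1 ∧ y1 + y2 + 1 ≤ 1) ∨
    (x1 + y1 + 1 ≤ 1 ∧ z2 + z3 ≤ 1) ∨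
    (x2 + y2 + 1 ≤ 1 ∧ z1 + z3 ≤ 1) ∨
    (x3 + y3 + 1 ≤ 1 ∧ z1 + z2 + 1 ≤ 1) := by
  have H : ((List.range 3).all fun y1 => (List.range 3).all fun y2 => (List.range 3).all fun y3 => !decide (y1 + y2 + y3 < 3) ||
    (List.range 3).all fun x1 => (List.range 3).all fun x2 => (List.range 3).all fun x3 => !decide (2 * (y1 + y2 + y3) + (x1 + x2 + x3) < 6) ||
    (List.range 3).all fun z1 => (List.range 3).all fun z2 => (List.range 3).all fun z3 =>
    !decide (2 * (y1 + y2 + y3) + (x1 + x2 + x3) + (z1 + z2 + z3) < 6) || decide ((y1 + z1 + 1 ≤ 1 ∧ x2 + x3 ≤ 1) ∨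
    (y2 + z2 + 1 ≤ 1 ∧ x1 + x3 ≤ 1) ∨
    (y3 + z3 + 1 ≤ 1 ∧ x1 + x2 + 1 ≤ 1) ∨
    (x1 + z1 ≤ 1 ∧ y2 + y3 ≤ 1) ∨
    (x2 + z2 ≤ 1 ∧ y1 + y3 ≤ 1) ∨
    (x3 + z3 ≤ 1 ∧ y1 + y2 + 1 ≤ 1) ∨
    (x1 + y1 + 1 ≤ 1 ∧ z2 + z3 ≤ 1) ∨
    (x2 + y2 + 1 ≤ 1 ∧ z1 + z3 ≤ 1) ∨
    (x3 + y3 + 1 ≤ 1 ∧ z1 + z2 + 1 ≤ 1))) = true := by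
    decide +kernel
  simpa only [List.all_eq_true, List.mem_range, Bool.or_eq_true, Bool.not_eq_true',
    decide_eq_false_iff_not, decide_eq_true_eq, ← imp_iff_not_or] using H

theorem num_heavy : ∀ y1 < 3, ∀ y2 < 3, ∀ y3 < 3, 3 * (y1 + y2 + y3) < 12 →
    ∀ x1 < 3, ∀ x2 < 3, ∀ x3 < 3, 3 * (y1 + y2 + y3) + 3 * (x1 + x2 + x3) < 12 →
    ∀ z1 < 3, ∀ z2 < 3, ∀ z3 < 3,
    3 * (y1 + y2 + y3) + 3 * (x1 + x2 + x3) + 2 * (z1 + z2 + z3) < 12 →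
    (y1 + z1 ≤ 1 ∧ x2 + x3 ≤ 1) ∨
    (y2 + z2 ≤ 1 ∧ x1 + x3 ≤ 1) ∨
    (y3 + z3 ≤ 1 ∧ x1 + x2 + 1 ≤ 1) ∨
    (x1 + z1 ≤ 1 ∧ y2 + y3 ≤ 1) ∨
    (x2 + z2 ≤ 1 ∧ y1 + y3 ≤ 1) ∨
    (x3 + z3 ≤ 1 ∧ y1 + y2 + 1 ≤ 1) := by
  have H : ((List.range 3).all fun y1 => (List.range 3).all fun y2 => (List.range 3).all fun y3 => !decide (3 * (y1 + y2 + y3) < 12) ||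
    (List.range 3).all fun x1 => (List.range 3).all fun x2 => (List.range 3).all fun x3 => !decide (3 * (y1 + y2 + y3) + 3 * (x1 + x2 + x3) < 12) ||
    (List.range 3).all fun z1 => (List.range 3).all fun z2 => (List.range 3).all fun z3 =>
    !decide (3 * (y1 + y2 + y3) + 3 * (x1 + x2 + x3) + 2 * (z1 + z2 + z3) < 12) || decide ((y1 + z1 ≤ 1 ∧ x2 + x3 ≤ 1) ∨
    (y2 + z2 ≤ 1 ∧ x1 + x3 ≤ 1) ∨
    (y3 + z3 ≤ 1 ∧ x1 + x2 + 1 ≤ 1) ∨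
    (x1 + z1 ≤ 1 ∧ y2 + y3 ≤ 1) ∨
    (x2 + z2 ≤ 1 ∧ y1 + y3 ≤ 1) ∨
    (x3 + z3 ≤ 1 ∧ y1 + y2 + 1 ≤ 1))) = true := by
    decide +kernel
  simpa only [List.all_eq_true, List.mem_range, Bool.or_eq_true, Bool.not_eq_true',
    decide_eq_false_iff_not, decide_eq_true_eq, ← imp_iff_not_or] using H

section
variable {V : Type*} (w : V → V → ℕ)

theorem norm_A (hs : ∀ u v, w u v = w v u) (t : V × V × V) (h : dW w t ≤ 1) :
    ∃ a b c, vs t = vs (a, b, c) ∧ w a b ≤ 1 ∧ w a c = 0 ∧ w b c = 0 := by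
  obtain ⟨a, b, c⟩ := t
  simp only [dW] at h
  have h1 := hs a b
  have h2 := hs a c
  have h3 := hs b c
  by_cases e1 : w a c = 0
  · by_cases e2 : w b c = 0
    · exact ⟨a, b, c, rfl, by omega, e1, e2⟩
    · refine ⟨b, c, a, ?_, by omega, by omega, by omega⟩
      simp only [vs, ← Multiset.singleton_add]; abel
  · refine ⟨a, c, b, ?_, by omega, by omega, by omega⟩
    simp only [vs, ← Multiset.singleton_add]; abel

theorem norm_B (hs : ∀ u v, w u v = w v u) (t : V × V × V) (h : dW w t = 2) :
    ∃ x y z, vs t = vs (x, y, z) ∧ ((w x y = 1 ∧ w y z = 1 ∧ w x z = 0) ∨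
      (w x y = 2 ∧ w y z = 0 ∧ w x z = 0)) := by
  obtain ⟨a, b, c⟩ := t
  simp only [dW] at h
  have h1 := hs a b
  have h2 := hs a c
  have h3 := hs b c
  have hc : (w a b = 1 ∧ w b c = 1 ∧ w a c = 0) ∨ (w a b = 2 ∧ w b c = 0 ∧ w a c = 0) ∨
    (w a b = 1 ∧ w b c = 0 ∧ w a c = 1) ∨ (w a b = 0 ∧ w b c = 2 ∧ w a c = 0) ∨
    (w a b = 0 ∧ w b c = 1 ∧ w a c = 1) ∨ (w a b = 0 ∧ w b c = 0 ∧ w a c = 2) := by omega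
  rcases hc with h | h | h | h | h | h
  · exact ⟨a, b, c, rfl, by omega⟩
  · exact ⟨a, b, c, rfl, by omega⟩
  · refine ⟨b, a, c, ?_, by omega⟩
    simp only [vs, ← Multiset.singleton_add]; abel
  · refine ⟨b, c, a, ?_, by omega⟩
    simp only [vs, ← Multiset.singleton_add]; abel
  · refine ⟨a, c, b, ?_, by omega⟩
    simp only [vs, ← Multiset.singleton_add]; abel
  · refine ⟨a, c, b, ?_, by omega⟩
    simp only [vs, ← Multiset.singleton_add]; abel

theorem swap_path (hs : ∀ u v, w u v = w v u) (h2 : ∀ u v, w u v ≤ 2) (x y z a b c : V)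
    (hB : w x y = 1 ∧ w y z = 1 ∧ w x z = 0)
    (hA : w a b ≤ 1 ∧ w a c = 0 ∧ w b c = 0)
    (hc : 2 * cW w y (a, b, c) + cW w x (a, b, c) + cW w z (a, b, c) < 6) :
    ∃ s t, vs s + vs t = vs (x, y, z) + vs (a, b, c) ∧ dW w s ≤ 1 ∧ dW w t ≤ 1 := by
  have l : ∀ u v, w u v < 3 := fun u v => Nat.lt_succ_of_le (h2 u v)
  simp only [cW] at hc
  have := num_path _ (l y a) _ (l y b) _ (l y c) (by omega) _ (l x a) _ (l x b) _ (l x c)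
    (by omega) _ (l z a) _ (l z b) _ (l z c) hc
  have e1 := hs x a
  have e2 := hs x b
  have e3 := hs x c
  have e4 := hs y a
  have e5 := hs y b
  have e6 := hs y c
  have e7 := hs z a
  have e8 := hs z b
  have e9 := hs z c
  rcases this with h | h | h | h | h | h | h | h | h
  · refine ⟨(a, y, z), (x, b, c), ?_, by simp only [dW]; omega, by simp only [dW]; omega⟩
    simp only [vs, ← Multiset.singleton_add]; abel
  · refine ⟨(b, y, z), (a, x, c), ?_, by simp only [dW]; omega, by simp only [dW]; omega⟩
    simp only [vs, ← Multiset.singleton_add]; abel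
  · refine ⟨(c, y, z), (a, b, x), ?_, by simp only [dW]; omega, by simp only [dW]; omega⟩
    simp only [vs, ← Multiset.singleton_add]; abel
  · refine ⟨(x, a, z), (y, b, c), ?_, by simp only [dW]; omega, by simp only [dW]; omega⟩
    simp only [vs, ← Multiset.singleton_add]; abel
  · refine ⟨(x, b, z), (a, y, c), ?_, by simp only [dW]; omega, by simp only [dW]; omega⟩
    simp only [vs, ← Multiset.singleton_add]; abel
  · refine ⟨(x, c, z), (a, b, y), ?_, by simp only [dW]; omega, by simp only [dW]; omega⟩
    simp only [vs, ← Multiset.singleton_add]; abel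
  · refine ⟨(x, y, a), (z, b, c), ?_, by simp only [dW]; omega, by simp only [dW]; omega⟩
    simp only [vs, ← Multiset.singleton_add]; abel
  · refine ⟨(x, y, b), (a, z, c), ?_, by simp only [dW]; omega, by simp only [dW]; omega⟩
    simp only [vs, ← Multiset.singleton_add]; abel
  · refine ⟨(x, y, c), (a, b, z), ?_, by simp only [dW]; omega, by simp only [dW]; omega⟩
    simp only [vs, ← Multiset.singleton_add]; abel

theorem swap_heavy (hs : ∀ u v, w u v = w v u) (h2 : ∀ u v, w u v ≤ 2) (x y z a b c : V)
    (hB : w x y = 2 ∧ w y z = 0 ∧ w x z = 0)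
    (hA : w a b ≤ 1 ∧ w a c = 0 ∧ w b c = 0)
    (hc : 3 * cW w y (a, b, c) + 3 * cW w x (a, b, c) + 2 * cW w z (a, b, c) < 12) :
    ∃ s t, vs s + vs t = vs (x, y, z) + vs (a, b, c) ∧ dW w s ≤ 1 ∧ dW w t ≤ 1 := by
  have l : ∀ u v, w u v < 3 := fun u v => Nat.lt_succ_of_le (h2 u v)
  simp only [cW] at hc
  have := num_heavy _ (l y a) _ (l y b) _ (l y c) (by omega) _ (l x a) _ (l x b) _ (l x c)
    (by omega) _ (l z a) _ (l z b) _ (l z c) hc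
  have e1 := hs x a
  have e2 := hs x b
  have e3 := hs x c
  have e4 := hs y a
  have e5 := hs y b
  have e6 := hs y c
  have e7 := hs z a
  have e8 := hs z b
  have e9 := hs z c
  rcases this with h | h | h | h | h | h
  · refine ⟨(a, y, z), (x, b, c), ?_, by simp only [dW]; omega, by simp only [dW]; omega⟩
    simp only [vs, ← Multiset.singleton_add]; abel
  · refine ⟨(b, y, z), (a, x, c), ?_, by simp only [dW]; omega, by simp only [dW]; omega⟩
    simp only [vs, ← Multiset.singleton_add]; abel
  · refine ⟨(c, y, z), (a, b, x), ?_, by simp only [dW]; omega, by simp only [dW]; omega⟩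
    simp only [vs, ← Multiset.singleton_add]; abel
  · refine ⟨(x, a, z), (y, b, c), ?_, by simp only [dW]; omega, by simp only [dW]; omega⟩
    simp only [vs, ← Multiset.singleton_add]; abel
  · refine ⟨(x, b, z), (a, y, c), ?_, by simp only [dW]; omega, by simp only [dW]; omega⟩
    simp only [vs, ← Multiset.singleton_add]; abel
  · refine ⟨(x, c, z), (a, b, y), ?_, by simp only [dW]; omega, by simp only [dW]; omega⟩
    simp only [vs, ← Multiset.singleton_add]; abel

theorem cW_congr (v : V) (s t : V × V × V) (h : vs s = vs t) : cW w v s = cW w v t := by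
  have := congrArg (fun m => (m.map (w v)).sum) h
  simp only [vs, Multiset.map_cons, Multiset.sum_cons, Multiset.map_zero, Multiset.sum_zero] at this
  simp only [cW]; omega

theorem exists_lt (R : Multiset (V × V × V)) (f : V × V × V → ℕ) (n : ℕ)
    (h : (R.map f).sum < R.card * n) : ∃ t ∈ R, f t < n := by
  by_contra hc
  push Not at hc
  have := Multiset.card_nsmul_le_sum (s := R.map f) (a := n) (by
    intro m hm
    obtain ⟨t, ht, rfl⟩ := Multiset.mem_map.1 hm
    exact hc t ht)
  simp at this
  omega

theorem deg_eq [Fintype V] (P : Multiset (V × V × V)) (hP : P.bind vs = Finset.univ.val) (v : V) :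
    ∑ u, w v u = (P.map (cW w v)).sum := by
  have : ∑ u, w v u = ((P.bind vs).map (w v)).sum := by rw [hP]; rfl
  rw [this, Multiset.map_bind, Multiset.sum_bind]
  congr 1
  apply Multiset.map_congr rfl
  intro t _
  simp [vs, cW]; omega

theorem card_eq [Fintype V] (k : ℕ) (hk : Fintype.card V = 3 * k)
    (P : Multiset (V × V × V)) (hP : P.bind vs = Finset.univ.val) : P.card = k := by
  have := congrArg Multiset.card hP
  rw [Multiset.card_bind] at this
  have h3 : (Multiset.card ∘ vs : V × V × V → ℕ) = fun _ => 3 := by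
    funext t; simp [vs]
  rw [h3] at this
  simp at this
  omega

theorem step [Fintype V] (k : ℕ) (hk : Fintype.card V = 3 * k)
    (hs : ∀ u v, w u v = w v u) (h0 : ∀ v, w v v = 0) (h2 : ∀ u v, w u v ≤ 2)
    (hd : ∀ v, 2 * ∑ u, w v u + 1 ≤ 3 * k)
    (B : V × V × V) (R : Multiset (V × V × V)) (hP : (B ::ₘ R).bind vs = Finset.univ.val)
    (hB : dW w B = 2) (hR : ∀ t ∈ R, dW w t ≤ 1) :
    ∃ P : Multiset (V × V × V), P.bind vs = Finset.univ.val ∧ ∀ t ∈ P, dW w t ≤ 1 := by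
  obtain ⟨x, y, z, hv, hB⟩ := norm_B w hs B hB
  have hcard := card_eq k hk _ hP
  have hdd : ∀ v, 2 * (cW w v (x, y, z) + (R.map (cW w v)).sum) + 1 ≤ 3 * k := by
    intro v
    have := hd v
    rw [deg_eq w _ hP] at this
    simpa [cW_congr w v _ _ hv] using this
  have hx := hdd x
  have hy := hdd y
  have hz := hdd z
  simp only [cW, h0] at hx hy hz
  rw [hs z x, hs z y] at hz
  rw [hs y x] at hy
  simp only [Multiset.card_cons] at hcard
  have key : ∃ A ∈ R, ∃ s t, vs s + vs t = vs (x, y, z) + vs A ∧ dW w s ≤ 1 ∧ dW w t ≤ 1 := by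
    rcases hB with hB | hB
    · obtain ⟨A, hA, hlt⟩ := exists_lt R (fun t => 2 * cW w y t + cW w x t + cW w z t) 6 (by
        simp only [Multiset.sum_map_add, Multiset.sum_map_mul_left]
        omega)
      obtain ⟨a, b, c, hva, hA'⟩ := norm_A w hs A (hR A hA)
      simp only [cW_congr w _ _ _ hva] at hlt
      exact ⟨A, hA, hva ▸ swap_path w hs h2 x y z a b c hB hA' hlt⟩
    · obtain ⟨A, hA, hlt⟩ := exists_lt R
        (fun t => 3 * cW w y t + 3 * cW w x t + 2 * cW w z t) 12 (by
        simp only [Multiset.sum_map_add, Multiset.sum_map_mul_left]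
        omega)
      obtain ⟨a, b, c, hva, hA'⟩ := norm_A w hs A (hR A hA)
      simp only [cW_congr w _ _ _ hva] at hlt
      exact ⟨A, hA, hva ▸ swap_heavy w hs h2 x y z a b c hB hA' hlt⟩
  obtain ⟨A, hA, s, t, hst, h1, h1'⟩ := key
  obtain ⟨R', rfl⟩ := Multiset.exists_cons_of_mem hA
  refine ⟨s ::ₘ t ::ₘ R', ?_, ?_⟩
  · rw [← hP]
    simp only [Multiset.cons_bind, ← add_assoc, hst, hv]
  · intro r hr
    simp only [Multiset.mem_cons] at hr
    rcases hr with rfl | rfl | hr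
    · exact h1
    · exact h1'
    · exact hR r (Multiset.mem_cons_of_mem hr)

theorem exists_init [Fintype V] (k : ℕ) (hk : Fintype.card V = 3 * k) :
    ∃ P : Multiset (V × V × V), P.bind vs = Finset.univ.val := by
  have : ∀ k (M : Multiset V), M.card = 3 * k → ∃ P : Multiset (V × V × V), P.bind vs = M := by
    intro k
    induction k with
    | zero =>
      intro M hM
      refine ⟨0, ?_⟩
      simp at hM
      simp [hM]
    | succ k ih =>
      intro M hM
      obtain ⟨a, M1, rfl⟩ := Multiset.card_pos_iff_exists_mem.1 (by omega : 0 < M.card) |>.imp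
        fun a ha => Multiset.exists_cons_of_mem ha
      rw [Multiset.card_cons] at hM
      obtain ⟨b, M2, rfl⟩ := Multiset.card_pos_iff_exists_mem.1 (by omega : 0 < M1.card) |>.imp
        fun a ha => Multiset.exists_cons_of_mem ha
      rw [Multiset.card_cons] at hM
      obtain ⟨c, M3, rfl⟩ := Multiset.card_pos_iff_exists_mem.1 (by omega : 0 < M2.card) |>.imp
        fun a ha => Multiset.exists_cons_of_mem ha
      rw [Multiset.card_cons] at hM
      obtain ⟨P, hP⟩ := ih M3 (by omega)
      exact ⟨(a, b, c) ::ₘ P, by simp [hP, vs]⟩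
  exact this k _ (by simpa using hk)

end

theorem main {V : Type*} [Fintype V] (k : ℕ) (hk : Fintype.card V = 3 * k) (N : ℕ) :
    ∀ w : V → V → ℕ, ∑ u, ∑ v, w u v ≤ N →
    (∀ u v, w u v = w v u) → (∀ v, w v v = 0) → (∀ u v, w u v ≤ 2) →
    (∀ v, 2 * ∑ u, w v u + 1 ≤ 3 * k) →
    ∃ P : Multiset (V × V × V), P.bind vs = Finset.univ.val ∧ ∀ t ∈ P, dW w t ≤ 1 := by
  classical
  induction N with
  | zero =>
    intro w hN _ _ _ _
    have hz : ∀ u v, w u v = 0 := by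
      intro u v
      have h := Nat.le_zero.1 hN
      have h1 := (Finset.sum_eq_zero_iff.1 h) u (Finset.mem_univ _)
      exact (Finset.sum_eq_zero_iff.1 h1) v (Finset.mem_univ _)
    obtain ⟨P, hP⟩ := exists_init k hk
    exact ⟨P, hP, fun t _ => by simp [dW, hz]⟩
  | succ N ih =>
    intro w hN hs h0 h2 hd
    by_cases hz : ∀ u v, w u v = 0
    · obtain ⟨P, hP⟩ := exists_init k hk
      exact ⟨P, hP, fun t _ => by simp [dW, hz]⟩
    push Not at hz
    obtain ⟨p, q, hpq⟩ := hz
    have hne : p ≠ q := by rintro rfl; exact hpq (h0 p)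
    let w' : V → V → ℕ := fun u v => if (u = p ∧ v = q) ∨ (u = q ∧ v = p) then w u v - 1 else w u v
    have hle : ∀ u v, w' u v ≤ w u v := by
      intro u v; simp only [w']; split_ifs <;> omega
    have hlt : w' p q < w p q := by simp [w']; omega
    obtain ⟨P, hP, hPd⟩ := ih w' (by
        have : ∑ u, ∑ v, w' u v < ∑ u, ∑ v, w u v := by
          apply Finset.sum_lt_sum
          · intro u _; exact Finset.sum_le_sum fun v _ => hle u v
          · exact ⟨p, Finset.mem_univ _, Finset.sum_lt_sum (fun v _ => hle p v)
              ⟨q, Finset.mem_univ _, hlt⟩⟩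
        omega)
      (by intro u v; simp only [w', hs u v]; congr 1; apply propext; tauto)
      (fun v => Nat.le_zero.1 ((hle v v).trans (h0 v).le))
      (fun u v => (hle u v).trans (h2 u v))
      (fun v => by
        have : ∑ u, w' v u ≤ ∑ u, w v u := Finset.sum_le_sum fun u _ => hle v u
        have := hd v
        omega)
    by_cases hg : ∀ t ∈ P, dW w t ≤ 1
    · exact ⟨P, hP, hg⟩
    push Not at hg
    obtain ⟨B, hB, hBd⟩ := hg
    obtain ⟨R, rfl⟩ := Multiset.exists_cons_of_mem hB
    have hnd : ((B ::ₘ R).bind vs).Nodup := by rw [hP]; exact Finset.univ.nodup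
    rw [Multiset.cons_bind, Multiset.nodup_add] at hnd
    obtain ⟨hBn, -, hdis⟩ := hnd
    -- a triple avoiding one of the two vertices keeps its weight
    have hsame : ∀ t, dW w' t < dW w t → p ∈ vs t := by
      intro t ht
      by_contra hp
      have : dW w' t = dW w t := by
        obtain ⟨a, b, c⟩ := t
        simp only [vs, Multiset.mem_cons, not_or] at hp
        obtain ⟨ha, hb, hc, -⟩ := hp
        simp [dW, w', Ne.symm ha, Ne.symm hb, Ne.symm hc]
      omega
    have hpB : p ∈ vs B := hsame B (lt_of_le_of_lt (hPd B hB) hBd)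
    refine step w k hk hs h0 h2 hd B R hP ?_ ?_
    · have := hPd B hB
      obtain ⟨a, b, c⟩ := B
      simp only [vs, Multiset.nodup_cons, Multiset.mem_cons, not_or] at hBn
      obtain ⟨⟨hab, hac, -⟩, ⟨hbc, -⟩, -⟩ := hBn
      have : dW w (a, b, c) ≤ dW w' (a, b, c) + 1 := by
        simp only [dW, w']
        split_ifs <;> first | omega | grind
      omega
    · intro t ht
      by_contra hc
      have hpt : p ∈ vs t := hsame t (lt_of_le_of_lt
        (hPd t (Multiset.mem_cons_of_mem ht)) (not_le.1 hc))
      exact Multiset.disjoint_left.1 hdis hpB (Multiset.mem_bind.2 ⟨t, ht, hpt⟩)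

theorem cyc {V : Type*} (A : V → V → Prop) (a b c : V) (hab : a ≠ b) (hac : a ≠ c) (hbc : b ≠ c)
    (h1 : A a b) (h2 : A b c) (h3 : A c a) : IsDicycle A [a, b, c] := by
  refine ⟨by simp, by simp [hab, hac, hbc], ?_⟩
  intro i
  have : (i : ℕ) < 3 := i.2
  obtain ⟨i, hi⟩ := i
  simp only at this
  interval_cases i <;> simpa

end TriFac

theorem stmt13 {V : Type*} [Fintype V] (A : V → V → Prop) (hloopless : Irreflexive A)
    (k : ℕ) (hk : 1 ≤ k) (hcard : Fintype.card V = 3 * k)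
    (hdeg : ∀ v : V, (9 * (k : ℚ) - 3) / 4 ≤ (outDeg A v : ℚ) ∧
      (9 * (k : ℚ) - 3) / 4 ≤ (inDeg A v : ℚ)) :
    ∃ c : Fin k → List V,
      (∀ i, IsDicycle A (c i) ∧ (c i).length = 3) ∧
      (∀ i j, i ≠ j → ∀ v ∈ c i, v ∉ c j) ∧
      (∀ v : V, ∃ i, v ∈ c i) := by
  classical
  let w : V → V → ℕ := fun u v => if u = v then 0 else
    (if A u v then 0 else 1) + (if A v u then 0 else 1)
  obtain ⟨P, hP, hPd⟩ := TriFac.main (V := V) k hcard _ w le_rfl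
    (by intro u v; simp only [w, eq_comm (a := u)]; split_ifs <;> rfl)
    (by intro v; simp [w])
    (by intro u v; simp only [w]; split_ifs <;> omega)
    (by
      intro v
      have key : ∑ u, w v u + outDeg A v + inDeg A v + 2 = 2 * Fintype.card V := by
        have e1 : outDeg A v = ∑ u, if A v u then 1 else 0 := by
          rw [outDeg, Set.ncard_eq_toFinset_card', Finset.sum_boole]
          simp
        have e2 : inDeg A v = ∑ u, if A u v then 1 else 0 := by
          rw [inDeg, Set.ncard_eq_toFinset_card', Finset.sum_boole]
          simp
        have e3 : 2 = ∑ u, if v = u then 2 else 0 := by simp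
        have e4 : 2 * Fintype.card V = ∑ u : V, 2 := by simp [mul_comm]
        rw [e1, e2, e4]
        conv_lhs => rw [e3]
        rw [← Finset.sum_add_distrib, ← Finset.sum_add_distrib, ← Finset.sum_add_distrib]
        apply Finset.sum_congr rfl
        intro u _
        simp only [w]
        by_cases h : v = u
        · subst h
          simp [hloopless v]
        · simp only [h, if_false]
          split_ifs <;> rfl
      obtain ⟨h1, h2⟩ := hdeg v
      have h3 : (9 * (k : ℚ) - 3) ≤ 2 * ((outDeg A v : ℚ) + inDeg A v) := by linarith
      have h4 : 9 * k ≤ 2 * (outDeg A v + inDeg A v) + 3 := by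
        have : (9 * (k : ℚ)) ≤ 2 * ((outDeg A v : ℚ) + inDeg A v) + 3 := by linarith
        exact_mod_cast this
      omega)
  have hPc := TriFac.card_eq k hcard P hP
  induction P using Quotient.inductionOn with
  | h L =>
  change L.length = k at hPc
  subst hPc
  have hnd : ((L : Multiset (V × V × V)).bind TriFac.vs).Nodup := by
    rw [show (L : Multiset (V × V × V)).bind TriFac.vs = _ from hP]; exact Finset.univ.nodup
  rw [Multiset.nodup_bind] at hnd
  obtain ⟨hn1, L', hL', hn2⟩ := hnd
  have hpw : L.Pairwise fun a b => Disjoint (TriFac.vs a) (TriFac.vs b) :=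
    (Quotient.exact hL' : L.Perm L').symm.pairwise hn2 (fun h => h.symm)
  have hex : ∀ t ∈ L, ∃ l : List V, (IsDicycle A l ∧ l.length = 3) ∧ ∀ v, v ∈ l ↔ v ∈ TriFac.vs t := by
    intro t ht
    have hd := hPd t ht
    have hn := hn1 t ht
    obtain ⟨a, b, c⟩ := t
    simp only [TriFac.vs, Multiset.nodup_cons, Multiset.mem_cons, not_or] at hn
    obtain ⟨⟨hab, hac, -⟩, ⟨hbc, -⟩, -⟩ := hn
    simp only [TriFac.dW, w, hab, hac, hbc, if_false] at hd
    by_cases hc : A a b ∧ A b c ∧ A c a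
    · exact ⟨[a, b, c], ⟨TriFac.cyc A a b c hab hac hbc hc.1 hc.2.1 hc.2.2, rfl⟩,
        by simp [TriFac.vs]⟩
    · have : A a c ∧ A c b ∧ A b a := by
        split_ifs at hd <;> first | omega | tauto
      exact ⟨[a, c, b], ⟨TriFac.cyc A a c b hac hab (Ne.symm hbc) this.1 this.2.1 this.2.2, rfl⟩,
        by intro v; simp [TriFac.vs]; tauto⟩
  choose! f hf hfm using hex
  refine ⟨fun i => f (L.get i), fun i => hf _ (L.get_mem i), ?_, ?_⟩
  · intro i j hij v hv hv'
    rw [hfm _ (L.get_mem _)] at hv hv'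
    rw [List.pairwise_iff_get] at hpw
    rcases lt_or_gt_of_ne hij with h | h
    · exact Multiset.disjoint_left.1 (hpw i j h) hv hv'
    · exact Multiset.disjoint_left.1 (hpw j i h) hv' hv
  · intro v
    have : v ∈ (L : Multiset (V × V × V)).bind TriFac.vs := by
      rw [show (L : Multiset (V × V × V)).bind TriFac.vs = _ from hP]; simp
    obtain ⟨t, ht, hvt⟩ := Multiset.mem_bind.1 this
    obtain ⟨i, hi⟩ := List.get_of_mem (Multiset.mem_coe.1 ht)
    exact ⟨i, by show v ∈ f (L.get i); rw [hi, hfm t ht]; exact hvt⟩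
end

section
/- Let D be a digraph of order n with δ⁰(D) ≥ (3n−3)/4. Then D contains an arbitrary cycle-factor: for every integer k ≥ 1 and every partition n = n_1 + ⋯ + n_k with n_i ≥ 2 for each i, D contains k pairwise vertex-disjoint directed cycles C_1, …, C_k with |V(C_i)| = n_i for each i (so the cycles cover all vertices of D). -/
open Finset in
/-- Counting step of the Sauer–Spencer style switching argument. -/
theorem switch_count {P : Type*} [Fintype P] (R : P → P → Prop)
    (hout : ∀ x, 4 * {y | y ≠ x ∧ ¬ R x y}.ncard + 1 ≤ Fintype.card P)
    (hin : ∀ x, 4 * {y | y ≠ x ∧ ¬ R y x}.ncard + 1 ≤ Fintype.card P)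
    (σ : Equiv.Perm P) (hσ : ∀ x, σ x ≠ x) (u : P) (hu : ¬ R u (σ u)) :
    (∃ w, w ≠ u ∧ w ≠ σ u ∧ w ≠ σ.symm u ∧ R w (σ u) ∧ R (σ.symm u) w ∧ R u (σ w) ∧
      R (σ.symm w) u) ∨
    (σ u ≠ σ.symm u ∧ R (σ.symm u) (σ u) ∧ R u (σ (σ u)) ∧ R (σ.symm (σ.symm u)) u) := by
  classical
  have hσ' : ∀ x, σ.symm x ≠ x := fun x h => hσ x (by rw [Equiv.symm_apply_eq] at h; exact h.symm)
  let A1 : Finset P := {w | w ≠ σ u ∧ ¬ R w (σ u)}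
  let A2 : Finset P := {w | w ≠ σ.symm u ∧ ¬ R (σ.symm u) w}
  let A3 : Finset P := {w | σ w ≠ u ∧ ¬ R u (σ w)}
  let A4 : Finset P := {w | σ.symm w ≠ u ∧ ¬ R (σ.symm w) u}
  have h1 : 4 * #A1 + 1 ≤ Fintype.card P := by
    have := hin (σ u)
    rw [Set.ncard_eq_toFinset_card'] at this
    simpa [A1] using this
  have h2 : 4 * #A2 + 1 ≤ Fintype.card P := by
    have := hout (σ.symm u)
    rw [Set.ncard_eq_toFinset_card'] at this
    simpa [A2] using this
  have h3 : 4 * #A3 + 1 ≤ Fintype.card P := by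
    have := hout u
    rw [Set.ncard_eq_toFinset_card'] at this
    have e : #A3 = #(Set.toFinset {y | y ≠ u ∧ ¬ R u y}) :=
      Finset.card_bij (fun a _ => σ a) (by simp [A3]) (by simp)
        (fun b hb => ⟨σ.symm b, by simpa [A3] using hb, by simp⟩)
    rw [e]; exact this
  have h4 : 4 * #A4 + 1 ≤ Fintype.card P := by
    have := hin u
    rw [Set.ncard_eq_toFinset_card'] at this
    have e : #A4 = #(Set.toFinset {y | y ≠ u ∧ ¬ R y u}) :=
      Finset.card_bij (fun a _ => σ.symm a) (by simp [A4]) (by simp)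
        (fun b hb => ⟨σ b, by simpa [A4] using hb, by simp⟩)
    rw [e]; exact this
  have u1 : u ∈ A1 := by simp [A1, hu, (hσ u).symm]
  have u3 : u ∈ A3 := by simp [A3, hu, hσ u]
  have c13 : #(A1 ∪ A3) + 1 ≤ #A1 + #A3 := by
    rw [← Finset.card_union_add_card_inter A1 A3]
    have : 0 < #(A1 ∩ A3) := Finset.card_pos.2 ⟨u, by simp [u1, u3]⟩
    omega
  set S := (A1 ∪ A3) ∪ (A2 ∪ A4) with hS
  have cS : #S + 2 ≤ Fintype.card P := by
    have a := Finset.card_union_le (A1 ∪ A3) (A2 ∪ A4)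
    rw [← hS] at a
    have b := Finset.card_union_le A2 A4
    omega
  have cSc : 2 ≤ #Sᶜ := by rw [Finset.card_compl]; omega
  by_cases hex : ∃ w ∈ Sᶜ, w ≠ σ u ∧ w ≠ σ.symm u
  · obtain ⟨w, hw, hw1, hw2⟩ := hex
    left
    simp only [hS, A1, A2, A3, A4, Finset.mem_compl, Finset.mem_union, Finset.mem_filter,
      Finset.mem_univ, true_and, not_or, not_and, not_not] at hw
    obtain ⟨⟨a1, a3⟩, a2, a4⟩ := hw
    refine ⟨w, ?_, hw1, hw2, a1 hw1, a2 hw2, a3 ?_, a4 ?_⟩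
    · rintro rfl; exact hu (a1 hw1)
    · intro h; exact hw2 (by rw [← h]; simp)
    · intro h; exact hw1 (by rw [← h]; simp)
  · right
    push Not at hex
    have sub : Sᶜ ⊆ {σ u, σ.symm u} := by
      intro w hw
      by_cases h : w = σ u
      · simp [h]
      · simp [hex w hw h]
    have hne : σ u ≠ σ.symm u := by
      intro h
      have := Finset.card_le_card sub
      rw [h] at this
      simp at this
      omega
    have heq : Sᶜ = {σ u, σ.symm u} :=
      Finset.eq_of_subset_of_card_le sub (by rw [Finset.card_pair hne]; exact cSc)
    have m1 : σ u ∈ Sᶜ := by rw [heq]; simp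
    have m2 : σ.symm u ∈ Sᶜ := by rw [heq]; simp
    simp only [hS, A1, A2, A3, A4, Finset.mem_compl, Finset.mem_union, Finset.mem_filter,
      Finset.mem_univ, true_and, not_or, not_and, not_not] at m1 m2
    refine ⟨hne, m1.2.1 hne, m1.1.2 ?_, m2.2.2 ?_⟩
    · intro h; exact hne (by rw [Equiv.eq_symm_apply]; exact h)
    · intro h; exact hne (by rw [Equiv.symm_apply_eq] at h; rw [← h])

/-- Set of bad positions of a placement `f`. -/
def badSet {P V : Type*} (A : V → V → Prop) (σ : Equiv.Perm P) (f : P ≃ V) : Set P :=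
  {x | ¬ A (f x) (f (σ x))}

/-- Positions not touched by the swap keep their status. -/
theorem bad_swap {P V : Type*} [DecidableEq P] (A : V → V → Prop) (σ : Equiv.Perm P) (f : P ≃ V)
    (u w x : P) (h1 : x ≠ u) (h2 : x ≠ w) (h3 : x ≠ σ.symm u) (h4 : x ≠ σ.symm w) :
    x ∈ badSet A σ ((Equiv.swap u w).trans f) ↔ x ∈ badSet A σ f := by
  have h3' : σ x ≠ u := fun h => h3 (by rw [← h]; simp)
  have h4' : σ x ≠ w := fun h => h4 (by rw [← h]; simp)
  simp [badSet, Equiv.swap_apply_of_ne_of_ne h1 h2, Equiv.swap_apply_of_ne_of_ne h3' h4']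

theorem bad_swap_lt {P V : Type*} [Fintype P] [DecidableEq P] (A : V → V → Prop)
    (σ : Equiv.Perm P) (f : P ≃ V)
    (u w : P) (hu : u ∈ badSet A σ f)
    (h1 : u ∉ badSet A σ ((Equiv.swap u w).trans f))
    (h2 : w ∉ badSet A σ ((Equiv.swap u w).trans f) ∨ w ∈ badSet A σ f)
    (h3 : σ.symm u ∉ badSet A σ ((Equiv.swap u w).trans f))
    (h4 : σ.symm w ∉ badSet A σ ((Equiv.swap u w).trans f)) :
    (badSet A σ ((Equiv.swap u w).trans f)).ncard < (badSet A σ f).ncard := by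
  apply Set.ncard_lt_ncard _ (Set.toFinite _)
  refine ⟨fun x hx => ?_, fun h => h1 (h hu)⟩
  by_cases e2 : x = w
  · subst e2
    exact h2.resolve_left (fun h => h hx)
  · refine (bad_swap A σ f u w x ?_ e2 ?_ ?_).1 hx
    · rintro rfl; exact h1 hx
    · rintro rfl; exact h3 hx
    · rintro rfl; exact h4 hx

/-- In a minimal placement, a bad arc yields a very restricted local structure. -/
theorem min_struct {P V : Type*} [Fintype P] [DecidableEq P] (A : V → V → Prop)
    (σ : Equiv.Perm P) (hσ : ∀ x, σ x ≠ x)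
    (hout : ∀ (f : P ≃ V) x, 4 * {y | y ≠ x ∧ ¬ A (f x) (f y)}.ncard + 1 ≤ Fintype.card P)
    (hin : ∀ (f : P ≃ V) x, 4 * {y | y ≠ x ∧ ¬ A (f y) (f x)}.ncard + 1 ≤ Fintype.card P)
    (f : P ≃ V) (hf : ∀ g : P ≃ V, (badSet A σ f).ncard ≤ (badSet A σ g).ncard)
    (u : P) (hu : u ∈ badSet A σ f) :
    σ u ≠ σ.symm u ∧ A (f (σ.symm u)) (f (σ u)) ∧ A (f (σ.symm (σ.symm u))) (f u) ∧
      ¬ A (f (σ u)) (f u) := by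
  have hσ' : ∀ x, σ.symm x ≠ x := fun x h => hσ x (by rw [Equiv.symm_apply_eq] at h; exact h.symm)
  rcases switch_count (fun x y => A (f x) (f y)) (hout f) (hin f) σ hσ u hu with
    ⟨w, w1, w2, w3, a1, a2, a3, a4⟩ | ⟨hne, a1, a2, a3⟩
  · exfalso
    have k1 : σ w ≠ u := fun h => w3 (by rw [← h]; simp)
    have k2 : σ.symm w ≠ u := fun h => w2 (by rw [← h]; simp)
    apply absurd (hf ((Equiv.swap u w).trans f)) (not_le.2 _)
    apply bad_swap_lt A σ f u w hu
    · simpa [badSet, Equiv.swap_apply_of_ne_of_ne (hσ u) w2.symm] using a1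
    · left
      simpa [badSet, Equiv.swap_apply_of_ne_of_ne k1 (hσ w)] using a3
    · simpa [badSet, Equiv.swap_apply_of_ne_of_ne (hσ' u) w3.symm] using a2
    · simpa [badSet, Equiv.swap_apply_of_ne_of_ne k2 (hσ' w)] using a4
  · refine ⟨hne, a1, a3, fun hb => ?_⟩
    have k1 : σ (σ u) ≠ u := fun h => hne (by rw [Equiv.eq_symm_apply]; exact h)
    apply absurd (hf ((Equiv.swap u (σ u)).trans f)) (not_le.2 _)
    apply bad_swap_lt A σ f u (σ u) hu
    · simpa [badSet] using hb
    · left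
      simpa [badSet, Equiv.swap_apply_of_ne_of_ne k1 (hσ (σ u))] using a2
    · simpa [badSet, Equiv.swap_apply_of_ne_of_ne (hσ' u) hne.symm] using a1
    · simpa [badSet] using hb

theorem exists_good {P V : Type*} [Fintype P] [DecidableEq P] [Fintype V] (A : V → V → Prop)
    (σ : Equiv.Perm P) (hσ : ∀ x, σ x ≠ x)
    (hout : ∀ (f : P ≃ V) x, 4 * {y | y ≠ x ∧ ¬ A (f x) (f y)}.ncard + 1 ≤ Fintype.card P)
    (hin : ∀ (f : P ≃ V) x, 4 * {y | y ≠ x ∧ ¬ A (f y) (f x)}.ncard + 1 ≤ Fintype.card P)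
    (f₀ : P ≃ V) : ∃ f : P ≃ V, ∀ x, A (f x) (f (σ x)) := by
  classical
  have hσ' : ∀ x, σ.symm x ≠ x := fun x h => hσ x (by rw [Equiv.symm_apply_eq] at h; exact h.symm)
  haveI : Nonempty (P ≃ V) := ⟨f₀⟩
  obtain ⟨f, hf⟩ := Finite.exists_min (fun f : P ≃ V => (badSet A σ f).ncard)
  refine ⟨f, ?_⟩
  by_contra hcon
  push Not at hcon
  obtain ⟨u, hu⟩ := hcon
  have hu : u ∈ badSet A σ f := hu
  obtain ⟨hne, a1, a3, -⟩ := min_struct A σ hσ hout hin f hf u hu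
  set p := σ.symm u with hp
  have hpu : σ p = u := by simp [hp]
  have k2 : σ.symm p ≠ u := fun h => hne (by rw [← h]; simp)
  set g := (Equiv.swap u p).trans f with hg
  have g1 : u ∉ badSet A σ g := by
    simpa [badSet, hg, Equiv.swap_apply_of_ne_of_ne (hσ u) hne] using a1
  have g4 : σ.symm p ∉ badSet A σ g := by
    simpa [badSet, hg, Equiv.swap_apply_of_ne_of_ne k2 (hσ' p)] using a3
  have key : p ∉ badSet A σ g ∨ p ∈ badSet A σ f → False := by
    intro h
    apply absurd (hf g) (not_le.2 _)
    by_cases hpg : p ∈ badSet A σ g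
    · have hpf := h.resolve_left (fun h => h hpg)
      apply Set.ncard_lt_ncard _ (Set.toFinite _)
      refine ⟨fun x hx => ?_, fun h => g1 (h hu)⟩
      by_cases e2 : x = p
      · rw [e2]; exact hpf
      · refine (bad_swap A σ f u p x ?_ e2 e2 ?_).1 hx
        · rintro rfl; exact g1 hx
        · rintro rfl; exact g4 hx
    · exact bad_swap_lt A σ f u p hu g1 (Or.inl hpg) hpg g4
  have hpg : p ∈ badSet A σ g := by
    by_contra h; exact key (Or.inl h)
  have hpf : p ∉ badSet A σ f := fun h => key (Or.inr h)
  have hle : (badSet A σ g).ncard ≤ (badSet A σ f).ncard := by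
    have sub : badSet A σ g ⊆ insert p (badSet A σ f \ {u}) := by
      intro x hx
      by_cases e2 : x = p
      · simp [e2]
      · have e1 : x ≠ u := by rintro rfl; exact g1 hx
        refine Set.mem_insert_of_mem _ ⟨(bad_swap A σ f u p x e1 e2 e2 ?_).1 hx, e1⟩
        rintro rfl; exact g4 hx
    have c1 := Set.ncard_le_ncard sub (Set.toFinite _)
    have c2 := Set.ncard_insert_le p (badSet A σ f \ {u})
    have c3 := Set.ncard_diff_singleton_add_one hu (Set.toFinite _)
    omega
  have := (min_struct A σ hσ hout hin g (fun g' => hle.trans (hf g')) p hpg).2.2.2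
  apply this
  have : A (f p) (f (σ p)) := by
    by_contra h; exact hpf h
  rw [hpu] at this ⊢
  simpa [hg] using this

theorem deg_count {P V : Type*} [Fintype P] [Fintype V] (B : V → Prop) (v : V) (hv : ¬ B v)
    (h : (3 * (Fintype.card V : ℚ) - 3) / 4 ≤ (({w | B w}.ncard : ℕ) : ℚ))
    (f : P ≃ V) (x : P) (hx : f x = v) :
    4 * {y | y ≠ x ∧ ¬ B (f y)}.ncard + 1 ≤ Fintype.card P := by
  classical
  have e : {y | y ≠ x ∧ ¬ B (f y)}.ncard = {w | w ≠ v ∧ ¬ B w}.ncard := by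
    rw [← Set.ncard_image_of_injective _ f.injective]
    congr 1
    ext w
    constructor
    · rintro ⟨y, ⟨h1, h2⟩, rfl⟩
      exact ⟨fun h => h1 (f.injective (h.trans hx.symm)), h2⟩
    · rintro ⟨h1, h2⟩
      exact ⟨f.symm w, ⟨fun h => h1 (by rw [← hx, ← h]; simp), by simpa using h2⟩, by simp⟩
  have e2 : {w | w ≠ v ∧ ¬ B w} = {w | B w}ᶜ \ {v} := by
    ext w; simp [and_comm]
  have c1 := Set.ncard_add_ncard_compl {w | B w}
  have c2 := Set.ncard_diff_singleton_add_one (show v ∈ {w | B w}ᶜ from hv) (Set.toFinite _)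
  rw [← e2] at c2
  rw [Nat.card_eq_fintype_card] at c1
  have h' : 3 * (Fintype.card V : ℚ) ≤ 4 * (({w | B w}.ncard : ℕ) : ℚ) + 3 := by linarith
  have h'' : 3 * Fintype.card V ≤ 4 * {w | B w}.ncard + 3 := by exact_mod_cast h'
  rw [e, Fintype.card_congr f]
  omega

theorem finRotate_val' (n : ℕ) (j : Fin n) : ((finRotate n j : Fin n) : ℕ) = (j + 1) % n := by
  cases n with
  | zero => exact j.elim0
  | succ n => rw [finRotate_succ_apply, Fin.val_add]; simp

/-- **Arbitrary cycle-factor (case `W = V(D)` of Theorem 1).** If `D` is a digraph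
of order `n` with `δ⁰(D) ≥ (3n−3)/4`, then for every `k ≥ 1` and every partition
`n = n₁ + ⋯ + n_k` with each `nᵢ ≥ 2`, `D` contains `k` pairwise vertex-disjoint
directed cycles `C₁, …, C_k` with `|V(Cᵢ)| = nᵢ` (these cycles cover `V(D)`). -/
theorem stmt14 {V : Type*} [Fintype V] (A : V → V → Prop) (hloopless : Irreflexive A)
    (hdeg : ∀ v : V, (3 * (Fintype.card V : ℚ) - 3) / 4 ≤ (outDeg A v : ℚ) ∧
      (3 * (Fintype.card V : ℚ) - 3) / 4 ≤ (inDeg A v : ℚ))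
    (k : ℕ) (hk : 1 ≤ k) (m : Fin k → ℕ) (hm : ∀ i, 2 ≤ m i)
    (hsum : ∑ i, m i = Fintype.card V) :
    ∃ c : Fin k → List V,
      (∀ i, IsDicycle A (c i) ∧ (c i).length = m i) ∧
      (∀ i j, i ≠ j → ∀ v ∈ c i, v ∉ c j) ∧
      (∀ v : V, ∃ i, v ∈ c i) := by
  classical
  let P := Σ i : Fin k, Fin (m i)
  let σ : Equiv.Perm P := Equiv.sigmaCongrRight fun i => finRotate (m i)
  have hcard : Fintype.card P = Fintype.card V := by simp [P, hsum]
  have hσ : ∀ x, σ x ≠ x := by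
    rintro ⟨i, j⟩ h
    have h1 : finRotate (m i) j = j := eq_of_heq (Sigma.mk.inj h).2
    have h2 := congrArg Fin.val h1
    rw [finRotate_val'] at h2
    have := hm i
    have := j.2
    rcases Nat.lt_or_ge (j + 1) (m i) with h3 | h3
    · rw [Nat.mod_eq_of_lt h3] at h2; omega
    · have h4 : (j : ℕ) + 1 = m i := by omega
      rw [h4, Nat.mod_self] at h2; omega
  obtain ⟨f, hf⟩ := exists_good A σ hσ
    (fun f x => deg_count (fun w => A (f x) w) (f x) (hloopless _) (hdeg (f x)).1 f x rfl)
    (fun f x => deg_count (fun w => A w (f x)) (f x) (hloopless _) (hdeg (f x)).2 f x rfl)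
    (Fintype.equivOfCardEq hcard)
  refine ⟨fun i => List.ofFn fun j : Fin (m i) => f ⟨i, j⟩, fun i => ⟨⟨?_, ?_, ?_⟩, ?_⟩, ?_, ?_⟩
  · simpa using hm i
  · rw [List.nodup_ofFn]
    intro a b hab
    exact eq_of_heq (Sigma.mk.inj (f.injective hab)).2
  · intro j
    have hj : (j : ℕ) < m i := by simpa using j.2
    have := hf ⟨i, ⟨j, hj⟩⟩
    have e : σ ⟨i, ⟨j, hj⟩⟩ = ⟨i, ⟨((j : ℕ) + 1) % m i, Nat.mod_lt _ (by omega)⟩⟩ := by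
      have : finRotate (m i) ⟨j, hj⟩ = ⟨((j : ℕ) + 1) % m i, Nat.mod_lt _ (by omega)⟩ :=
        Fin.ext (finRotate_val' _ _)
      exact congrArg (Sigma.mk i) this
    rw [e] at this
    simpa using this
  · simp
  · intro i j hij v hv hv'
    rw [List.mem_ofFn] at hv hv'
    obtain ⟨a, rfl⟩ := hv
    obtain ⟨b, hb⟩ := hv'
    have := f.injective hb
    exact hij (congrArg Sigma.fst this).symm
  · intro v
    refine ⟨(f.symm v).1, ?_⟩
    rw [List.mem_ofFn]
    exact ⟨(f.symm v).2, by simp⟩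
end
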